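/- arXiv:2407.12546 — 4 statements merged into one kernel-verified Lean document; each statement's English description precedes it below -/
import Mathlib

section
/- Let n ≥ 17. Every irreducible finite-dimensional continuous real representation of SO_n(ℝ) of dimension exactly (n−1)(n+2)/2 is isomorphic to Sym²₀(ℝⁿ), the space of real symmetric traceless n×n matrices with the conjugation action Q·X = QXQᵀ. -/
open Matrix Topology

/-- `SOn n` is the set of real `n × n` special orthogonal matrices. -/
def SOn (n : ℕ) : Set (Matrix (Fin n) (Fin n) ℝ) :=
  {Q | Qᵀ * Q = 1 ∧ Q.det = 1}

/-- `Sym²₀(ℝⁿ)`: the space of real symmetric traceless `n × n` matrices. -/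
def symTraceless (n : ℕ) : Submodule ℝ (Matrix (Fin n) (Fin n) ℝ) where
  carrier := {X | Xᵀ = X ∧ X.trace = 0}
  add_mem' := fun hX hY =>
    ⟨by rw [Matrix.transpose_add, hX.1, hY.1], by rw [Matrix.trace_add, hX.2, hY.2, add_zero]⟩
  zero_mem' := ⟨by simp, by simp⟩
  smul_mem' := fun c X hX =>
    ⟨by rw [Matrix.transpose_smul, hX.1], by rw [Matrix.trace_smul, hX.2, smul_zero]⟩

/-- The group `SO_n(ℝ)` as a subtype of matrices. -/
abbrev SOGroup (n : ℕ) := Matrix.specialUnitaryGroup (Fin n) ℝ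

namespace SOGroup

variable {n : ℕ}

/-- The `k`-th standard basis vector of `ℝⁿ`. -/
abbrev stdVec (k : Fin n) : Fin n → ℝ := Pi.single k 1

theorem mem_iff_transpose {Q : Matrix (Fin n) (Fin n) ℝ} :
    Q ∈ Matrix.specialUnitaryGroup (Fin n) ℝ ↔ Qᵀ * Q = 1 ∧ Q.det = 1 := by
  rw [Matrix.mem_specialUnitaryGroup_iff, Matrix.mem_unitaryGroup_iff',
    Matrix.star_eq_conjTranspose, Matrix.conjTranspose_eq_transpose_of_trivial]

theorem transpose_mul_self (Q : SOGroup n) : (Q : Matrix (Fin n) (Fin n) ℝ)ᵀ * Q.1 = 1 :=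
  (mem_iff_transpose.1 Q.2).1

theorem mul_transpose_self (Q : SOGroup n) : (Q : Matrix (Fin n) (Fin n) ℝ) * Q.1ᵀ = 1 :=
  mul_eq_one_comm.1 (transpose_mul_self Q)

theorem coe_inv (Q : SOGroup n) : ((Q⁻¹ : SOGroup n) : Matrix (Fin n) (Fin n) ℝ) = Q.1ᵀ := by
  have h : ((Q⁻¹ : SOGroup n) : Matrix (Fin n) (Fin n) ℝ) * Q.1 = 1 :=
    congrArg Subtype.val (inv_mul_cancel Q)
  calc ((Q⁻¹ : SOGroup n) : Matrix (Fin n) (Fin n) ℝ)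
      = (Q⁻¹ : SOGroup n).1 * (Q.1 * Q.1ᵀ) := by rw [mul_transpose_self, mul_one]
    _ = Q.1ᵀ := by rw [← mul_assoc, h, one_mul]

theorem dotProduct_mulVec_mulVec (Q : SOGroup n) (x y : Fin n → ℝ) :
    (Q.1 *ᵥ x) ⬝ᵥ (Q.1 *ᵥ y) = x ⬝ᵥ y := by
  rw [Matrix.dotProduct_mulVec, Matrix.vecMul_mulVec, transpose_mul_self, Matrix.vecMul_one]

theorem ext_mulVec {Q R : SOGroup n} (h : ∀ x, Q.1 *ᵥ x = R.1 *ᵥ x) : Q = R :=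
  Subtype.ext (Matrix.ext_of_mulVec_single fun _ => h _)

theorem coe_mul_mulVec (Q R : SOGroup n) (x : Fin n → ℝ) :
    (Q * R).1 *ᵥ x = Q.1 *ᵥ (R.1 *ᵥ x) := by
  rw [Matrix.mulVec_mulVec]; rfl

theorem one_mulVec (x : Fin n → ℝ) : (1 : SOGroup n).1 *ᵥ x = x := Matrix.one_mulVec x

/-- If `Q x = y` then `Q⁻¹ y = x`. -/
theorem inv_mulVec_of_mulVec {Q : SOGroup n} {x y : Fin n → ℝ} (h : Q.1 *ᵥ x = y) :
    (Q⁻¹).1 *ᵥ y = x := by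
  rw [← h, ← coe_mul_mulVec, inv_mul_cancel, one_mulVec]

/-- The matrix of the rotation by `θ` in the oriented coordinate plane `(k, l)`. -/
noncomputable def rotMatrix (k l : Fin n) (θ : ℝ) : Matrix (Fin n) (Fin n) ℝ :=
  Matrix.of fun i j =>
    if i = k then (if j = k then Real.cos θ else 0) - (if j = l then Real.sin θ else 0)
    else if i = l then (if j = k then Real.sin θ else 0) + (if j = l then Real.cos θ else 0)
    else if j = i then 1 else 0

theorem rotMatrix_mulVec (k l : Fin n) (θ : ℝ) (x : Fin n → ℝ) (i : Fin n) :
    (rotMatrix k l θ *ᵥ x) i =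
      if i = k then Real.cos θ * x k - Real.sin θ * x l
      else if i = l then Real.sin θ * x k + Real.cos θ * x l else x i := by
  simp only [Matrix.mulVec, dotProduct, rotMatrix, Matrix.of_apply]
  split_ifs <;> simp [sub_mul, add_mul, Finset.sum_sub_distrib, Finset.sum_add_distrib, ite_mul]

theorem rotMatrix_mul {k l : Fin n} (h : k ≠ l) (θ φ : ℝ) :
    rotMatrix k l θ * rotMatrix k l φ = rotMatrix k l (θ + φ) := by
  refine Matrix.ext_of_mulVec_single fun j => ?_
  rw [← Matrix.mulVec_mulVec]
  ext i
  simp only [rotMatrix_mulVec, h, h.symm, if_true, if_false, Real.cos_add, Real.sin_add]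
  split_ifs <;> ring

theorem rotMatrix_zero (k l : Fin n) : rotMatrix k l 0 = 1 := by
  refine Matrix.ext_of_mulVec_single fun j => ?_
  ext i
  rw [rotMatrix_mulVec, Matrix.one_mulVec]
  simp only [Real.cos_zero, Real.sin_zero]
  split_ifs with h1 h2
  · subst h1; ring
  · subst h2; ring
  · rfl

theorem rotMatrix_transpose {k l : Fin n} (h : k ≠ l) (θ : ℝ) :
    (rotMatrix k l θ)ᵀ = rotMatrix k l (-θ) := by
  ext i j
  simp only [Matrix.transpose_apply, rotMatrix, Matrix.of_apply, Real.cos_neg, Real.sin_neg]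
  by_cases hik : i = k
  · subst hik
    by_cases hji : j = i
    · subst hji; simp [h]
    · by_cases hjl : j = l
      · subst hjl; simp [h, h.symm]
      · simp [hji, hjl, Ne.symm hji]
  · by_cases hil : i = l
    · subst hil
      by_cases hjk : j = k
      · subst hjk; simp [h, h.symm]
      · by_cases hji : j = i
        · subst hji; simp [hjk]
        · simp [hjk, hji, hik, Ne.symm hji]
    · by_cases hjk : j = k
      · subst hjk; simp [hik, hil, Ne.symm hik]
      · by_cases hjl : j = l
        · subst hjl; simp [hik, hil, hjk, Ne.symm hil]
        · simp [hik, hil, hjk, hjl, eq_comm]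

theorem rotMatrix_mem {k l : Fin n} (h : k ≠ l) (θ : ℝ) :
    rotMatrix k l θ ∈ Matrix.specialUnitaryGroup (Fin n) ℝ := by
  have ho : ∀ φ, (rotMatrix k l φ)ᵀ * rotMatrix k l φ = 1 := fun φ => by
    rw [rotMatrix_transpose h, rotMatrix_mul h, neg_add_cancel, rotMatrix_zero]
  refine mem_iff_transpose.2 ⟨ho θ, ?_⟩
  have hd := congrArg Matrix.det (ho (θ / 2))
  rw [Matrix.det_mul, Matrix.det_transpose, Matrix.det_one] at hd
  rw [← add_halves θ, ← rotMatrix_mul h, Matrix.det_mul, hd]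

open Classical in
/-- The rotation by `θ` in the oriented coordinate plane `(k, l)`, for `k ≠ l`. -/
noncomputable def rot (k l : Fin n) (θ : ℝ) : SOGroup n :=
  if h : k ≠ l then ⟨rotMatrix k l θ, rotMatrix_mem h θ⟩ else 1

theorem rot_mulVec {k l : Fin n} (h : k ≠ l) (θ : ℝ) (x : Fin n → ℝ) (i : Fin n) :
    ((rot k l θ).1 *ᵥ x) i =
      if i = k then Real.cos θ * x k - Real.sin θ * x l
      else if i = l then Real.sin θ * x k + Real.cos θ * x l else x i := by
  rw [rot, dif_pos h, rotMatrix_mulVec]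

theorem rot_mul {k l : Fin n} (h : k ≠ l) (θ φ : ℝ) :
    rot k l θ * rot k l φ = rot k l (θ + φ) := by
  simp only [rot, dif_pos h]
  exact Subtype.ext (rotMatrix_mul h θ φ)

theorem rot_zero (k l : Fin n) : rot k l 0 = 1 := by
  unfold rot
  split_ifs with h
  · exact Subtype.ext (rotMatrix_zero k l)
  · rfl

theorem rot_inv {k l : Fin n} (h : k ≠ l) (θ : ℝ) : (rot k l θ)⁻¹ = rot k l (-θ) :=
  inv_eq_of_mul_eq_one_right (by rw [rot_mul h, add_neg_cancel, rot_zero])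

theorem rot_mulVec_stdVec_left {k l : Fin n} (h : k ≠ l) (θ : ℝ) :
    (rot k l θ).1 *ᵥ stdVec k = Real.cos θ • stdVec k + Real.sin θ • stdVec l := by
  ext i
  rw [rot_mulVec h]
  by_cases h1 : i = k
  · subst h1; simp [h]
  · by_cases h2 : i = l
    · subst h2; simp [h.symm]
    · simp [h1, h2]

theorem rot_mulVec_stdVec_right {k l : Fin n} (h : k ≠ l) (θ : ℝ) :
    (rot k l θ).1 *ᵥ stdVec l = -Real.sin θ • stdVec k + Real.cos θ • stdVec l := by
  ext i
  rw [rot_mulVec h]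
  by_cases h1 : i = k
  · subst h1; simp [h]
  · by_cases h2 : i = l
    · subst h2; simp [h.symm]
    · simp [h1, h2]

theorem rot_mulVec_stdVec_of_ne {k l j : Fin n} (h : k ≠ l) (hk : j ≠ k) (hl : j ≠ l) (θ : ℝ) :
    (rot k l θ).1 *ᵥ stdVec j = stdVec j := by
  ext i
  rw [rot_mulVec h]
  by_cases h1 : i = k
  · subst h1; simp [hk.symm, hl.symm]
  · by_cases h2 : i = l
    · subst h2; simp [hk.symm, hl.symm]
    · simp [h1, h2]

/-! ### Sign changes -/

/-- The sign of the `i`-th coordinate attached to a set `S` of coordinates. -/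
def sgn (S : Finset (Fin n)) (i : Fin n) : ℝ := if i ∈ S then -1 else 1

theorem sgn_mul_self (S : Finset (Fin n)) (i : Fin n) : sgn S i * sgn S i = 1 := by
  unfold sgn; split_ifs <;> norm_num

/-- The diagonal matrix changing the sign of the coordinates `i` and `j`
(the identity if `i = j`). -/
noncomputable def flip (i j : Fin n) : SOGroup n :=
  ⟨Matrix.diagonal fun k => sgn {i} k * sgn {j} k, by
    rw [mem_iff_transpose, Matrix.diagonal_transpose, Matrix.diagonal_mul_diagonal,
      Matrix.det_diagonal]
    constructor
    · rw [← Matrix.diagonal_one]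
      congr 1
      ext k
      rw [mul_mul_mul_comm, sgn_mul_self, sgn_mul_self, one_mul]
    · rw [Finset.prod_mul_distrib]
      simp [sgn, Finset.prod_ite_eq']⟩

theorem flip_mulVec (i j : Fin n) (x : Fin n → ℝ) (k : Fin n) :
    ((flip i j).1 *ᵥ x) k = sgn {i} k * sgn {j} k * x k := by
  simp [flip, Matrix.mulVec_diagonal]

theorem flip_self (i : Fin n) : flip i i = 1 :=
  ext_mulVec fun x => by
    ext k
    rw [flip_mulVec, sgn_mul_self, one_mul, one_mulVec]

theorem flip_mul_flip (i j k : Fin n) : flip i j * flip j k = flip i k :=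
  ext_mulVec fun x => by
    ext m
    rw [coe_mul_mulVec, flip_mulVec, flip_mulVec, flip_mulVec]
    linear_combination sgn {i} m * sgn {k} m * x m * sgn_mul_self {j} m

theorem flip_comm (i j : Fin n) : flip i j = flip j i :=
  ext_mulVec fun x => by
    ext k
    rw [flip_mulVec, flip_mulVec, mul_comm (sgn {i} k)]

theorem flip_commute (i j k l : Fin n) : flip i j * flip k l = flip k l * flip i j :=
  ext_mulVec fun x => by
    ext m
    rw [coe_mul_mulVec, coe_mul_mulVec]
    simp only [flip_mulVec]
    ring

theorem flip_sq (i j : Fin n) : flip i j * flip i j = 1 := by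
  nth_rw 2 [flip_comm]
  rw [flip_mul_flip, flip_self]

theorem flip_mulVec_stdVec (i j k : Fin n) :
    (flip i j).1 *ᵥ stdVec k = (sgn {i} k * sgn {j} k) • stdVec k := by
  ext m
  rw [flip_mulVec]
  by_cases h : m = k
  · subst h; simp
  · simp [h]

theorem rot_pi {k l : Fin n} (h : k ≠ l) : rot k l Real.pi = flip k l :=
  ext_mulVec fun x => by
    ext m
    rw [rot_mulVec h, flip_mulVec]
    by_cases h1 : m = k
    · subst h1; simp [sgn, h]
    · by_cases h2 : m = l
      · subst h2; simp [sgn, h.symm]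
      · simp [sgn, h1, h2]

theorem rot_commute_flip {k l i j : Fin n} (h : k ≠ l) (hik : i ≠ k) (hil : i ≠ l)
    (hjk : j ≠ k) (hjl : j ≠ l) (θ : ℝ) : flip i j * rot k l θ = rot k l θ * flip i j :=
  ext_mulVec fun x => by
    ext m
    rw [coe_mul_mulVec, coe_mul_mulVec]
    simp only [flip_mulVec, rot_mulVec h]
    by_cases h1 : m = k
    · subst h1; simp [sgn, hik.symm, hjk.symm, hil.symm, hjl.symm]
    · by_cases h2 : m = l
      · subst h2; simp [sgn, hik.symm, hjk.symm, hil.symm, hjl.symm]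
      · simp [h1, h2]

theorem rot_commute_flip_self {k l : Fin n} (h : k ≠ l) (θ : ℝ) :
    flip k l * rot k l θ = rot k l θ * flip k l := by
  rw [← rot_pi h, rot_mul h, rot_mul h, add_comm]

theorem flip_mul_rot {k l j : Fin n} (h : k ≠ l) (hjk : j ≠ k) (hjl : j ≠ l) (θ : ℝ) :
    flip k j * rot k l θ = rot k l (-θ) * flip k j :=
  ext_mulVec fun x => by
    ext m
    rw [coe_mul_mulVec, coe_mul_mulVec]
    simp only [flip_mulVec, rot_mulVec h, Real.cos_neg, Real.sin_neg]
    by_cases h1 : m = k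
    · subst h1; simp [sgn, h.symm, hjk.symm, hjl.symm]; ring
    · by_cases h2 : m = l
      · subst h2; simp [sgn, h.symm, hjk.symm, hjl.symm]
      · simp [h1, h2]

theorem flip_mul_rot_half_pi {k l : Fin n} (h : k ≠ l) (i j : Fin n) :
    flip (Equiv.swap k l i) (Equiv.swap k l j) * rot k l (Real.pi / 2)
      = rot k l (Real.pi / 2) * flip i j := by
  have key : ∀ a m, sgn {Equiv.swap k l a} m = sgn {a} (Equiv.swap k l m) := by
    intro a m
    simp only [sgn, Finset.mem_singleton]
    congr 1
    rw [eq_iff_iff]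
    constructor
    · rintro rfl; simp
    · rintro rfl; simp
  refine ext_mulVec fun x => ?_
  ext m
  rw [coe_mul_mulVec, coe_mul_mulVec]
  simp only [flip_mulVec, rot_mulVec h, key, Real.cos_pi_div_two, Real.sin_pi_div_two]
  by_cases h1 : m = k
  · subst h1; simp
  · by_cases h2 : m = l
    · subst h2; simp [h.symm]
    · simp [h1, h2, Equiv.swap_apply_of_ne_of_ne h1 h2]

/-! ### Generation by coordinate rotations -/

/-- The subgroup generated by the rotations in coordinate planes avoiding `J`. -/
def rotSubgroup (J : Finset (Fin n)) : Subgroup (SOGroup n) :=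
  Subgroup.closure {Q | ∃ k l θ, k ∉ J ∧ l ∉ J ∧ k ≠ l ∧ Q = rot k l θ}

theorem rot_mem_rotSubgroup {J : Finset (Fin n)} {k l : Fin n} (hk : k ∉ J) (hl : l ∉ J)
    (h : k ≠ l) (θ : ℝ) : rot k l θ ∈ rotSubgroup J :=
  Subgroup.subset_closure ⟨k, l, θ, hk, hl, h, rfl⟩

theorem rotSubgroup_le {J : Finset (Fin n)} {H : Subgroup (SOGroup n)}
    (hH : ∀ k l θ, k ∉ J → l ∉ J → k ≠ l → rot k l θ ∈ H) : rotSubgroup J ≤ H := by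
  refine (Subgroup.closure_le _).2 ?_
  rintro _ ⟨k, l, θ, hk, hl, h, rfl⟩
  exact hH k l θ hk hl h

theorem mulVec_stdVec_of_mem_rotSubgroup {J : Finset (Fin n)} {Q : SOGroup n}
    (hQ : Q ∈ rotSubgroup J) {j : Fin n} (hj : j ∈ J) : Q.1 *ᵥ stdVec j = stdVec j := by
  let H : Subgroup (SOGroup n) :=
    { carrier := {Q | Q.1 *ᵥ stdVec j = stdVec j}
      mul_mem' := fun {a b} ha hb => by
        change (a * b).1 *ᵥ stdVec j = stdVec j
        rw [coe_mul_mulVec, hb, ha]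
      one_mem' := one_mulVec _
      inv_mem' := fun {a} ha => inv_mulVec_of_mulVec ha }
  refine rotSubgroup_le (H := H) (fun k l θ hk hl h => ?_) hQ
  exact rot_mulVec_stdVec_of_ne h (fun e => hk (e ▸ hj)) (fun e => hl (e ▸ hj)) θ

theorem exists_polar (a b : ℝ) : ∃ r θ : ℝ, a = r * Real.cos θ ∧ b = r * Real.sin θ :=
  ⟨‖(⟨a, b⟩ : ℂ)‖, Complex.arg ⟨a, b⟩, (Complex.norm_mul_cos_arg ⟨a, b⟩).symm,
    (Complex.norm_mul_sin_arg ⟨a, b⟩).symm⟩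

theorem exists_mem_rotSubgroup_forall_eq_zero {J : Finset (Fin n)} {k : Fin n} (hk : k ∉ J)
    (x : Fin n → ℝ) (A : Finset (Fin n)) (hA : ∀ a ∈ A, a ∉ J ∧ a ≠ k) :
    ∃ g ∈ rotSubgroup J, (∀ i ∈ A, (g.1 *ᵥ x) i = 0) ∧
      ∀ i, i ∉ A → i ≠ k → (g.1 *ᵥ x) i = x i := by
  classical
  induction A using Finset.induction_on with
  | empty => exact ⟨1, one_mem _, by simp, fun i _ _ => by rw [one_mulVec]⟩
  | insert l A hl ih =>
    obtain ⟨g, hg, hg0, hg1⟩ := ih fun a ha => hA a (Finset.mem_insert_of_mem ha)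
    obtain ⟨hlJ, hlk⟩ := hA l (Finset.mem_insert_self _ _)
    obtain ⟨r, θ, hr, hr'⟩ := exists_polar ((g.1 *ᵥ x) k) ((g.1 *ᵥ x) l)
    refine ⟨rot k l (-θ) * g, mul_mem (rot_mem_rotSubgroup hk hlJ hlk.symm _) hg, ?_, ?_⟩
    · intro i hi
      rw [coe_mul_mulVec, rot_mulVec hlk.symm]
      rw [if_neg (hA i hi).2]
      split_ifs with hil
      · rw [hr, hr', Real.cos_neg, Real.sin_neg]; ring
      · exact hg0 i ((Finset.mem_insert.1 hi).resolve_left hil)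
    · intro i hi hik
      rw [Finset.mem_insert, not_or] at hi
      rw [coe_mul_mulVec, rot_mulVec hlk.symm, if_neg hik, if_neg hi.1, hg1 i hi.2 hik]

/-- The rotations avoiding `J` act transitively on the unit vectors supported off `J`. -/
theorem exists_mem_rotSubgroup_mulVec_stdVec {J : Finset (Fin n)} {k l : Fin n} (hk : k ∉ J)
    (hl : l ∉ J) (hkl : k ≠ l) {x : Fin n → ℝ} (hx : x ⬝ᵥ x = 1) (hxJ : ∀ j ∈ J, x j = 0) :
    ∃ g ∈ rotSubgroup J, g.1 *ᵥ stdVec k = x := by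
  classical
  obtain ⟨g, hg, hg0, hg1⟩ := exists_mem_rotSubgroup_forall_eq_zero hk x
    ((Finset.univ \ J).erase k) (fun a ha => by simp at ha; exact ⟨ha.2, ha.1⟩)
  have hz : ∀ i, i ≠ k → (g.1 *ᵥ x) i = 0 := fun i hik => by
    by_cases hi : i ∈ J
    · rw [hg1 i (by simp [hi]) hik, hxJ i hi]
    · exact hg0 i (by simp [hi, hik])
  set t := (g.1 *ᵥ x) k with ht
  have hgx : g.1 *ᵥ x = t • stdVec k := by
    ext i
    by_cases hik : i = k
    · subst hik; simp [ht]
    · rw [hz i hik]; simp [hik]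
  have ht2 : t * t = 1 := by
    have := dotProduct_mulVec_mulVec g x x
    rw [hx, hgx] at this
    simpa using this
  rcases mul_self_eq_one_iff.1 ht2 with h1 | h1
  · refine ⟨g⁻¹, inv_mem hg, inv_mulVec_of_mulVec ?_⟩
    rw [hgx, h1, one_smul]
  · refine ⟨(rot k l Real.pi * g)⁻¹,
      inv_mem (mul_mem (rot_mem_rotSubgroup hk hl hkl _) hg), inv_mulVec_of_mulVec ?_⟩
    rw [coe_mul_mulVec, hgx, Matrix.mulVec_smul, rot_mulVec_stdVec_left hkl, h1]
    simp

theorem mulVec_stdVec_apply (Q : SOGroup n) (i k : Fin n) : (Q.1 *ᵥ stdVec k) i = Q.1 i k := by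
  simp [Matrix.col]

theorem eq_one_of_forall_ne {Q : SOGroup n} (k : Fin n)
    (hQ : ∀ j, j ≠ k → Q.1 *ᵥ stdVec j = stdVec j) : Q = 1 := by
  have hentry : ∀ i j, Q.1 i j = Matrix.diagonal (fun i => if i = k then Q.1 k k else 1) i j := by
    intro i j
    by_cases hj : j = k
    · subst hj
      by_cases hi : i = j
      · subst hi; simp
      · have h := dotProduct_mulVec_mulVec Q (stdVec i) (stdVec j)
        rw [hQ i hi] at h
        rw [Matrix.diagonal_apply_ne _ hi]
        simpa [hi] using h
    · rw [← mulVec_stdVec_apply, hQ j hj]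
      by_cases hi : i = j
      · subst hi; simp [hj]
      · simp [hi]
  have hdiag : Q.1 = Matrix.diagonal (fun i => if i = k then Q.1 k k else 1) :=
    Matrix.ext hentry
  have hdet : Q.1 k k = 1 := by
    have h := (mem_iff_transpose.1 Q.2).2
    rw [hdiag, Matrix.det_diagonal] at h
    simpa using h
  refine Subtype.ext ?_
  rw [hdiag, hdet]
  simp

/-- A special orthogonal matrix fixing the basis vectors indexed by `J` is a product of rotations
in coordinate planes avoiding `J`. -/
theorem mem_rotSubgroup_of_fix (J : Finset (Fin n)) (Q : SOGroup n)
    (hQ : ∀ j ∈ J, Q.1 *ᵥ stdVec j = stdVec j) : Q ∈ rotSubgroup J := by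
  classical
  by_cases hJ : ∃ k l, k ∉ J ∧ l ∉ J ∧ k ≠ l
  · obtain ⟨k, l, hk, hl, hkl⟩ := hJ
    have hx : (Q.1 *ᵥ stdVec k) ⬝ᵥ (Q.1 *ᵥ stdVec k) = 1 := by
      rw [dotProduct_mulVec_mulVec]; simp
    have hxJ : ∀ j ∈ J, (Q.1 *ᵥ stdVec k) j = 0 := fun j hj => by
      have h := dotProduct_mulVec_mulVec Q (stdVec j) (stdVec k)
      rw [hQ j hj] at h
      have hjk : j ≠ k := fun e => hk (e ▸ hj)
      simpa [hjk] using h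
    obtain ⟨g, hg, hgx⟩ := exists_mem_rotSubgroup_mulVec_stdVec hk hl hkl hx hxJ
    have hfix : ∀ j ∈ insert k J, (g⁻¹ * Q).1 *ᵥ stdVec j = stdVec j := fun j hj => by
      rw [coe_mul_mulVec]
      rcases Finset.mem_insert.1 hj with rfl | hj
      · exact inv_mulVec_of_mulVec hgx
      · rw [hQ j hj]
        exact mulVec_stdVec_of_mem_rotSubgroup (inv_mem hg) hj
    have ih := mem_rotSubgroup_of_fix (insert k J) (g⁻¹ * Q) hfix
    have hle : rotSubgroup (insert k J) ≤ rotSubgroup J :=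
      rotSubgroup_le fun a b θ ha hb hab => rot_mem_rotSubgroup
        (fun h => ha (Finset.mem_insert_of_mem h)) (fun h => hb (Finset.mem_insert_of_mem h)) hab θ
    have := mul_mem hg (hle ih)
    rwa [mul_inv_cancel_left] at this
  · push Not at hJ
    have hone : Q = 1 := by
      by_cases hk : ∃ k, k ∉ J
      · obtain ⟨k, hk⟩ := hk
        refine eq_one_of_forall_ne k fun j hj => hQ j ?_
        by_contra hjJ
        exact hj (hJ j k hjJ hk)
      · push Not at hk
        exact Subtype.ext (Matrix.ext_of_mulVec_single fun j => by
          rw [hQ j (hk j)]; exact (one_mulVec _).symm)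
    rw [hone]
    exact one_mem _
termination_by (Finset.univ \ J).card
decreasing_by
  apply Finset.card_lt_card
  rw [Finset.ssubset_iff_of_subset (Finset.sdiff_subset_sdiff le_rfl (Finset.subset_insert _ _))]
  exact ⟨k, by simp [hk], by simp⟩

/-- Orthonormal pairs are completed to special orthogonal matrices. -/
theorem exists_mulVec_stdVec_pair {p q r : Fin n} (hpq : p ≠ q) (hrp : r ≠ p) (hrq : r ≠ q)
    {x y : Fin n → ℝ} (hx : x ⬝ᵥ x = 1) (hy : y ⬝ᵥ y = 1) (hxy : x ⬝ᵥ y = 0) :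
    ∃ Q : SOGroup n, Q.1 *ᵥ stdVec p = x ∧ Q.1 *ᵥ stdVec q = y := by
  obtain ⟨g, -, hg⟩ := exists_mem_rotSubgroup_mulVec_stdVec (J := ∅) (by simp) (by simp) hpq hx
    (by simp)
  have hg' : (g⁻¹).1 *ᵥ x = stdVec p := inv_mulVec_of_mulVec hg
  obtain ⟨h, hh, hhy⟩ := exists_mem_rotSubgroup_mulVec_stdVec (J := {p}) (k := q) (l := r)
    (x := (g⁻¹).1 *ᵥ y) (by simpa using hpq.symm) (by simpa using hrp) hrq.symm
    (by rw [dotProduct_mulVec_mulVec, hy]) (by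
      have := dotProduct_mulVec_mulVec g⁻¹ x y
      rw [hxy, hg'] at this
      simpa using this)
  refine ⟨g * h, ?_, ?_⟩
  · rw [coe_mul_mulVec, mulVec_stdVec_of_mem_rotSubgroup hh (by simp), hg]
  · rw [coe_mul_mulVec, hhy, ← coe_mul_mulVec, mul_inv_cancel, one_mulVec]

end SOGroup

namespace SOGroup

variable {n : ℕ}

/-! ### Weight spaces of the sign changes -/

theorem sgn_compl (S : Finset (Fin n)) (i : Fin n) : sgn Sᶜ i = -sgn S i := by
  unfold sgn
  by_cases h : i ∈ S <;> simp [h]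

theorem sgn_symmDiff_pair_of_mem {S : Finset (Fin n)} {k l i : Fin n} (h : i = k ∨ i = l) :
    sgn (symmDiff S {k, l}) i = -sgn S i := by
  unfold sgn
  by_cases hi : i ∈ S <;> simp [Finset.mem_symmDiff, hi, h]

theorem sgn_symmDiff_pair_of_ne {S : Finset (Fin n)} {k l i : Fin n} (hk : i ≠ k) (hl : i ≠ l) :
    sgn (symmDiff S {k, l}) i = sgn S i := by
  unfold sgn
  simp [Finset.mem_symmDiff, hk, hl]

variable {V : Type*} [AddCommGroup V] [Module ℝ V] (ρ : SOGroup n →* Module.End ℝ V)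

theorem rep_mul_apply (Q R : SOGroup n) (v : V) : ρ (Q * R) v = ρ Q (ρ R v) := by
  rw [map_mul]; rfl

theorem rep_one_apply (v : V) : ρ 1 v = v := by
  rw [map_one]; rfl

theorem rep_inv_apply_apply (Q : SOGroup n) (v : V) : ρ Q⁻¹ (ρ Q v) = v := by
  rw [← rep_mul_apply, inv_mul_cancel, rep_one_apply]

theorem rep_injective (Q : SOGroup n) : Function.Injective (ρ Q) :=
  Function.LeftInverse.injective (g := ρ Q⁻¹) (rep_inv_apply_apply ρ Q)

/-- The vectors on which sign changes act through the character attached to `S`. -/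
def weightSpace (S : Finset (Fin n)) : Submodule ℝ V where
  carrier := {v | ∀ i j, ρ (flip i j) v = (sgn S i * sgn S j) • v}
  add_mem' := fun {a b} ha hb i j => by rw [map_add, ha i j, hb i j, smul_add]
  zero_mem' := fun i j => by rw [map_zero, smul_zero]
  smul_mem' := fun c v hv i j => by rw [map_smul, hv i j, smul_comm]

variable {ρ}

theorem mem_weightSpace {S : Finset (Fin n)} {v : V} :
    v ∈ weightSpace ρ S ↔ ∀ i j, ρ (flip i j) v = (sgn S i * sgn S j) • v := Iff.rfl

theorem mem_weightSpace_of_ref {S : Finset (Fin n)} {v : V} (z : Fin n)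
    (h : ∀ j, ρ (flip z j) v = (sgn S z * sgn S j) • v) : v ∈ weightSpace ρ S := by
  intro i j
  rw [← flip_mul_flip i z j, rep_mul_apply, h j, map_smul, flip_comm i z, h i, smul_smul]
  congr 1
  linear_combination sgn S i * sgn S j * sgn_mul_self S z

variable (ρ) in
theorem weightSpace_compl (S : Finset (Fin n)) : weightSpace ρ Sᶜ = weightSpace ρ S := by
  ext v
  simp only [mem_weightSpace, sgn_compl, neg_mul_neg]

/-- A rotation in the plane `(k, l)` mixes the weight `S` only with `S ∆ {k, l}`. -/
theorem exists_rot_apply_eq_add {S : Finset (Fin n)} {v : V} (hv : v ∈ weightSpace ρ S)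
    {k l z : Fin n} (hkl : k ≠ l) (hzk : z ≠ k) (hzl : z ≠ l) (θ : ℝ) :
    ∃ y₁ ∈ weightSpace ρ S, ∃ y₂ ∈ weightSpace ρ (symmDiff S {k, l}),
      ρ (rot k l θ) v = y₁ + y₂ := by
  set y := ρ (rot k l θ) v with hy
  set c := sgn S k * sgn S z with hc
  have hcc : c * c = 1 := by
    rw [hc, mul_mul_mul_comm, sgn_mul_self, sgn_mul_self, one_mul]
  have hykl : ρ (flip k l) y = (sgn S k * sgn S l) • y := by
    rw [hy, ← rep_mul_apply, rot_commute_flip_self hkl, rep_mul_apply, hv, map_smul]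
  have hyj : ∀ j, j ≠ k → j ≠ l → ρ (flip z j) y = (sgn S z * sgn S j) • y := by
    intro j hjk hjl
    rw [hy, ← rep_mul_apply, rot_commute_flip hkl hzk hzl hjk hjl, rep_mul_apply, hv, map_smul]
  set w := ρ (flip z k) y with hw
  have hwk : ρ (flip z k) w = y := by
    rw [hw, ← rep_mul_apply, flip_sq, rep_one_apply]
  have hwkl : ρ (flip k l) w = (sgn S k * sgn S l) • w := by
    rw [hw, ← rep_mul_apply, flip_commute, rep_mul_apply, hykl, map_smul]
  have hwj : ∀ j, j ≠ k → j ≠ l → ρ (flip z j) w = (sgn S z * sgn S j) • w := by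
    intro j hjk hjl
    rw [hw, ← rep_mul_apply, flip_commute, rep_mul_apply, hyj j hjk hjl, map_smul]
  have hl : ∀ x : V, ρ (flip z l) x = ρ (flip z k) (ρ (flip k l) x) := fun x => by
    rw [← rep_mul_apply, flip_mul_flip]
  have hzz : sgn S z * sgn S z = 1 := sgn_mul_self S z
  have hkk : sgn S k * sgn S k = 1 := sgn_mul_self S k
  refine ⟨(2⁻¹ : ℝ) • (y + c • w), ?_, (2⁻¹ : ℝ) • (y - c • w), ?_, ?_⟩
  · refine mem_weightSpace_of_ref z fun j => ?_
    by_cases hjk : j = k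
    · subst hjk
      simp only [map_smul, map_add, hwk, ← hw]
      rw [smul_comm (sgn S z * sgn S j)]
      congr 1
      rw [smul_add, smul_smul, mul_comm (sgn S z), ← hc, hcc, one_smul, add_comm]
    · by_cases hjl : j = l
      · subst hjl
        simp only [hl, map_smul, map_add, hykl, hwkl, hwk, ← hw]
        rw [smul_comm (sgn S z * sgn S j)]
        congr 1
        simp only [smul_add, smul_smul]
        rw [add_comm]
        congr 2
        · rw [hc]; linear_combination sgn S z * sgn S j * hkk
        · rw [hc]; linear_combination -sgn S k * sgn S j * hzz
      · simp only [map_smul, map_add, hyj j hjk hjl, hwj j hjk hjl]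
        simp only [smul_add, smul_smul]
        congr 2 <;> ring
  · refine mem_weightSpace_of_ref z fun j => ?_
    rw [sgn_symmDiff_pair_of_ne hzk hzl]
    by_cases hjk : j = k
    · subst hjk
      rw [sgn_symmDiff_pair_of_mem (Or.inl rfl)]
      simp only [map_smul, map_sub, hwk, ← hw]
      rw [smul_comm (sgn S z * -sgn S j)]
      congr 1
      rw [smul_sub, smul_smul, mul_neg, mul_comm (sgn S z), ← hc, neg_mul, hcc]
      module
    · by_cases hjl : j = l
      · subst hjl
        rw [sgn_symmDiff_pair_of_mem (Or.inr rfl)]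
        simp only [hl, map_smul, map_sub, hykl, hwkl, hwk, ← hw]
        rw [smul_comm (sgn S z * -sgn S j)]
        congr 1
        simp only [smul_sub, smul_smul]
        have e1 : c * (sgn S k * sgn S j) = sgn S z * sgn S j := by
          rw [hc]; linear_combination sgn S z * sgn S j * hkk
        have e2 : sgn S z * -sgn S j * c = -(sgn S k * sgn S j) := by
          rw [hc]; linear_combination -sgn S k * sgn S j * hzz
        rw [e1, e2]
        module
      · rw [sgn_symmDiff_pair_of_ne hjk hjl]
        simp only [map_smul, map_sub, hyj j hjk hjl, hwj j hjk hjl]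
        simp only [smul_sub, smul_smul]
        congr 2 <;> ring
  · module

/-! ### Symmetry of the weight multiplicities -/

theorem rot_half_pi_mem_weightSpace {S : Finset (Fin n)} {v : V} (hv : v ∈ weightSpace ρ S)
    {k l : Fin n} (hkl : k ≠ l) :
    ρ (rot k l (Real.pi / 2)) v ∈ weightSpace ρ (S.map (Equiv.swap k l).toEmbedding) := by
  intro i j
  have hs : ∀ a, sgn (S.map (Equiv.swap k l).toEmbedding) (Equiv.swap k l a) = sgn S a := by
    intro a
    simp [sgn]
  obtain ⟨i, rfl⟩ := (Equiv.swap k l).surjective i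
  obtain ⟨j, rfl⟩ := (Equiv.swap k l).surjective j
  rw [← rep_mul_apply, flip_mul_rot_half_pi hkl, rep_mul_apply, hv, map_smul, hs, hs]

variable (ρ) in
theorem finrank_weightSpace_le_map [FiniteDimensional ℝ V] (S : Finset (Fin n))
    (σ : Equiv.Perm (Fin n)) :
    Module.finrank ℝ (weightSpace ρ S) ≤ Module.finrank ℝ (weightSpace ρ (S.map σ.toEmbedding)) := by
  induction σ using Equiv.Perm.swap_induction_on with
  | one =>
    have : S.map (1 : Equiv.Perm (Fin n)).toEmbedding = S := Finset.map_refl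
    rw [this]
  | swap_mul f x y hxy ih =>
    have hmap : S.map (Equiv.swap x y * f).toEmbedding
        = (S.map f.toEmbedding).map (Equiv.swap x y).toEmbedding := by
      rw [Finset.map_map]; rfl
    rw [hmap]
    refine ih.trans ?_
    refine LinearMap.finrank_le_finrank_of_injective
      (f := (ρ (rot x y (Real.pi / 2))).restrict fun v hv => rot_half_pi_mem_weightSpace hv hxy) ?_
    intro a b hab
    exact Subtype.ext (rep_injective ρ _ (congrArg Subtype.val hab))

variable (ρ) in
theorem finrank_weightSpace_eq_of_card_eq [FiniteDimensional ℝ V] {S T : Finset (Fin n)}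
    (h : S.card = T.card) :
    Module.finrank ℝ (weightSpace ρ S) = Module.finrank ℝ (weightSpace ρ T) := by
  have key : ∀ {S T : Finset (Fin n)}, S.card = T.card →
      Module.finrank ℝ (weightSpace ρ S) ≤ Module.finrank ℝ (weightSpace ρ T) := by
    intro S T h
    let e := Finset.equivOfCardEq h
    have hmap : S.map e.extendSubtype.toEmbedding = T := by
      refine Finset.eq_of_subset_of_card_le (fun x hx => ?_) (by rw [Finset.card_map, h])
      obtain ⟨y, hy, rfl⟩ := Finset.mem_map.1 hx
      exact e.extendSubtype_mem y hy
    have := finrank_weightSpace_le_map ρ S e.extendSubtype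
    rwa [hmap] at this
  exact le_antisymm (key h) (key h.symm)

/-! ### The weight decomposition -/

variable (ρ) in
theorem span_partial_weight_eq_top (z : Fin n) (A : Finset (Fin n)) (hA : z ∉ A) :
    Submodule.span ℝ {w : V | ∃ S : Finset (Fin n), z ∉ S ∧
      ∀ j ∈ A, ρ (flip z j) w = sgn S j • w} = ⊤ := by
  induction A using Finset.induction_on with
  | empty =>
    refine eq_top_iff.2 fun v _ => Submodule.subset_span ⟨∅, by simp, by simp⟩
  | insert j A hj ih =>
    rw [Finset.mem_insert, not_or] at hA
    rw [eq_top_iff, ← ih hA.2, Submodule.span_le]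
    rintro w ⟨S, hzS, hw⟩
    set x := ρ (flip z j) w with hx
    have hxj : ρ (flip z j) x = w := by
      rw [hx, ← rep_mul_apply, flip_sq, rep_one_apply]
    have hxA : ∀ i ∈ A, ρ (flip z i) x = sgn S i • x := fun i hi => by
      rw [hx, ← rep_mul_apply, flip_commute, rep_mul_apply, hw i hi, map_smul]
    have hdec : w = (2⁻¹ : ℝ) • (w + x) + (2⁻¹ : ℝ) • (w - x) := by module
    rw [hdec]
    refine Submodule.add_mem _ (Submodule.smul_mem _ _ (Submodule.subset_span ?_))
      (Submodule.smul_mem _ _ (Submodule.subset_span ?_))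
    · refine ⟨S.erase j, fun h => hzS (Finset.mem_of_mem_erase h), fun i hi => ?_⟩
      by_cases hij : i = j
      · subst hij
        rw [map_add, hxj, ← hx]
        simp [sgn, add_comm]
      · have hiA := (Finset.mem_insert.1 hi).resolve_left hij
        rw [map_add, hw i hiA, hxA i hiA]
        simp [sgn, hij]
    · refine ⟨insert j S, by simp [hA.1, hzS], fun i hi => ?_⟩
      by_cases hij : i = j
      · subst hij
        rw [map_sub, hxj, ← hx]
        simp [sgn]
      · have hiA := (Finset.mem_insert.1 hi).resolve_left hij
        rw [map_sub, hw i hiA, hxA i hiA]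
        simp [sgn, hij, smul_sub]

variable (ρ) in
theorem iSup_weightSpace_eq_top (z : Fin n) :
    ⨆ S : {S : Finset (Fin n) // z ∉ S}, weightSpace ρ S.1 = ⊤ := by
  rw [eq_top_iff, ← span_partial_weight_eq_top ρ z (Finset.univ.erase z) (by simp),
    Submodule.span_le]
  rintro w ⟨S, hzS, hw⟩
  refine Submodule.mem_iSup_of_mem ⟨S, hzS⟩ (mem_weightSpace_of_ref z fun j => ?_)
  have hz : sgn S z = 1 := by simp [sgn, hzS]
  by_cases hj : j = z
  · subst hj
    rw [flip_self, rep_one_apply, hz, mul_one, one_smul]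
  · rw [hw j (by simp [hj]), hz, one_mul]

variable (ρ) in
theorem iSupIndep_weightSpace (z : Fin n) :
    iSupIndep fun S : {S : Finset (Fin n) // z ∉ S} => weightSpace ρ S.1 := by
  have hind := Module.End.independent_iInf_maxGenEigenspace_of_forall_mapsTo
    (fun j : Fin n => ρ (flip z j)) fun i j φ => Module.End.mapsTo_maxGenEigenspace_of_comm (by
      change ρ (flip z j) * ρ (flip z i) = ρ (flip z i) * ρ (flip z j)
      rw [← map_mul, flip_commute, map_mul]) φ
  have hinj : Function.Injective
      fun (S : {S : Finset (Fin n) // z ∉ S}) (j : Fin n) => sgn S.1 j := by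
    intro S T h
    refine Subtype.ext (Finset.ext fun j => ?_)
    have := congrFun h j
    by_cases h1 : j ∈ S.1 <;> by_cases h2 : j ∈ T.1 <;> simp [sgn, h1, h2] at this ⊢ <;> linarith
  refine (hind.comp hinj).mono fun S v hv => ?_
  simp only [Function.comp, Submodule.mem_iInf, Module.End.mem_maxGenEigenspace]
  intro j
  refine ⟨1, ?_⟩
  have hz : sgn S.1 z = 1 := by simp [sgn, S.2]
  rw [pow_one, LinearMap.sub_apply, LinearMap.smul_apply, Module.End.one_apply, hv, hz, one_mul,
    sub_self]

variable (ρ) in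
theorem sum_finrank_weightSpace [FiniteDimensional ℝ V] (z : Fin n) :
    ∑ S : {S : Finset (Fin n) // z ∉ S}, Module.finrank ℝ (weightSpace ρ S.1)
      = Module.finrank ℝ V := by
  classical
  have hinternal := DirectSum.isInternal_submodule_of_iSupIndep_of_iSup_eq_top
    (iSupIndep_weightSpace ρ z) (iSup_weightSpace_eq_top ρ z)
  rw [← (LinearEquiv.ofBijective (DirectSum.coeLinearMap _) hinternal).finrank_eq,
    Module.finrank_directSum]

variable (ρ) in
theorem sum_finrank_weightSpace_eq_two_mul [FiniteDimensional ℝ V] (z : Fin n) :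
    ∑ S : Finset (Fin n), Module.finrank ℝ (weightSpace ρ S) = 2 * Module.finrank ℝ V := by
  classical
  have h1 : ∑ S with z ∉ S, Module.finrank ℝ (weightSpace ρ S) = Module.finrank ℝ V := by
    rw [← sum_finrank_weightSpace ρ z]
    exact (Finset.sum_subtype _ (by simp) _)
  have h2 : ∑ S with ¬ z ∉ S, Module.finrank ℝ (weightSpace ρ S) = Module.finrank ℝ V := by
    rw [← h1]
    refine Finset.sum_nbij' (fun S => Sᶜ) (fun S => Sᶜ) ?_ ?_ ?_ ?_ ?_
    · intro S hS; simpa using hS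
    · intro S hS; simpa using hS
    · intro S _; simp
    · intro S _; simp
    · intro S _
      rw [weightSpace_compl]
  rw [← Finset.sum_filter_add_sum_filter_not Finset.univ (fun S : Finset (Fin n) => z ∉ S), h1, h2,
    two_mul]

/-- A weight vector is detected by a functional transforming by the same character. -/
theorem exists_weight_functional {S : Finset (Fin n)} {u : V} (hu : u ∈ weightSpace ρ S)
    (hu0 : u ≠ 0) {z : Fin n} (hz : z ∉ S) :
    ∃ f : V →ₗ[ℝ] ℝ, f u = 1 ∧
      ∀ i j v, f (ρ (flip i j) v) = sgn S i * sgn S j * f v := by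
  set N : Submodule ℝ V :=
    ⨆ (T : {T : Finset (Fin n) // z ∉ T}) (_ : T ≠ ⟨S, hz⟩), weightSpace ρ T.1 with hN
  have huN : u ∉ N := fun h =>
    hu0 ((Submodule.disjoint_def.1 (iSupIndep_weightSpace ρ z ⟨S, hz⟩)) u hu h)
  obtain ⟨f, hfu, hfN⟩ := Submodule.exists_le_ker_of_notMem huN
  refine ⟨(f u)⁻¹ • f, by simp [hfu], fun i j v => ?_⟩
  have hv : v ∈ ⨆ T : {T : Finset (Fin n) // z ∉ T}, weightSpace ρ T.1 := by
    rw [iSup_weightSpace_eq_top]; trivial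
  induction hv using Submodule.iSup_induction' with
  | mem T x hx =>
    rw [hx i j, map_smul, smul_eq_mul]
    by_cases hT : T = ⟨S, hz⟩
    · rw [hT]
    · have hx0 : f x = 0 := hfN (Submodule.mem_iSup_of_mem T (Submodule.mem_iSup_of_mem hT hx))
      simp [hx0]
  | zero => simp
  | add x y _ _ hx hy => rw [map_add, map_add, hx, hy, map_add, mul_add]

end SOGroup

namespace SOGroup

variable {n : ℕ}

/-! ### Dimension count -/

theorem choose_three_le_choose {k : ℕ} (h3 : 3 ≤ k) (hk : k + 3 ≤ n) :
    n.choose 3 ≤ n.choose k := by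
  have key : ∀ k, 3 ≤ k → 2 * k ≤ n → n.choose 3 ≤ n.choose k := by
    intro k h3
    induction k, h3 using Nat.le_induction with
    | base => exact fun _ => le_rfl
    | succ k hk ih =>
      intro h
      exact (ih (by omega)).trans (Nat.choose_le_succ_of_lt_half_left (by omega))
  by_cases h : 2 * k ≤ n
  · exact key k h3 h
  · rw [← Nat.choose_symm (n := n) (k := k) (by omega)]
    exact key (n - k) (by omega) (by omega)

theorem two_mul_choose_two (n : ℕ) : (n + 1).choose 2 * 2 = (n + 1) * n := by
  simpa using (Nat.add_one_mul_choose_eq n 1).symm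

theorem sub_one_mul_add_two_lt_choose_three (hn : 17 ≤ n) : (n - 1) * (n + 2) < n.choose 3 := by
  obtain ⟨m, rfl⟩ : ∃ m, n = m + 2 := ⟨n - 2, by omega⟩
  have h1 : (m + 2) * (m + 1).choose 2 = (m + 2).choose 3 * 3 := by
    simpa using Nat.add_one_mul_choose_eq (m + 1) 2
  have h2 := two_mul_choose_two m
  have h3 : m + 2 - 1 = m + 1 := rfl
  rw [h3]
  nlinarith

variable {V : Type*} [AddCommGroup V] [Module ℝ V] {ρ : SOGroup n →* Module.End ℝ V}

theorem eq_bot_or_eq_top_of_rot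
    (hirr : ∀ U : Submodule ℝ V, (∀ Q, ∀ v ∈ U, ρ Q v ∈ U) → U = ⊥ ∨ U = ⊤)
    {U : Submodule ℝ V} (hU : ∀ k l θ, k ≠ l → ∀ v ∈ U, ρ (rot k l θ) v ∈ U) :
    U = ⊥ ∨ U = ⊤ := by
  refine hirr U fun Q => ?_
  have hQ : Q ∈ rotSubgroup ∅ := mem_rotSubgroup_of_fix ∅ Q (by simp)
  induction hQ using Subgroup.closure_induction'' with
  | mem x hx =>
    obtain ⟨k, l, θ, -, -, hkl, rfl⟩ := hx
    exact hU k l θ hkl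
  | inv_mem x hx =>
    obtain ⟨k, l, θ, -, -, hkl, rfl⟩ := hx
    rw [rot_inv hkl]
    exact hU k l _ hkl
  | one => exact fun v hv => by rwa [rep_one_apply]
  | mul x y _ _ hx hy => exact fun v hv => (rep_mul_apply ρ x y v).symm ▸ hx _ (hy v hv)

theorem exists_ne_ne_ne (hn : 4 ≤ n) (a b c : Fin n) : ∃ z : Fin n, z ≠ a ∧ z ≠ b ∧ z ≠ c := by
  have hc : ({a, b, c} : Finset (Fin n)).card < Fintype.card (Fin n) :=
    Finset.card_le_three.trans_lt (by rw [Fintype.card_fin]; omega)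
  obtain ⟨z, hz⟩ := Finset.exists_mem_notMem_of_card_lt_card (s := {a, b, c})
    (t := Finset.univ) (by simpa using hc)
  exact ⟨z, by simpa using hz.2⟩

/-- If the weight `∅` fills the whole space, rotations act trivially. -/
theorem rot_apply_of_weightSpace_empty_eq_top (hn : 4 ≤ n) (h : weightSpace ρ ∅ = ⊤)
    {k l : Fin n} (hkl : k ≠ l) (θ : ℝ) (v : V) : ρ (rot k l θ) v = v := by
  obtain ⟨j, hjk, hjl, -⟩ := exists_ne_ne_ne hn k l l
  have hf : ∀ i j v, ρ (flip i j) v = v := fun i j v => by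
    have hv : v ∈ weightSpace ρ ∅ := h ▸ Submodule.mem_top
    simpa [sgn] using hv i j
  have h1 : ∀ t (w : V), ρ (rot k l t) w = ρ (rot k l (-t)) w := fun t w => by
    rw [← hf k j (ρ (rot k l t) w), ← rep_mul_apply, flip_mul_rot hkl hjk hjl, rep_mul_apply, hf]
  rw [← add_halves θ, ← rot_mul hkl, rep_mul_apply, h1, ← rep_mul_apply, rot_mul hkl,
    neg_add_cancel, rot_zero, rep_one_apply]

/-- In an irreducible representation of dimension at least two, if the weights of size two do not
occur then neither does the weight `∅`. -/
theorem weightSpace_empty_eq_bot [FiniteDimensional ℝ V] (hn : 4 ≤ n)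
    (hirr : ∀ U : Submodule ℝ V, (∀ Q, ∀ v ∈ U, ρ Q v ∈ U) → U = ⊥ ∨ U = ⊤)
    (hd : 2 ≤ Module.finrank ℝ V)
    (h2 : ∀ k l : Fin n, k ≠ l → weightSpace ρ {k, l} = ⊥) : weightSpace ρ ∅ = ⊥ := by
  refine (eq_bot_or_eq_top_of_rot hirr fun k l θ hkl v hv => ?_).resolve_right fun htop => ?_
  · obtain ⟨z, hzk, hzl, -⟩ := exists_ne_ne_ne hn k l l
    obtain ⟨y₁, hy₁, y₂, hy₂, h⟩ := exists_rot_apply_eq_add hv hkl hzk hzl θ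
    have hs : symmDiff (∅ : Finset (Fin n)) {k, l} = {k, l} := by simp
    rw [hs, h2 k l hkl, Submodule.mem_bot] at hy₂
    rwa [h, hy₂, add_zero]
  · have : Nontrivial V := Module.nontrivial_of_finrank_pos (R := ℝ) (by omega)
    obtain ⟨v, hv⟩ := exists_ne (0 : V)
    rcases eq_bot_or_eq_top_of_rot hirr (U := ℝ ∙ v) fun k l θ hkl w hw => by
        rwa [rot_apply_of_weightSpace_empty_eq_top hn htop hkl] with h | h
    · exact hv (Submodule.span_singleton_eq_bot.1 h)
    · have h1 := finrank_span_singleton (K := ℝ) hv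
      rw [h, finrank_top] at h1
      omega

variable (ρ) in
theorem sum_choose_mul_finrank [FiniteDimensional ℝ V] (z : Fin n) :
    ∃ m : ℕ → ℕ, (∀ S : Finset (Fin n), Module.finrank ℝ (weightSpace ρ S) = m S.card) ∧
      ∑ k ∈ Finset.range (n + 1), n.choose k * m k = 2 * Module.finrank ℝ V := by
  let m : ℕ → ℕ := fun k =>
    Module.finrank ℝ (weightSpace ρ (Finset.univ.filter fun i : Fin n => i.val < k))
  have hm : ∀ S : Finset (Fin n), Module.finrank ℝ (weightSpace ρ S) = m S.card := fun S =>
    finrank_weightSpace_eq_of_card_eq ρ (by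
      rw [Fin.card_filter_val_lt, min_eq_right (by simpa using S.card_le_univ)])
  refine ⟨m, hm, ?_⟩
  have h := Finset.sum_powerset_apply_card m (x := (Finset.univ : Finset (Fin n)))
  simp only [Finset.powerset_univ, ← hm, Finset.card_univ, Fintype.card_fin, smul_eq_mul] at h
  rw [← h, sum_finrank_weightSpace_eq_two_mul ρ z]

/-- The weight multiplicities of an irreducible representation of dimension `(n - 1)(n + 2) / 2`. -/
theorem weight_multiplicities [FiniteDimensional ℝ V] (hn : 17 ≤ n)
    (hirr : ∀ U : Submodule ℝ V, (∀ Q, ∀ v ∈ U, ρ Q v ∈ U) → U = ⊥ ∨ U = ⊤)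
    (hd : 2 * Module.finrank ℝ V = (n - 1) * (n + 2)) :
    (∀ k l : Fin n, k ≠ l → Module.finrank ℝ (weightSpace ρ {k, l}) = 1) ∧
      ∀ S : Finset (Fin n), S.card = 4 → weightSpace ρ S = ⊥ := by
  obtain ⟨m, hm, hsum⟩ := sum_choose_mul_finrank ρ (⟨0, by omega⟩ : Fin n)
  have hle : ∀ k, k ≤ n → n.choose k * m k ≤ 2 * Module.finrank ℝ V := fun k hk => by
    rw [← hsum]
    exact Finset.single_le_sum (f := fun k => n.choose k * m k) (fun _ _ => Nat.zero_le _)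
      (Finset.mem_range.2 (by omega))
  have hmid : ∀ k, 3 ≤ k → k + 3 ≤ n → m k = 0 := fun k h3 hk => by
    by_contra h0
    have h1 := hle k (by omega)
    have h2 := choose_three_le_choose h3 hk
    have h3 := sub_one_mul_add_two_lt_choose_three hn
    have h4 : n.choose k * 1 ≤ n.choose k * m k := Nat.mul_le_mul_left _ (by omega)
    omega
  have hcompl : ∀ k, k ≤ n → m (n - k) = m k := fun k hk => by
    obtain ⟨S, -, hS⟩ := Finset.exists_subset_card_eq (s := (Finset.univ : Finset (Fin n)))
      (n := k) (by simpa using hk)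
    have h := hm Sᶜ
    rw [weightSpace_compl, hm, Finset.card_compl, hS, Fintype.card_fin] at h
    exact h.symm
  have hsum' : m 0 + n * m 1 + n.choose 2 * m 2 = Module.finrank ℝ V := by
    have hsub : ({0, 1, 2, n - 2, n - 1, n} : Finset ℕ) ⊆ Finset.range (n + 1) := by
      intro k hk
      simp only [Finset.mem_insert, Finset.mem_singleton] at hk
      simp only [Finset.mem_range]
      omega
    rw [← Finset.sum_subset hsub fun k hk hk' => by
      simp only [Finset.mem_insert, Finset.mem_singleton, not_or] at hk'
      simp only [Finset.mem_range] at hk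
      rw [hmid k (by omega) (by omega), mul_zero]] at hsum
    have e1 := hcompl 1 (by omega)
    have e2 := hcompl 2 (by omega)
    have e0 := hcompl 0 (by omega)
    have c1 := Nat.choose_symm (n := n) (k := 1) (by omega)
    have c2 := Nat.choose_symm (n := n) (k := 2) (by omega)
    rw [Finset.sum_insert (by simp; omega), Finset.sum_insert (by simp; omega),
      Finset.sum_insert (by simp; omega), Finset.sum_insert (by simp; omega),
      Finset.sum_insert (by simp; omega), Finset.sum_singleton, c1, c2, e1, e2] at hsum
    rw [Nat.sub_zero] at e0
    rw [e0, Nat.choose_self, Nat.choose_zero_right, Nat.choose_one_right] at hsum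
    omega
  obtain ⟨a, rfl⟩ : ∃ a, n = a + 1 := ⟨n - 1, by omega⟩
  have hc2 := two_mul_choose_two a
  rw [Nat.add_sub_cancel] at hd
  have hd2 : 2 ≤ Module.finrank ℝ V := by nlinarith
  have hm2 : m 2 = 1 := by
    have hlt : m 2 < 2 := by
      by_contra h
      have : (a + 1).choose 2 * 2 ≤ (a + 1).choose 2 * m 2 := Nat.mul_le_mul_left _ (by omega)
      nlinarith
    have hne : m 2 ≠ 0 := by
      intro h0
      have hbot : weightSpace ρ ∅ = ⊥ := weightSpace_empty_eq_bot (by omega) hirr hd2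
        fun k l hkl => Submodule.finrank_eq_zero.1 (by rw [hm, Finset.card_pair hkl, h0])
      have hm0 : m 0 = 0 := by
        have h := hm ∅
        rwa [hbot, finrank_bot, Finset.card_empty, eq_comm] at h
      rw [hm0, h0] at hsum'
      have hdvd : a + 1 ∣ 2 := by
        have h1 : a + 1 ∣ a * (a + 1 + 2) := ⟨2 * m 1, by rw [← hd, ← hsum']; ring⟩
        exact (Nat.dvd_add_right h1).1 ⟨a + 2, by ring⟩
      have := Nat.le_of_dvd (by norm_num) hdvd
      omega
    omega
  refine ⟨fun k l hkl => by rw [hm, Finset.card_pair hkl, hm2], fun S hS => ?_⟩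
  exact Submodule.finrank_eq_zero.1 (by rw [hm, hS, hmid 4 (by omega) (by omega)])

end SOGroup

namespace SOGroup

/-! ### A functional characterization of the cosine -/

theorem eq_cos_of_mul_of_double {c : ℝ → ℝ} (hbdd : ∀ t, |c t| ≤ 1)
    (hdouble : ∀ t, c (2 * t) = 2 * c t ^ 2 - 1) (hpi : ∀ t, c (t + Real.pi) = -c t)
    (hmul : ∀ a b t, Real.cos t = Real.cos a * Real.cos b → c t = c a * c b) (t : ℝ) :
    c t = Real.cos t := by
  have hpos : ∀ B, (∀ q, |c q - Real.cos q| ≤ B) → ∀ q, 0 ≤ Real.cos q →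
      |c q - Real.cos q| ≤ B / 2 := by
    intro B hB q hq
    set r := Real.arccos √(Real.cos q) with hr
    have hcr : Real.cos r = √(Real.cos q) := Real.cos_arccos
      ((by norm_num : (-1 : ℝ) ≤ 0).trans (Real.sqrt_nonneg _))
      (Real.sqrt_le_one.2 (Real.cos_le_one q))
    have hcq : Real.cos q = Real.cos r * Real.cos r := by rw [hcr, Real.mul_self_sqrt hq]
    have h1 := hmul r r q hcq
    have h2 := hB (2 * r)
    rw [hdouble, Real.cos_two_mul] at h2
    rw [h1, hcq]
    rw [abs_le] at h2 ⊢
    constructor <;> nlinarith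
  have hstep : ∀ B, (∀ q, |c q - Real.cos q| ≤ B) → ∀ q, |c q - Real.cos q| ≤ B / 2 := by
    intro B hB q
    rcases le_total 0 (Real.cos q) with hq | hq
    · exact hpos B hB q hq
    · have h := hpos B hB (q + Real.pi) (by rw [Real.cos_add_pi]; linarith)
      rw [hpi, Real.cos_add_pi] at h
      rwa [neg_sub_neg, abs_sub_comm] at h
  have hall : ∀ m : ℕ, ∀ q, |c q - Real.cos q| ≤ 2 * (1 / 2) ^ m := by
    intro m
    induction m with
    | zero =>
      intro q
      have h1 := abs_le.1 (hbdd q)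
      have h2 := Real.neg_one_le_cos q
      have h3 := Real.cos_le_one q
      rw [abs_le]
      constructor <;> simp <;> linarith
    | succ m ih =>
      intro q
      refine (hstep _ ih q).trans (le_of_eq ?_)
      ring
  by_contra hne
  have hε : 0 < |c t - Real.cos t| / 2 := by
    have := abs_pos.2 (sub_ne_zero.2 hne)
    linarith
  obtain ⟨m, hm⟩ := exists_pow_lt_of_lt_one hε (by norm_num : (1 / 2 : ℝ) < 1)
  have := hall m t
  linarith

variable {n : ℕ} {V : Type*} [AddCommGroup V] [Module ℝ V] {ρ : SOGroup n →* Module.End ℝ V}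

/-- The weights of size two occur with multiplicity one, those of size four do not occur. -/
structure IsTwoWeight (ρ : SOGroup n →* Module.End ℝ V) : Prop where
  four_lt : 4 < n
  finrank_pair : ∀ k l : Fin n, k ≠ l → Module.finrank ℝ (weightSpace ρ {k, l}) = 1
  quad_eq_bot : ∀ S : Finset (Fin n), S.card = 4 → weightSpace ρ S = ⊥

theorem exists_ne_of_four (hn : 4 < n) (a b c d : Fin n) :
    ∃ z : Fin n, z ≠ a ∧ z ≠ b ∧ z ≠ c ∧ z ≠ d := by
  have hc : ({a, b, c, d} : Finset (Fin n)).card < Fintype.card (Fin n) :=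
    Finset.card_le_four.trans_lt (by rw [Fintype.card_fin]; omega)
  obtain ⟨z, hz⟩ := Finset.exists_mem_notMem_of_card_lt_card (s := {a, b, c, d})
    (t := Finset.univ) (by simpa using hc)
  exact ⟨z, by simpa using hz.2⟩

theorem IsTwoWeight.exists_smul_eq (hρ : IsTwoWeight ρ) {k l : Fin n} (hkl : k ≠ l) {u v : V}
    (hu : u ∈ weightSpace ρ {k, l}) (hu0 : u ≠ 0) (hv : v ∈ weightSpace ρ {k, l}) :
    ∃ c : ℝ, v = c • u := by
  obtain ⟨c, hc⟩ := (finrank_eq_one_iff_of_nonzero' (⟨u, hu⟩ : weightSpace ρ {k, l})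
    (fun h => hu0 (congrArg Subtype.val h))).1 (hρ.finrank_pair k l hkl) ⟨v, hv⟩
  exact ⟨c, (congrArg Subtype.val hc).symm⟩

theorem IsTwoWeight.rot_apply_of_disjoint (hρ : IsTwoWeight ρ) {p q k l : Fin n} (hpq : p ≠ q)
    (hkp : k ≠ p) (hkq : k ≠ q) (hlp : l ≠ p) (hlq : l ≠ q) (hkl : k ≠ l) {u : V}
    (hu : u ∈ weightSpace ρ {p, q}) (θ : ℝ) : ρ (rot k l θ) u = u := by
  obtain ⟨j, hjk, hjl, hjp, hjq⟩ := exists_ne_of_four hρ.four_lt k l p q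
  have hmem : ∀ t, ρ (rot k l t) u ∈ weightSpace ρ {p, q} := fun t => by
    obtain ⟨y₁, hy₁, y₂, hy₂, h⟩ := exists_rot_apply_eq_add hu hkl hkp.symm hlp.symm t
    have hs : symmDiff ({p, q} : Finset (Fin n)) {k, l} = {p, q, k, l} := by
      ext i
      simp only [Finset.mem_symmDiff, Finset.mem_insert, Finset.mem_singleton]
      grind
    rw [hs, hρ.quad_eq_bot _ (by
      rw [Finset.card_insert_of_notMem (by simp [hpq, hkp.symm, hlp.symm]),
        Finset.card_insert_of_notMem (by simp [hkq.symm, hlq.symm]), Finset.card_pair hkl]),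
        Submodule.mem_bot] at hy₂
    rwa [h, hy₂, add_zero]
  have hf : ∀ v ∈ weightSpace ρ {p, q}, ρ (flip k j) v = v := fun v hv => by
    have := hv k j
    simpa [sgn, hkp, hkq, hjp, hjq] using this
  have h1 : ∀ t, ρ (rot k l t) u = ρ (rot k l (-t)) u := fun t => by
    rw [← hf _ (hmem t), ← rep_mul_apply, flip_mul_rot hkl hjk hjl, rep_mul_apply, hf u hu]
  rw [← add_halves θ, ← rot_mul hkl, rep_mul_apply, h1, ← rep_mul_apply, rot_mul hkl,
    add_neg_cancel, rot_zero, rep_one_apply]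

theorem IsTwoWeight.apply_of_fix (hρ : IsTwoWeight ρ) {p q : Fin n} (hpq : p ≠ q) {u : V}
    (hu : u ∈ weightSpace ρ {p, q}) {Q : SOGroup n} (hp : Q.1 *ᵥ stdVec p = stdVec p)
    (hq : Q.1 *ᵥ stdVec q = stdVec q) : ρ Q u = u := by
  have hQ : Q ∈ rotSubgroup {p, q} := mem_rotSubgroup_of_fix _ Q fun j hj => by
    rcases Finset.mem_insert.1 hj with rfl | hj
    · exact hp
    · rw [Finset.mem_singleton.1 hj, hq]
  let H : Subgroup (SOGroup n) :=
    { carrier := {Q | ρ Q u = u}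
      mul_mem' := fun {a b} (ha : ρ a u = u) (hb : ρ b u = u) => by
        change ρ (a * b) u = u
        rw [rep_mul_apply, hb, ha]
      one_mem' := rep_one_apply ρ u
      inv_mem' := fun {a} (ha : ρ a u = u) => by
        change ρ a⁻¹ u = u
        conv_lhs => rw [← ha]
        exact rep_inv_apply_apply ρ a u }
  refine rotSubgroup_le (H := H) (fun k l θ hk hl hkl => ?_) hQ
  simp only [Finset.mem_insert, Finset.mem_singleton, not_or] at hk hl
  exact hρ.rot_apply_of_disjoint hpq hk.1 hk.2 hl.1 hl.2 hkl hu θ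

theorem IsTwoWeight.apply_eq_of_eq (hρ : IsTwoWeight ρ) {p q : Fin n} (hpq : p ≠ q) {u : V}
    (hu : u ∈ weightSpace ρ {p, q}) {Q R : SOGroup n}
    (hp : Q.1 *ᵥ stdVec p = R.1 *ᵥ stdVec p) (hq : Q.1 *ᵥ stdVec q = R.1 *ᵥ stdVec q) :
    ρ Q u = ρ R u := by
  have h := hρ.apply_of_fix hpq hu (Q := R⁻¹ * Q)
    (by rw [coe_mul_mulVec]; exact inv_mulVec_of_mulVec hp.symm)
    (by rw [coe_mul_mulVec]; exact inv_mulVec_of_mulVec hq.symm)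
  rw [← mul_inv_cancel_left R Q, rep_mul_apply, h]

theorem rot_half_pi_mem_pair {p q k : Fin n} (hpq : p ≠ q) (hkp : k ≠ p) (hkq : k ≠ q) {u : V}
    (hu : u ∈ weightSpace ρ {p, q}) : ρ (rot p k (Real.pi / 2)) u ∈ weightSpace ρ {k, q} := by
  have h := rot_half_pi_mem_weightSpace hu hkp.symm
  have hs : ({p, q} : Finset (Fin n)).map (Equiv.swap p k).toEmbedding = {k, q} := by
    simp [Finset.map_insert, Equiv.swap_apply_of_ne_of_ne hpq.symm hkq.symm]
  rwa [hs] at h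

/-- A functional transforming by the character of `{p, q}` vanishes on the other weights
containing `q`. -/
theorem functional_eq_zero_of_mem_pair (hn : 4 < n) {p q j : Fin n} (hjp : j ≠ p)
    (hpq : p ≠ q) {f : V →ₗ[ℝ] ℝ}
    (hf : ∀ i j v, f (ρ (flip i j) v) = sgn {p, q} i * sgn {p, q} j * f v) {x : V}
    (hx : x ∈ weightSpace ρ {j, q}) : f x = 0 := by
  obtain ⟨z, hzp, hzq, hzj, -⟩ := exists_ne_of_four hn p q j j
  have h := hf p z x
  rw [hx p z, map_smul] at h
  simp [sgn, hpq, hjp.symm, hzp, hzq, hzj] at h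
  linarith

theorem IsTwoWeight.rot_apply (hρ : IsTwoWeight ρ) {p q k : Fin n} (hpq : p ≠ q)
    (hkp : k ≠ p) (hkq : k ≠ q) {u : V} (hu : u ∈ weightSpace ρ {p, q}) (θ : ℝ) :
    ρ (rot p k θ) u = Real.cos θ • u + Real.sin θ • ρ (rot p k (Real.pi / 2)) u := by
  by_cases hu0 : u = 0
  · simp [hu0]
  obtain ⟨l, hlp, hlq, hlk, -⟩ := exists_ne_of_four hρ.four_lt p q k k
  obtain ⟨f, hfu, hf⟩ := exists_weight_functional hu hu0 (z := l) (by simp [hlp, hlq])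
  have hf0 : ∀ {j}, j ≠ p → ∀ {x}, x ∈ weightSpace ρ {j, q} → f x = 0 := fun {_} hj {_} hx =>
    functional_eq_zero_of_mem_pair hρ.four_lt hj hpq hf hx
  have hmem : ∀ {j}, j ≠ p → j ≠ q → ρ (rot p j (Real.pi / 2)) u ∈ weightSpace ρ {j, q} :=
    fun {_} hjp hjq => rot_half_pi_mem_pair hpq hjp hjq hu
  set c : Fin n → ℝ → ℝ := fun j t => f (ρ (rot p j t) u) with hc
  -- decomposition with coefficients read off by `f`
  have hdec : ∀ {j}, j ≠ p → j ≠ q → ∀ t, ρ (rot p j t) u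
      = c j t • u + c j (t - Real.pi / 2) • ρ (rot p j (Real.pi / 2)) u := by
    intro j hjp hjq t
    obtain ⟨y₁, hy₁, y₂, hy₂, h⟩ := exists_rot_apply_eq_add hu hjp.symm hpq.symm hjq.symm t
    have hs : symmDiff ({p, q} : Finset (Fin n)) {p, j} = {j, q} := by
      ext i
      simp only [Finset.mem_symmDiff, Finset.mem_insert, Finset.mem_singleton]
      grind
    rw [hs] at hy₂
    obtain ⟨a, rfl⟩ := hρ.exists_smul_eq hpq hu hu0 hy₁
    obtain ⟨b, rfl⟩ := hρ.exists_smul_eq hjq (hmem hjp hjq)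
      (fun h0 => hu0 (rep_injective ρ _ (h0.trans (map_zero _).symm))) hy₂
    have ha : c j t = a := by
      simp only [hc, h, map_add, map_smul, hfu, hf0 hjp (hmem hjp hjq)]
      simp
    have hneg : f (ρ (rot p j (-(Real.pi / 2))) u) = 0 := by
      have : ρ (rot p j (-(Real.pi / 2))) u = -ρ (rot p j (Real.pi / 2)) u := by
        rw [show -(Real.pi / 2) = Real.pi / 2 + -Real.pi by ring, ← rot_mul hjp.symm,
          ← rot_inv hjp.symm, rot_pi hjp.symm, inv_eq_of_mul_eq_one_right (flip_sq p j),
          rep_mul_apply, hu]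
        simp [sgn, hjp, hjq]
      rw [this, map_neg, hf0 hjp (hmem hjp hjq), neg_zero]
    have hb : c j (t - Real.pi / 2) = b := by
      simp only [hc]
      rw [sub_eq_neg_add, ← rot_mul hjp.symm, rep_mul_apply, h, map_add, map_smul, map_smul,
        ← rep_mul_apply, rot_mul hjp.symm, neg_add_cancel, rot_zero, rep_one_apply, map_add,
        map_smul, map_smul, hneg, hfu]
      simp
    rw [h, ha, hb]
  have hzero : c k 0 = 1 := by simp only [hc, rot_zero, rep_one_apply, hfu]
  have hpi : ∀ t, c k (t + Real.pi) = -c k t := by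
    intro t
    simp only [hc]
    rw [← rot_mul hkp.symm, rot_pi hkp.symm, rep_mul_apply, hu]
    simp [sgn, hkp, hkq]
  have heven : ∀ t, c k (-t) = c k t := by
    intro t
    have h := hf p l (ρ (rot p k t) u)
    rw [← rep_mul_apply, flip_mul_rot hkp.symm hlp hlk, rep_mul_apply, hu] at h
    simpa [sgn, hlp, hlq, hc] using h
  have hadd : ∀ a b, c k (a + b)
      = c k a * c k b - c k (a - Real.pi / 2) * c k (b - Real.pi / 2) := by
    intro a b
    have h1 : c k (a + Real.pi / 2) = -c k (a - Real.pi / 2) := by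
      rw [← hpi]; congr 1; ring
    have h2 : f (ρ (rot p k a) (ρ (rot p k (Real.pi / 2)) u)) = c k (a + Real.pi / 2) := by
      rw [← rep_mul_apply, rot_mul hkp.symm]
    have h3 : c k (a + b) = f (ρ (rot p k a) (ρ (rot p k b) u)) := by
      rw [← rep_mul_apply, rot_mul hkp.symm]
    rw [h3, hdec hkp hkq b, map_add, map_smul, map_smul, map_add, map_smul, map_smul, h2, h1,
      smul_eq_mul, smul_eq_mul]
    simp only [hc]
    ring
  have hsq : ∀ t, c k t ^ 2 + c k (t - Real.pi / 2) ^ 2 = 1 := by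
    intro t
    have h := hadd t (-t)
    have h1 : c k (-t - Real.pi / 2) = -c k (t - Real.pi / 2) := by
      rw [← hpi, ← heven]; congr 1; ring
    rw [add_neg_cancel, hzero, heven, h1] at h
    linarith
  have hmulc : ∀ a b t, Real.cos t = Real.cos a * Real.cos b → c k t = c k a * c l b := by
    intro a b t ht
    obtain ⟨φ, h1, h2⟩ : ∃ φ, Real.cos b * Real.sin a = Real.sin t * Real.cos φ ∧
        Real.sin b = Real.sin t * Real.sin φ := by
      obtain ⟨r, φ, h1, h2⟩ := exists_polar (Real.cos b * Real.sin a) (Real.sin b)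
      have hr : r ^ 2 = Real.sin t ^ 2 := by
        have e1 : r ^ 2 = (Real.cos b * Real.sin a) ^ 2 + Real.sin b ^ 2 := by
          rw [h1, h2]
          linear_combination -r ^ 2 * Real.sin_sq_add_cos_sq φ
        rw [e1, Real.sin_sq t, ht]
        linear_combination Real.sin_sq_add_cos_sq b + Real.cos b ^ 2 * Real.sin_sq_add_cos_sq a
      rcases sq_eq_sq_iff_eq_or_eq_neg.1 hr with h | h
      · exact ⟨φ, by rw [h1, h], by rw [h2, h]⟩
      · exact ⟨φ + Real.pi, by rw [h1, h, Real.cos_add_pi]; ring,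
          by rw [h2, h, Real.sin_add_pi]; ring⟩
    have hQR : ρ (rot p k a * rot p l b) u = ρ (rot k l φ * rot p k t) u := by
      refine hρ.apply_eq_of_eq hpq hu ?_ ?_
      · rw [coe_mul_mulVec, coe_mul_mulVec, rot_mulVec_stdVec_left hlp.symm,
          rot_mulVec_stdVec_left hkp.symm, Matrix.mulVec_add, Matrix.mulVec_smul,
          Matrix.mulVec_smul, Matrix.mulVec_add, Matrix.mulVec_smul, Matrix.mulVec_smul,
          rot_mulVec_stdVec_left hkp.symm, rot_mulVec_stdVec_of_ne hkp.symm hlp hlk,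
          rot_mulVec_stdVec_left hlk.symm, rot_mulVec_stdVec_of_ne hlk.symm hkp.symm hlp.symm, ht,
          smul_add, smul_add, smul_smul, smul_smul, smul_smul, smul_smul, h1, ← h2,
          mul_comm (Real.cos b), add_assoc]
      · rw [coe_mul_mulVec, coe_mul_mulVec, rot_mulVec_stdVec_of_ne hlp.symm hpq.symm hlq.symm,
          rot_mulVec_stdVec_of_ne hkp.symm hpq.symm hkq.symm,
          rot_mulVec_stdVec_of_ne hkp.symm hpq.symm hkq.symm,
          rot_mulVec_stdVec_of_ne hlk.symm hkq.symm hlq.symm]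
    have hL : f (ρ (rot p k a * rot p l b) u) = c k a * c l b := by
      rw [rep_mul_apply, hdec hlp hlq b, map_add, map_smul, map_smul,
        hρ.rot_apply_of_disjoint hlq hlp.symm hpq hlk.symm hkq hkp.symm (hmem hlp hlq), map_add,
        map_smul, map_smul, hf0 hlp (hmem hlp hlq), smul_zero, add_zero, smul_eq_mul, mul_comm]
    have hR : f (ρ (rot k l φ * rot p k t) u) = c k t := by
      have hv : f (ρ (rot k l φ) (ρ (rot p k (Real.pi / 2)) u)) = 0 := by
        obtain ⟨y₁, hy₁, y₂, hy₂, h⟩ := exists_rot_apply_eq_add (hmem hkp hkq) hlk.symm hkp.symm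
          hlp.symm φ
        have hs : symmDiff ({k, q} : Finset (Fin n)) {k, l} = {l, q} := by
          ext i
          simp only [Finset.mem_symmDiff, Finset.mem_insert, Finset.mem_singleton]
          grind
        rw [hs] at hy₂
        rw [h, map_add, hf0 hkp hy₁, hf0 hlp hy₂, add_zero]
      rw [rep_mul_apply, hdec hkp hkq t, map_add, map_smul, map_smul,
        hρ.rot_apply_of_disjoint hpq hkp hkq hlp hlq hlk.symm hu, map_add, map_smul, map_smul,
        hv, hfu]
      simp
    rw [← hL, ← hR, hQR]
  have hcl : ∀ b, c l b = c k b := fun b => by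
    have := hmulc 0 b b (by simp)
    rw [hzero, one_mul] at this
    exact this.symm
  have hcos : ∀ t, c k t = Real.cos t := eq_cos_of_mul_of_double
    (fun t => abs_le_one_iff_mul_self_le_one.2 (by nlinarith [hsq t, sq_nonneg (c k (t - Real.pi / 2))]))
    (fun t => by rw [two_mul, hadd]; linarith [hsq t]) hpi
    (fun a b t h => by rw [hmulc a b t h, hcl])
  rw [hdec hkp hkq, hcos, hcos, Real.cos_sub_pi_div_two]

end SOGroup

namespace SOGroup

variable {n : ℕ} {V : Type*} [AddCommGroup V] [Module ℝ V] {ρ : SOGroup n →* Module.End ℝ V}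

/-- The orbit of a weight vector under the stabilizer of `e_q` is described by a linear map. -/
theorem IsTwoWeight.exists_linear_orbit (hρ : IsTwoWeight ρ) {p q : Fin n} (hpq : p ≠ q) {u : V}
    (hu : u ∈ weightSpace ρ {p, q}) :
    ∃ T : (Fin n → ℝ) →ₗ[ℝ] V, T (stdVec p) = u ∧
      ∀ Q : SOGroup n, Q.1 *ᵥ stdVec q = stdVec q → ∀ x, T (Q.1 *ᵥ x) = ρ Q (T x) := by
  set S : Fin n → SOGroup n := fun l => if l = p then 1 else rot p l (Real.pi / 2) with hS
  set w : Fin n → V := fun l => if l = q then 0 else ρ (S l) u with hw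
  have hSp : ∀ l, (S l).1 *ᵥ stdVec p = stdVec l := fun l => by
    by_cases hl : l = p
    · simp only [hS, hl, if_true, one_mulVec]
    · simp only [hS, if_neg hl]
      rw [rot_mulVec_stdVec_left (Ne.symm hl)]
      simp
  have hSq : ∀ l, l ≠ q → (S l).1 *ᵥ stdVec q = stdVec q := fun l hlq => by
    by_cases hl : l = p
    · simp only [hS, if_pos hl, one_mulVec]
    · simp only [hS, if_neg hl]
      rw [rot_mulVec_stdVec_of_ne (Ne.symm hl) hpq.symm hlq.symm]
  have hwl : ∀ l, l ≠ q → w l = ρ (S l) u := fun l hl => by simp only [hw, if_neg hl]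
  have hwmem : ∀ l, l ≠ q → w l ∈ weightSpace ρ {l, q} := fun l hlq => by
    rw [hwl l hlq]
    by_cases hl : l = p
    · simp only [hS, if_pos hl, rep_one_apply]
      rwa [hl]
    · simp only [hS, if_neg hl]
      exact rot_half_pi_mem_pair hpq hl hlq hu
  have hhalf : ∀ i j, i ≠ q → j ≠ q → i ≠ j → ρ (rot i j (Real.pi / 2)) (w i) = w j := by
    intro i j hi hj hij
    rw [hwl i hi, hwl j hj, ← rep_mul_apply]
    refine hρ.apply_eq_of_eq hpq hu ?_ ?_
    · rw [coe_mul_mulVec, hSp, hSp, rot_mulVec_stdVec_left hij]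
      simp
    · rw [coe_mul_mulVec, hSq i hi, hSq j hj, rot_mulVec_stdVec_of_ne hij hi.symm hj.symm]
  set T : (Fin n → ℝ) →ₗ[ℝ] V := Fintype.linearCombination ℝ w with hT
  have hTe : ∀ l, T (stdVec l) = w l := fun l => by
    rw [hT, Fintype.linearCombination_apply_single, one_smul]
  refine ⟨T, ?_, fun Q hQ => ?_⟩
  · rw [hTe, hwl p hpq]
    simp only [hS, if_true, rep_one_apply]
  let H : Subgroup (SOGroup n) :=
    { carrier := {Q | ∀ x, T (Q.1 *ᵥ x) = ρ Q (T x)}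
      mul_mem' := fun {a b} (ha : ∀ x, _) (hb : ∀ x, _) x => by
        rw [coe_mul_mulVec, ha, hb, rep_mul_apply]
      one_mem' := fun x => by rw [one_mulVec, rep_one_apply]
      inv_mem' := fun {a} (ha : ∀ x, _) x => by
        refine rep_injective ρ a ?_
        rw [← ha, ← coe_mul_mulVec, ← rep_mul_apply, mul_inv_cancel, one_mulVec, rep_one_apply] }
  have hmem : Q ∈ rotSubgroup {q} := mem_rotSubgroup_of_fix _ Q fun j hj => by
    rw [Finset.mem_singleton.1 hj, hQ]
  refine rotSubgroup_le (H := H) (fun i j θ hi hj hij => ?_) hmem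
  rw [Finset.mem_singleton] at hi hj
  have hrot : ∀ t, ρ (rot i j t) (w i) = Real.cos t • w i + Real.sin t • w j := fun t => by
    rw [hρ.rot_apply hi hij.symm hj (hwmem i hi), hhalf i j hi hj hij]
  suffices h : T ∘ₗ Matrix.mulVecLin (rot i j θ).1 = ρ (rot i j θ) ∘ₗ T from
    fun x => LinearMap.congr_fun h x
  refine LinearMap.pi_ext' fun l => LinearMap.ext_ring ?_
  change T ((rot i j θ).1 *ᵥ stdVec l) = ρ (rot i j θ) (T (stdVec l))
  rw [hTe]
  by_cases hli : l = i
  · rw [hli, rot_mulVec_stdVec_left hij, map_add, map_smul, map_smul, hTe, hTe, hrot]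
  by_cases hlj : l = j
  · rw [hlj, rot_mulVec_stdVec_right hij, map_add, map_smul, map_smul, hTe, hTe,
      ← hhalf i j hi hj hij, ← rep_mul_apply, rot_mul hij, hrot, hrot, Real.cos_add_pi_div_two,
      Real.sin_add_pi_div_two]
    simp
  rw [rot_mulVec_stdVec_of_ne hij hli hlj, hTe]
  by_cases hlq : l = q
  · simp [hw, hlq]
  · exact (hρ.rot_apply_of_disjoint hlq (Ne.symm hli) hi (Ne.symm hlj) hj hij (hwmem l hlq) θ).symm

/-- Exchanging the two basis vectors multiplies the weight vector by a sign. -/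
theorem IsTwoWeight.exists_swap_sign (hρ : IsTwoWeight ρ) {p q : Fin n} (hpq : p ≠ q) {u : V}
    (hu : u ∈ weightSpace ρ {p, q}) (hu0 : u ≠ 0) :
    ∃ η : ℝ, η * η = 1 ∧ ∃ R : SOGroup n, R.1 *ᵥ stdVec p = stdVec q ∧
      R.1 *ᵥ stdVec q = stdVec p ∧ ρ R u = η • u := by
  obtain ⟨z, hzp, hzq, -⟩ := exists_ne_of_four hρ.four_lt p q q q
  have hmem : ρ (rot p q (Real.pi / 2)) u ∈ weightSpace ρ {p, q} := by
    have h := rot_half_pi_mem_weightSpace hu hpq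
    have hs : ({p, q} : Finset (Fin n)).map (Equiv.swap p q).toEmbedding = {p, q} := by
      simp [Finset.map_insert, Finset.pair_comm]
    rwa [hs] at h
  obtain ⟨c, hc⟩ := hρ.exists_smul_eq hpq hu hu0 hmem
  have hfl : ρ (flip q z) u = -u := by
    rw [hu]; simp [sgn, hzp, hzq]
  refine ⟨-c, ?_, rot p q (Real.pi / 2) * flip q z, ?_, ?_, ?_⟩
  · have h1 : ρ (flip p q) u = u := by
      rw [hu]; simp [sgn]
    rw [← rot_pi hpq, ← add_halves Real.pi, ← rot_mul hpq, rep_mul_apply, hc, map_smul, hc,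
      smul_smul] at h1
    have h2 : (c * c - 1) • u = 0 := by rw [sub_smul, h1, one_smul, sub_self]
    have h3 := (smul_eq_zero.1 h2).resolve_right hu0
    linarith
  · rw [coe_mul_mulVec, flip_mulVec_stdVec, Matrix.mulVec_smul, rot_mulVec_stdVec_left hpq]
    simp [sgn, hpq, hzp.symm]
  · rw [coe_mul_mulVec, flip_mulVec_stdVec, Matrix.mulVec_smul, rot_mulVec_stdVec_right hpq]
    simp [sgn, hzq.symm]
  · rw [rep_mul_apply, hfl, map_neg, hc, neg_smul]

/-! ### Forms on orthogonal pairs -/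

theorem flip_mulVec_eq_self {i j : Fin n} {x : Fin n → ℝ} (hi : x i = 0) (hj : x j = 0) :
    (flip i j).1 *ᵥ x = x := by
  ext k
  rw [flip_mulVec]
  by_cases h1 : k = i
  · rw [h1, hi, mul_zero]
  by_cases h2 : k = j
  · rw [h2, hj, mul_zero]
  simp [sgn, h1, h2]

/-- A form on orthogonal pairs which is linear in one variable, symmetric up to a sign, and
transforms by the character of `{p, q}` under sign changes, is determined by its value at
`(e_p, e_q)`. -/
theorem eq_zero_of_orthogonal_form (hn : 4 < n) {p q : Fin n} (hpq : p ≠ q) {η : ℝ}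
    (L : (Fin n → ℝ) → (Fin n → ℝ) →ₗ[ℝ] ℝ)
    (hsymm : ∀ x y, x ⬝ᵥ y = 0 → L x y = η * L y x)
    (hflip : ∀ i j x y, L ((flip i j).1 *ᵥ y) ((flip i j).1 *ᵥ x)
      = sgn {p, q} i * sgn {p, q} j * L y x)
    (hL : L (stdVec q) (stdVec p) = 0) {x y : Fin n → ℝ} (hxy : x ⬝ᵥ y = 0) : L y x = 0 := by
  have hsymm' : ∀ x y, y ⬝ᵥ x = 0 → L x y = η * L y x := fun x y h =>
    hsymm x y (by rwa [dotProduct_comm])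
  -- vanishing by a sign change
  have hvan : ∀ i j, i ≠ j → ¬(i = p ∧ j = q) → ¬(i = q ∧ j = p) → ∀ x y : Fin n → ℝ,
      (∀ k, k ≠ i → k ≠ j → x k = 0) → (∀ k, k ≠ i → k ≠ j → y k = 0) → L y x = 0 := by
    intro i j hij h1 h2 x y hx hy
    obtain ⟨z, hzp, hzq, hzi, hzj⟩ := exists_ne_of_four hn p q i j
    have key : ∀ a, (a = p ∨ a = q) → a ≠ i → a ≠ j → L y x = 0 := by
      intro a ha hai haj
      have h := hflip a z x y
      rw [flip_mulVec_eq_self (hx a hai haj) (hx z hzi hzj),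
        flip_mulVec_eq_self (hy a hai haj) (hy z hzi hzj)] at h
      have hs1 : sgn {p, q} a = -1 := by rcases ha with rfl | rfl <;> simp [sgn]
      have hs2 : sgn {p, q} z = 1 := by simp [sgn, hzp, hzq]
      rw [hs1, hs2] at h
      linarith
    by_cases hp : p ≠ i ∧ p ≠ j
    · exact key p (Or.inl rfl) hp.1 hp.2
    · refine key q (Or.inr rfl) ?_ ?_ <;> grind
  have hstd : ∀ i j, i ≠ j → L (stdVec j) (stdVec i) = 0 := by
    intro i j hij
    by_cases h1 : i = p ∧ j = q
    · rw [h1.1, h1.2, hL]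
    by_cases h2 : i = q ∧ j = p
    · rw [h2.1, h2.2, hsymm _ _ (by simp [hpq]), hL, mul_zero]
    refine hvan i j hij h1 h2 _ _ (fun k hk _ => ?_) (fun k _ hk => ?_) <;> simp [hk]
  have hadd : ∀ b y y' : Fin n → ℝ, y ⬝ᵥ b = 0 → y' ⬝ᵥ b = 0 → L (y + y') b = L y b + L y' b := by
    intro b y y' h h'
    rw [hsymm _ _ (by rw [add_dotProduct, h, h', add_zero]), map_add, hsymm y b h, hsymm y' b h']
    ring
  -- the elementary vectors orthogonal to `y`
  set b : (Fin n → ℝ) → Fin n → Fin n → Fin n → ℝ :=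
    fun y i j => y j • stdVec i - y i • stdVec j with hb
  have hbk : ∀ y i j k, k ≠ i → k ≠ j → L (stdVec k) (b y i j) = 0 := by
    intro y i j k hki hkj
    simp only [hb, map_sub, map_smul, hstd i k hki.symm, hstd j k hkj.symm]
    simp
  have hbn : ∀ y i j, ¬(i = p ∧ j = q) → ¬(i = q ∧ j = p) → L y (b y i j) = 0 := by
    intro y i j h1 h2
    by_cases hij : i = j
    · simp [hb, hij]
    set y₁ : Fin n → ℝ := y i • stdVec i + y j • stdVec j with hy₁
    have hdot : ∀ v : Fin n → ℝ, v ⬝ᵥ b y i j = y j * v i - y i * v j := fun v => by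
      simp [hb, dotProduct_sub, dotProduct_smul]
    have hy₁i : y₁ i = y i := by simp [hy₁, hij]
    have hy₁j : y₁ j = y j := by simp [hy₁, Ne.symm hij]
    have hy₁k : ∀ k, k ≠ i → k ≠ j → y₁ k = 0 := fun k hki hkj => by simp [hy₁, hki, hkj]
    have h3 : L y₁ (b y i j) = 0 := hvan i j hij h1 h2 _ _
      (fun k hki hkj => by simp [hb, hki, hkj]) hy₁k
    have h4 : L (y - y₁) (b y i j) = 0 := by
      rw [hsymm _ _ (by rw [hdot]; simp [hy₁i, hy₁j])]
      have h5 : L (b y i j) (y - y₁) = ∑ k, (y - y₁) k * L (b y i j) (stdVec k) := by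
        conv_lhs => rw [pi_eq_sum_univ' (y - y₁), map_sum]
        simp only [map_smul, smul_eq_mul]
      rw [h5, Finset.sum_eq_zero, mul_zero]
      intro k _
      by_cases hki : k = i
      · simp [hki, hy₁i]
      by_cases hkj : k = j
      · simp [hkj, hy₁j]
      rw [hsymm' _ _ (by rw [hdot]; simp [Ne.symm hki, Ne.symm hkj]), hbk y i j k hki hkj]
      simp
    have h6 := hadd (b y i j) y₁ (y - y₁) (by rw [hdot, hy₁i, hy₁j]; ring)
      (by rw [hdot]; simp [hy₁i, hy₁j])
    rwa [add_sub_cancel, h3, h4, add_zero] at h6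
  have hbpq' : ∀ y k, k ≠ p → k ≠ q → y k ≠ 0 → L y (b y p q) = 0 := by
    intro y k hkp hkq hk
    have h1 : y k • b y p q = y q • b y p k - y p • b y q k := by
      simp only [hb]
      module
    have h2 : y k * L y (b y p q) = 0 := by
      rw [← smul_eq_mul, ← map_smul, h1, map_sub, map_smul, map_smul, hbn y p k (by grind) (by grind),
        hbn y q k (by grind) (by grind)]
      simp
    exact (mul_eq_zero.1 h2).resolve_left hk
  have hbpq : ∀ y, L y (b y p q) = 0 := by
    intro y
    obtain ⟨k, hkp, hkq, -⟩ := exists_ne_of_four hn p q q q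
    by_cases hk : y k = 0
    · have hby : b (y + stdVec k) p q = b y p q := by
        simp [hb, hkp.symm, hkq.symm]
      have h1 := hbpq' (y + stdVec k) k hkp hkq (by simp [hk])
      rw [hby, hadd _ _ _ (by simp [hb, dotProduct_sub, dotProduct_smul, mul_comm])
        (by simp [hb, dotProduct_sub, hkp.symm, hkq.symm]), hbk y p q k hkp hkq, add_zero] at h1
      exact h1
    · exact hbpq' y k hkp hkq hk
  have hball : ∀ y i j, L y (b y i j) = 0 := by
    intro y i j
    by_cases h1 : i = p ∧ j = q
    · rw [h1.1, h1.2, hbpq]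
    by_cases h2 : i = q ∧ j = p
    · have : b y i j = -b y p q := by simp [hb, h2.1, h2.2]
      rw [this, map_neg, hbpq, neg_zero]
    exact hbn y i j h1 h2
  by_cases hy : y = 0
  · rw [hsymm' _ _ hxy, hy, map_zero, mul_zero]
  have hyy : y ⬝ᵥ y ≠ 0 := fun h => hy (dotProduct_self_eq_zero.1 h)
  have hsum : (y ⬝ᵥ y) • x = ∑ i, ∑ j, (x i * y j) • b y i j := by
    ext m
    have h1 : ∀ i j, ((x i * y j) • b y i j) m
        = stdVec i m * (x i * (y j * y j)) - stdVec j m * (y j * (x i * y i)) := fun i j => by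
      simp only [hb, Pi.smul_apply, Pi.sub_apply, smul_eq_mul]
      ring
    have h2 : ∑ i, ∑ j, stdVec i m * (x i * (y j * y j)) = x m * (y ⬝ᵥ y) := by
      simp only [← Finset.mul_sum]
      simp [Pi.single_apply, dotProduct]
    have h3 : ∑ i, ∑ j, stdVec j m * (y j * (x i * y i)) = y m * (x ⬝ᵥ y) := by
      simp [Pi.single_apply, dotProduct, Finset.mul_sum]
    simp only [Finset.sum_apply, h1, Finset.sum_sub_distrib, h2, h3, hxy, Pi.smul_apply,
      smul_eq_mul]
    ring
  have h := congrArg (L y) hsum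
  simp only [map_smul, map_sum, hball, smul_eq_mul, mul_zero, Finset.sum_const_zero] at h
  exact (mul_eq_zero.1 h).resolve_left hyy

end SOGroup

namespace SOGroup

variable {n : ℕ} {V : Type*} [AddCommGroup V] [Module ℝ V] {ρ : SOGroup n →* Module.End ℝ V}

theorem dotProduct_self_pos {v : Fin n → ℝ} (hv : v ≠ 0) : 0 < v ⬝ᵥ v :=
  lt_of_le_of_ne (Finset.sum_nonneg fun _ _ => mul_self_nonneg _)
    fun h => hv (dotProduct_self_eq_zero.1 h.symm)

/-- Every vector is a nonnegative multiple of a rotated basis vector. -/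
theorem exists_frame {q r : Fin n} (hqr : q ≠ r) (y : Fin n → ℝ) :
    ∃ Q : SOGroup n, y = √(y ⬝ᵥ y) • (Q.1 *ᵥ stdVec q) := by
  by_cases hy : y = 0
  · exact ⟨1, by simp [hy]⟩
  have hyy : 0 < y ⬝ᵥ y := dotProduct_self_pos hy
  have hs := Real.sqrt_pos.2 hyy
  obtain ⟨g, -, hg⟩ := exists_mem_rotSubgroup_mulVec_stdVec (J := ∅) (by simp) (by simp) hqr
    (x := (√(y ⬝ᵥ y))⁻¹ • y) (by
      rw [smul_dotProduct, dotProduct_smul, smul_smul, ← mul_inv, Real.mul_self_sqrt hyy.le,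
        smul_eq_mul, inv_mul_cancel₀ hyy.ne']) (by simp)
  exact ⟨g, by rw [hg, smul_inv_smul₀ hs.ne']⟩

/-- The matrix coefficient of the weight vector of weight `{p, q}`. -/
theorem IsTwoWeight.functional_apply (hρ : IsTwoWeight ρ) {p q : Fin n} (hpq : p ≠ q) {u : V}
    (hu : u ∈ weightSpace ρ {p, q}) {f : V →ₗ[ℝ] ℝ} (hfu : f u = 1)
    (hf : ∀ i j v, f (ρ (flip i j) v) = sgn {p, q} i * sgn {p, q} j * f v)
    {η : ℝ} (hη : η * η = 1) {R : SOGroup n} (hRp : R.1 *ᵥ stdVec p = stdVec q)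
    (hRq : R.1 *ᵥ stdVec q = stdVec p) (hR : ρ R u = η • u) (Q : SOGroup n) :
    f (ρ Q u) = Q.1 p p * Q.1 q q + η * (Q.1 q p * Q.1 p q) := by
  obtain ⟨z, hzp, hzq, -⟩ := exists_ne_of_four hρ.four_lt p q q q
  obtain ⟨T, hTp, hT⟩ := hρ.exists_linear_orbit hpq hu
  choose frame hframe using exists_frame (n := n) hzq.symm
  let F : (Fin n → ℝ) → (Fin n → ℝ) →ₗ[ℝ] ℝ := fun y =>
    √(y ⬝ᵥ y) • (f ∘ₗ ρ (frame y) ∘ₗ T ∘ₗ Matrix.mulVecLin (frame y)⁻¹.1)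
  have hFapp : ∀ x y, F y x = √(y ⬝ᵥ y) * f (ρ (frame y) (T ((frame y)⁻¹.1 *ᵥ x))) :=
    fun x y => rfl
  have hF : ∀ (Q : SOGroup n) (r : ℝ), 0 ≤ r → ∀ x,
      F (r • (Q.1 *ᵥ stdVec q)) x = r * f (ρ Q (T (Q⁻¹.1 *ᵥ x))) := by
    intro Q r hr x
    have hnorm : (r • (Q.1 *ᵥ stdVec q)) ⬝ᵥ (r • (Q.1 *ᵥ stdVec q)) = r * r := by
      rw [smul_dotProduct, dotProduct_smul, dotProduct_mulVec_mulVec]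
      simp
    have hfr := hframe (r • (Q.1 *ᵥ stdVec q))
    rw [hFapp]
    rw [hnorm, Real.sqrt_mul_self hr] at hfr ⊢
    set g := frame (r • (Q.1 *ᵥ stdVec q)) with hg
    rcases hr.eq_or_lt with h0 | h0
    · rw [← h0, zero_mul, zero_mul]
    · have hgQ : Q.1 *ᵥ stdVec q = g.1 *ᵥ stdVec q := smul_right_injective _ h0.ne' hfr
      have hfix : (g⁻¹ * Q).1 *ᵥ stdVec q = stdVec q := by
        rw [coe_mul_mulVec]; exact inv_mulVec_of_mulVec hgQ.symm
      have hx : g⁻¹.1 *ᵥ x = (g⁻¹ * Q).1 *ᵥ (Q⁻¹.1 *ᵥ x) := by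
        rw [← coe_mul_mulVec, mul_inv_cancel_right]
      rw [hx, hT _ hfix, ← rep_mul_apply, mul_inv_cancel_left]
  have hFpq : ∀ (Q : SOGroup n) (a b : ℝ), 0 ≤ b →
      F (b • (Q.1 *ᵥ stdVec q)) (a • (Q.1 *ᵥ stdVec p)) = a * b * f (ρ Q u) := by
    intro Q a b hb
    rw [hF Q b hb, Matrix.mulVec_smul, inv_mulVec_of_mulVec rfl, map_smul, hTp, map_smul, map_smul,
      smul_eq_mul]
    ring
  have hF0 : ∀ x, F 0 x = 0 := fun x => by
    rw [hFapp, zero_dotProduct, Real.sqrt_zero, zero_mul]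
  have hFsymm : ∀ x y, x ⬝ᵥ y = 0 → F x y = η * F y x := by
    intro x y hxy
    by_cases hx : x = 0
    · rw [hx, hF0, map_zero, mul_zero]
    by_cases hy : y = 0
    · rw [hy, hF0, map_zero, mul_zero]
    have hunit : ∀ v : Fin n → ℝ, v ≠ 0 → ((√(v ⬝ᵥ v))⁻¹ • v) ⬝ᵥ ((√(v ⬝ᵥ v))⁻¹ • v) = 1 :=
      fun v hv => by
        rw [smul_dotProduct, dotProduct_smul, smul_smul, ← mul_inv,
          Real.mul_self_sqrt (dotProduct_self_pos hv).le, smul_eq_mul,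
          inv_mul_cancel₀ (dotProduct_self_pos hv).ne']
    obtain ⟨Q, hQp, hQq⟩ := exists_mulVec_stdVec_pair hpq hzp hzq (hunit x hx) (hunit y hy)
      (by rw [smul_dotProduct, dotProduct_smul, hxy, smul_zero, smul_zero])
    have hsx := Real.sqrt_pos.2 (dotProduct_self_pos hx)
    have hsy := Real.sqrt_pos.2 (dotProduct_self_pos hy)
    have hx' : x = √(x ⬝ᵥ x) • (Q.1 *ᵥ stdVec p) := by rw [hQp, smul_inv_smul₀ hsx.ne']
    have hy' : y = √(y ⬝ᵥ y) • (Q.1 *ᵥ stdVec q) := by rw [hQq, smul_inv_smul₀ hsy.ne']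
    have hx'' : x = √(x ⬝ᵥ x) • ((Q * R).1 *ᵥ stdVec q) := by rw [coe_mul_mulVec, hRq, ← hx']
    have hy'' : y = √(y ⬝ᵥ y) • ((Q * R).1 *ᵥ stdVec p) := by rw [coe_mul_mulVec, hRp, ← hy']
    have e1 : F y x = √(x ⬝ᵥ x) * √(y ⬝ᵥ y) * f (ρ Q u) := by
      conv_lhs => rw [hx', hy']
      exact hFpq Q _ _ hsy.le
    have e2 : F x y = √(y ⬝ᵥ y) * √(x ⬝ᵥ x) * f (ρ (Q * R) u) := by
      conv_lhs => rw [hx'', hy'']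
      exact hFpq (Q * R) _ _ hsx.le
    rw [e1, e2, rep_mul_apply, hR, map_smul, map_smul, smul_eq_mul]
    ring
  have hFflip : ∀ i j x y, F ((flip i j).1 *ᵥ y) ((flip i j).1 *ᵥ x)
      = sgn {p, q} i * sgn {p, q} j * F y x := by
    intro i j x y
    have hy := hframe y
    have e1 : F y x = √(y ⬝ᵥ y) * f (ρ (frame y) (T ((frame y)⁻¹.1 *ᵥ x))) := rfl
    have e2 : (flip i j).1 *ᵥ y = √(y ⬝ᵥ y) • ((flip i j * frame y).1 *ᵥ stdVec q) := by
      conv_lhs => rw [hy]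
      rw [Matrix.mulVec_smul, coe_mul_mulVec]
    rw [e1, e2, hF _ _ (Real.sqrt_nonneg _), ← coe_mul_mulVec, _root_.mul_inv_rev,
      inv_mul_cancel_right, rep_mul_apply, hf]
    ring
  let B : (Fin n → ℝ) → (Fin n → ℝ) →ₗ[ℝ] ℝ := fun y =>
    y q • LinearMap.proj p + (η * y p) • LinearMap.proj q
  have hB : ∀ x y, B y x = y q * x p + η * y p * x q := fun x y => rfl
  have hs : ∀ i j, sgn ({i} : Finset (Fin n)) p * sgn {j} p * (sgn {i} q * sgn {j} q)
      = sgn {p, q} i * sgn {p, q} j := by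
    intro i j
    have h1 : ∀ i, sgn ({i} : Finset (Fin n)) p * sgn {i} q = sgn {p, q} i := fun i => by
      simp only [sgn, Finset.mem_singleton, Finset.mem_insert]
      grind
    rw [← h1, ← h1]
    ring
  have hzero := eq_zero_of_orthogonal_form hρ.four_lt hpq (η := η) (fun y => F y - B y)
    (fun x y hxy => by
      simp only [LinearMap.sub_apply, hFsymm x y hxy, hB]
      linear_combination x q * y p * hη)
    (fun i j x y => by
      simp only [LinearMap.sub_apply, hFflip, hB, flip_mulVec]
      linear_combination -(y q * x p + η * y p * x q) * hs i j)
    (by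
      have h := hFpq 1 1 1 zero_le_one
      rw [one_smul, one_smul, one_mulVec, one_mulVec, rep_one_apply, hfu] at h
      simp only [LinearMap.sub_apply, h, hB]
      simp [hpq])
    (x := Q.1 *ᵥ stdVec p) (y := Q.1 *ᵥ stdVec q)
    (by rw [dotProduct_mulVec_mulVec]; simp [hpq])
  have h := hFpq Q 1 1 zero_le_one
  rw [one_smul, one_smul] at h
  simp only [LinearMap.sub_apply, h, hB, mulVec_stdVec_apply] at hzero
  linarith

end SOGroup

namespace SOGroup

variable {n : ℕ} {V : Type*} [AddCommGroup V] [Module ℝ V] {ρ : SOGroup n →* Module.End ℝ V}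

theorem two_mul_card_sigma_fin (n : ℕ) :
    2 * Fintype.card (Σ j : Fin n, Fin j) = n * (n - 1) := by
  simp only [Fintype.card_sigma, Fintype.card_fin]
  rw [Fin.sum_univ_eq_sum_range (fun i => i), mul_comm, Finset.sum_range_id_mul_two]

/-- The strictly upper triangular entries of a matrix. -/
def upperEntries (n : ℕ) : Matrix (Fin n) (Fin n) ℝ →ₗ[ℝ] ((Σ j : Fin n, Fin j) → ℝ) where
  toFun X s := X (s.2.castLE s.1.2.le) s.1
  map_add' _ _ := rfl
  map_smul' _ _ := rfl

theorem apply_eq_zero_of_upperEntries {X : Matrix (Fin n) (Fin n) ℝ} (h : upperEntries n X = 0)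
    {i j : Fin n} (hij : i < j) : X i j = 0 :=
  congrFun h ⟨j, ⟨i, hij⟩⟩

theorem two_mul_finrank_le_of_skew [FiniteDimensional ℝ V]
    (Θ : V →ₗ[ℝ] Matrix (Fin n) (Fin n) ℝ) (hΘ : Function.Injective Θ)
    (hskew : ∀ v, (Θ v)ᵀ = -Θ v) : 2 * Module.finrank ℝ V ≤ n * (n - 1) := by
  have hinj : Function.Injective (upperEntries n ∘ₗ Θ) := by
    rw [← LinearMap.ker_eq_bot, LinearMap.ker_eq_bot']
    intro v hv
    refine hΘ ?_
    have hs : ∀ i j, Θ v j i = -Θ v i j := fun i j => congrFun (congrFun (hskew v) i) j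
    rw [map_zero]
    ext i j
    rw [Matrix.zero_apply]
    rcases lt_trichotomy i j with hij | rfl | hij
    · exact apply_eq_zero_of_upperEntries hv hij
    · linarith [hs i i]
    · have h0 : Θ v j i = 0 := apply_eq_zero_of_upperEntries hv hij
      linarith [hs j i]
  have h := LinearMap.finrank_le_finrank_of_injective hinj
  rw [Module.finrank_fintype_fun_eq_card] at h
  rw [← two_mul_card_sigma_fin]
  omega

theorem two_mul_finrank_symTraceless_le (z : Fin n) :
    2 * Module.finrank ℝ (symTraceless n) ≤ n * (n - 1) + 2 * (n - 1) := by
  let D : Matrix (Fin n) (Fin n) ℝ →ₗ[ℝ] ({i : Fin n // i ≠ z} → ℝ) :=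
    { toFun := fun X i => X i i
      map_add' := fun _ _ => rfl
      map_smul' := fun _ _ => rfl }
  have hinj : Function.Injective
      ((upperEntries n).prod D ∘ₗ (symTraceless n).subtype) := by
    rw [← LinearMap.ker_eq_bot, LinearMap.ker_eq_bot']
    rintro ⟨X, hXs, hXt⟩ hX
    obtain ⟨hU, hD⟩ := Prod.mk.inj hX
    have hs : ∀ i j, X j i = X i j := fun i j => congrFun (congrFun hXs i) j
    have hdiag : ∀ i, i ≠ z → X i i = 0 := fun i hi => congrFun hD ⟨i, hi⟩
    have hz : X z z = 0 := by
      have hsum : X.trace = X z z :=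
        Finset.sum_eq_single z (fun i _ hi => hdiag i hi) fun hz => absurd (Finset.mem_univ z) hz
      rw [← hsum, hXt]
    refine Subtype.ext ?_
    ext i j
    change X i j = 0
    rcases lt_trichotomy i j with hij | rfl | hij
    · exact apply_eq_zero_of_upperEntries hU hij
    · by_cases hi : i = z
      · rw [hi, hz]
      · exact hdiag i hi
    · rw [hs j i]
      exact apply_eq_zero_of_upperEntries hU hij
  have h := LinearMap.finrank_le_finrank_of_injective hinj
  rw [Module.finrank_prod, Module.finrank_fintype_fun_eq_card,
    Module.finrank_fintype_fun_eq_card] at h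
  have hc : Fintype.card {i : Fin n // i ≠ z} = n - 1 := by
    simp [Fintype.card_subtype_compl]
  rw [← two_mul_card_sigma_fin]
  omega

theorem conj_apply (Q X : Matrix (Fin n) (Fin n) ℝ) (p q : Fin n) :
    (Q * X * Qᵀ) p q = (Qᵀ *ᵥ stdVec p) ⬝ᵥ (X *ᵥ (Qᵀ *ᵥ stdVec q)) := by
  rw [Matrix.mulVec_mulVec, Matrix.mulVec_transpose, ← Matrix.dotProduct_mulVec,
    Matrix.mulVec_mulVec, ← Matrix.mul_assoc]
  simp [stdVec]

/-- A traceless matrix all of whose conjugates have vanishing `(p, q)` entry is zero. -/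
theorem eq_zero_of_conj_apply_eq_zero {p q r : Fin n} (hpq : p ≠ q) (hrp : r ≠ p) (hrq : r ≠ q)
    {X : Matrix (Fin n) (Fin n) ℝ} (hX : X.trace = 0)
    (h : ∀ Q : SOGroup n, (Q.1 * X * Q.1ᵀ) p q = 0) : X = 0 := by
  have hpair : ∀ x y : Fin n → ℝ, x ⬝ᵥ x = 1 → y ⬝ᵥ y = 1 → x ⬝ᵥ y = 0 →
      x ⬝ᵥ (X *ᵥ y) = 0 := by
    intro x y hx hy hxy
    obtain ⟨Q, rfl, rfl⟩ := exists_mulVec_stdVec_pair hpq hrp hrq hx hy hxy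
    have hQ := h Q⁻¹
    rwa [conj_apply, coe_inv, Matrix.transpose_transpose] at hQ
  have hoff : ∀ i j, i ≠ j → X i j = 0 := by
    intro i j hij
    simpa [stdVec] using hpair (stdVec i) (stdVec j) (by simp [stdVec]) (by simp [stdVec])
      (by simp [stdVec, hij])
  have hdiag : ∀ i j, X i i = X j j := by
    intro i j
    by_cases hij : i = j
    · rw [hij]
    obtain ⟨c, h2⟩ : ∃ c : ℝ, c * c = 2⁻¹ := ⟨√2⁻¹, Real.mul_self_sqrt (by norm_num)⟩
    have h0 := hpair (c • (stdVec i + stdVec j)) (c • (stdVec i - stdVec j))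
      (by simp [stdVec, hij, Ne.symm hij]; linarith)
      (by simp [stdVec, hij, Ne.symm hij]; linarith)
      (by simp [stdVec, hij, Ne.symm hij])
    simp only [stdVec, Matrix.mulVec_smul, smul_dotProduct, dotProduct_smul, smul_eq_mul,
      ← mul_assoc, h2, Matrix.mulVec_sub, Matrix.mulVec_single_one, add_dotProduct,
      single_one_dotProduct, Pi.sub_apply, Matrix.col_apply, hoff i j hij,
      hoff j i (Ne.symm hij)] at h0
    linarith
  ext i j
  rw [Matrix.zero_apply]
  by_cases hij : i = j
  · subst hij
    have hsum : X.trace = n * X i i := by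
      simp [Matrix.trace, Finset.sum_congr rfl fun k _ => hdiag k i]
    have hn : (n : ℝ) ≠ 0 := by
      have := i.pos
      positivity
    exact (mul_eq_zero.1 (hsum.symm.trans hX)).resolve_left hn
  · exact hoff i j hij

/-- Conjugation `X ↦ Q X Qᵀ` as a linear map. -/
def conjMap (Q : SOGroup n) : Matrix (Fin n) (Fin n) ℝ →ₗ[ℝ] Matrix (Fin n) (Fin n) ℝ :=
  LinearMap.mulRight ℝ Q.1ᵀ ∘ₗ LinearMap.mulLeft ℝ Q.1

theorem conjMap_apply (Q : SOGroup n) (X : Matrix (Fin n) (Fin n) ℝ) :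
    conjMap Q X = Q.1 * X * Q.1ᵀ := rfl

theorem conjMap_mul_apply (Q R : SOGroup n) (X : Matrix (Fin n) (Fin n) ℝ) :
    conjMap (Q * R) X = conjMap Q (conjMap R X) := by
  simp only [conjMap_apply, Submonoid.coe_mul, Matrix.transpose_mul, Matrix.mul_assoc]

theorem trace_conjMap (Q : SOGroup n) (X : Matrix (Fin n) (Fin n) ℝ) :
    (conjMap Q X).trace = X.trace := by
  rw [conjMap_apply, Matrix.trace_mul_comm, ← Matrix.mul_assoc, transpose_mul_self, Matrix.one_mul]

theorem transpose_conjMap (Q : SOGroup n) (X : Matrix (Fin n) (Fin n) ℝ) :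
    (conjMap Q X)ᵀ = conjMap Q Xᵀ := by
  simp only [conjMap_apply, Matrix.transpose_mul, Matrix.transpose_transpose, Matrix.mul_assoc]

/-- If a matrix coefficient of an irreducible representation agrees with the `(p, q)` entry on the
conjugation orbit of a traceless matrix `E`, then the representation embeds equivariantly into the
span of that orbit. -/
theorem exists_equivariant_embedding {p q r : Fin n} (hpq : p ≠ q) (hrp : r ≠ p) (hrq : r ≠ q)
    (hirr : ∀ U : Submodule ℝ V, (∀ Q, ∀ v ∈ U, ρ Q v ∈ U) → U = ⊥ ∨ U = ⊤)
    {u : V} (hu0 : u ≠ 0) {E : Matrix (Fin n) (Fin n) ℝ} (hE0 : E ≠ 0) (hE : E.trace = 0)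
    {f : V →ₗ[ℝ] ℝ} (hf : ∀ Q, f (ρ Q u) = conjMap Q E p q) :
    ∃ Θ : V →ₗ[ℝ] Matrix (Fin n) (Fin n) ℝ, Function.Injective Θ ∧
      (∀ Q v, Θ (ρ Q v) = conjMap Q (Θ v)) ∧
      ∀ v, Θ v ∈ Submodule.span ℝ (Set.range fun Q => conjMap Q E) := by
  let L : (SOGroup n →₀ ℝ) →ₗ[ℝ] V := Finsupp.linearCombination ℝ fun Q => ρ Q u
  let M : (SOGroup n →₀ ℝ) →ₗ[ℝ] Matrix (Fin n) (Fin n) ℝ :=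
    Finsupp.linearCombination ℝ fun Q => conjMap Q E
  have hLsingle : ∀ Q, L (Finsupp.single Q 1) = ρ Q u := fun Q => by simp [L]
  have hMsingle : ∀ Q, M (Finsupp.single Q 1) = conjMap Q E := fun Q => by simp [M]
  let shift : SOGroup n → (SOGroup n →₀ ℝ) →ₗ[ℝ] (SOGroup n →₀ ℝ) :=
    fun Q => Finsupp.lmapDomain ℝ ℝ fun R => Q * R
  have hLshift : ∀ Q w, L (shift Q w) = ρ Q (L w) := fun Q => by
    refine LinearMap.congr_fun (f := L ∘ₗ shift Q) (g := ρ Q ∘ₗ L) ?_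
    refine Finsupp.lhom_ext' fun R => LinearMap.ext_ring ?_
    simp [shift, L, Finsupp.mapDomain_single]
  have hMshift : ∀ Q w, M (shift Q w) = conjMap Q (M w) := fun Q => by
    refine LinearMap.congr_fun (f := M ∘ₗ shift Q) (g := conjMap Q ∘ₗ M) ?_
    refine Finsupp.lhom_ext' fun R => LinearMap.ext_ring ?_
    simp [shift, M, Finsupp.mapDomain_single, conjMap_mul_apply]
  have hfL : ∀ w, f (L w) = M w p q := by
    have h : f ∘ₗ L = Matrix.entryLinearMap ℝ ℝ p q ∘ₗ M := by
      refine Finsupp.lhom_ext' fun R => LinearMap.ext_ring ?_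
      simp [L, M, hf]
    exact fun w => LinearMap.congr_fun h w
  have hMtrace : ∀ w, (M w).trace = 0 := by
    have h : Matrix.traceLinearMap (Fin n) ℝ ℝ ∘ₗ M = 0 := by
      refine Finsupp.lhom_ext' fun R => LinearMap.ext_ring ?_
      simp [M, trace_conjMap, hE]
    exact fun w => LinearMap.congr_fun h w
  have hker : ∀ w, L w = 0 → M w = 0 := fun w hw =>
    eq_zero_of_conj_apply_eq_zero hpq hrp hrq (hMtrace w) fun Q => by
      rw [← conjMap_apply, ← hMshift, ← hfL, hLshift, hw, map_zero, map_zero]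
  have hLsurj : Function.Surjective L := by
    rw [← LinearMap.range_eq_top]
    refine (hirr (LinearMap.range L) ?_).resolve_left fun h => hu0 ?_
    · rintro Q _ ⟨w, rfl⟩
      exact ⟨shift Q w, hLshift Q w⟩
    · have h1 : L (Finsupp.single 1 1) ∈ LinearMap.range L := ⟨_, rfl⟩
      rw [h, Submodule.mem_bot, hLsingle, rep_one_apply] at h1
      exact h1
  obtain ⟨s, hs⟩ := LinearMap.exists_rightInverse_of_surjective L (LinearMap.range_eq_top.2 hLsurj)
  have hΘL : ∀ w, M (s (L w)) = M w := fun w => by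
    rw [← sub_eq_zero, ← map_sub]
    refine hker _ ?_
    rw [map_sub, sub_eq_zero]
    exact LinearMap.congr_fun hs (L w)
  have hequiv : ∀ Q v, M (s (ρ Q v)) = conjMap Q (M (s v)) := fun Q v => by
    obtain ⟨w, rfl⟩ := hLsurj v
    rw [hΘL, ← hLshift, hΘL, hMshift]
  refine ⟨M ∘ₗ s, ?_, hequiv, fun v => ?_⟩
  · rw [← LinearMap.ker_eq_bot]
    refine (hirr (LinearMap.ker (M ∘ₗ s)) fun Q v hv => ?_).resolve_right fun h => hE0 ?_
    · rw [LinearMap.mem_ker] at hv ⊢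
      rw [LinearMap.comp_apply, hequiv, ← LinearMap.comp_apply M s, hv, map_zero]
    · have h1 : L (Finsupp.single 1 1) ∈ LinearMap.ker (M ∘ₗ s) := h ▸ Submodule.mem_top
      rw [LinearMap.mem_ker, LinearMap.comp_apply, hΘL, hMsingle] at h1
      simpa [conjMap_apply] using h1
  · rw [LinearMap.comp_apply, ← Finsupp.range_linearCombination]
    exact ⟨s v, rfl⟩

/-- An irreducible representation of the dimension of the traceless symmetric matrices is
isomorphic to them. -/
theorem exists_equiv_symTraceless [FiniteDimensional ℝ V] (hn : 17 ≤ n)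
    (hirr : ∀ U : Submodule ℝ V, (∀ Q, ∀ v ∈ U, ρ Q v ∈ U) → U = ⊥ ∨ U = ⊤)
    (hd : 2 * Module.finrank ℝ V = (n - 1) * (n + 2)) :
    ∃ e : V ≃ₗ[ℝ] symTraceless n, ∀ Q v,
      (e (ρ Q v) : Matrix (Fin n) (Fin n) ℝ) = Q.1 * (e v).1 * Q.1ᵀ := by
  obtain ⟨hpair, hquad⟩ := weight_multiplicities hn hirr hd
  have hρ : IsTwoWeight ρ := ⟨by omega, hpair, hquad⟩
  let p : Fin n := ⟨0, by omega⟩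
  let q : Fin n := ⟨1, by omega⟩
  have hpq : p ≠ q := by simp [p, q]
  obtain ⟨r, hrp, hrq, -⟩ := exists_ne_of_four hρ.four_lt p q q q
  obtain ⟨⟨u, hu⟩, hu0⟩ := (Module.finrank_pos_iff_exists_ne_zero (R := ℝ)).1
    ((hpair p q hpq).symm ▸ Nat.one_pos)
  replace hu0 : u ≠ 0 := fun h => hu0 (Subtype.ext h)
  obtain ⟨f, hfu, hf⟩ := exists_weight_functional hu hu0 (z := r) (by simp [hrp, hrq])
  obtain ⟨η, hη, R, hRp, hRq, hR⟩ := hρ.exists_swap_sign hpq hu hu0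
  let E : Matrix (Fin n) (Fin n) ℝ := Matrix.single p q 1 + η • Matrix.single q p 1
  have hEtrace : E.trace = 0 := by
    simp [E, Matrix.trace_single_eq_of_ne _ _ _ hpq, Matrix.trace_single_eq_of_ne _ _ _ hpq.symm]
  have hEt : Eᵀ = η • E := by
    simp only [E, Matrix.transpose_add, Matrix.transpose_smul, Matrix.transpose_single, smul_add,
      smul_smul, hη, one_smul]
    exact add_comm _ _
  have hE0 : E ≠ 0 := fun h => by
    have h1 := congrFun (congrFun h p) q
    simp [E, hpq, hpq.symm] at h1
  have hcoeff : ∀ Q, f (ρ Q u) = conjMap Q E p q := fun Q => by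
    rw [hρ.functional_apply hpq hu hfu hf hη hRp hRq hR, conjMap_apply, conj_apply]
    simp [E, stdVec, Matrix.add_mulVec, Matrix.single_mulVec_eq]
    ring
  obtain ⟨Θ, hΘ, hequiv, hspan⟩ :=
    exists_equivariant_embedding hpq hrp hrq hirr hu0 hE0 hEtrace hcoeff
  have hΘt : ∀ v, (Θ v)ᵀ = η • Θ v := fun v => by
    refine Submodule.span_induction ?_ ?_ ?_ ?_ (hspan v)
    · rintro _ ⟨Q, rfl⟩
      rw [transpose_conjMap, hEt, map_smul]
    · simp
    · intro X Y _ _ hX hY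
      rw [Matrix.transpose_add, hX, hY, smul_add]
    · intro c X _ hX
      rw [Matrix.transpose_smul, hX, smul_comm]
  have hΘtrace : ∀ v, (Θ v).trace = 0 := fun v => by
    refine Submodule.span_induction ?_ ?_ ?_ ?_ (hspan v)
    · rintro _ ⟨Q, rfl⟩
      rw [trace_conjMap, hEtrace]
    · simp
    · intro X Y _ _ hX hY
      rw [Matrix.trace_add, hX, hY, add_zero]
    · intro c X _ hX
      rw [Matrix.trace_smul, hX, smul_zero]
  have harith : (n - 1) * (n + 2) = n * (n - 1) + 2 * (n - 1) := by ring
  rcases mul_self_eq_one_iff.1 hη with rfl | rfl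
  · let Θ' : V →ₗ[ℝ] symTraceless n :=
      Θ.codRestrict _ fun v => ⟨by rw [hΘt, one_smul], hΘtrace v⟩
    have hΘ' : Function.Injective Θ' := fun v w h => hΘ (congrArg Subtype.val h)
    have hle := LinearMap.finrank_le_finrank_of_injective hΘ'
    have hge := two_mul_finrank_symTraceless_le p
    refine ⟨LinearEquiv.ofBijective Θ' ⟨hΘ', ?_⟩, fun Q v => hequiv Q v⟩
    exact (LinearMap.injective_iff_surjective_of_finrank_eq_finrank (by omega)).1 hΘ'
  · have h := two_mul_finrank_le_of_skew Θ hΘ fun v => by rw [hΘt, neg_one_smul]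
    omega

end SOGroup

/-- Let `n ≥ 17`.  Every irreducible finite-dimensional continuous real
representation of `SO_n(ℝ)` (realized on `ℝᵈ`, `d > 0`) of dimension exactly
`(n−1)(n+2)/2` (i.e. `2d = (n−1)(n+2)`) is isomorphic to `Sym²₀(ℝⁿ)`, the real symmetric
traceless `n × n` matrices with the conjugation action `Q · X = Q X Qᵀ`. -/
theorem irreducible_of_dim_symTraceless_is_symTraceless
    (n : ℕ) (hn : 17 ≤ n)
    (d : ℕ) (hd0 : 0 < d) (hd : 2 * d = (n - 1) * (n + 2))
    (ρ : Matrix (Fin n) (Fin n) ℝ → Matrix (Fin d) (Fin d) ℝ)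
    (hρ1 : ρ 1 = 1)
    (hρmul : ∀ Q ∈ SOn n, ∀ R ∈ SOn n, ρ (Q * R) = ρ Q * ρ R)
    (hρunit : ∀ Q ∈ SOn n, IsUnit (ρ Q))
    (hρcont : ContinuousOn ρ (SOn n))
    (hirr : ∀ U : Submodule ℝ (Fin d → ℝ),
      (∀ Q ∈ SOn n, ∀ v ∈ U, (ρ Q).mulVec v ∈ U) → U = ⊥ ∨ U = ⊤) :
    ∃ e : (Fin d → ℝ) ≃ₗ[ℝ] symTraceless n,
      ∀ Q ∈ SOn n, ∀ v : Fin d → ℝ,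
        (e ((ρ Q).mulVec v) : Matrix (Fin n) (Fin n) ℝ)
          = Q * (e v : Matrix (Fin n) (Fin n) ℝ) * Qᵀ := by
  let π : SOGroup n →* Module.End ℝ (Fin d → ℝ) :=
    { toFun := fun Q => (ρ Q.1).mulVecLin
      map_one' := by
        rw [OneMemClass.coe_one, hρ1, Matrix.mulVecLin_one]
        rfl
      map_mul' := fun Q R => by
        rw [Submonoid.coe_mul, hρmul _ (SOGroup.mem_iff_transpose.1 Q.2) _
          (SOGroup.mem_iff_transpose.1 R.2), Matrix.mulVecLin_mul]
        rfl }
  obtain ⟨e, he⟩ := SOGroup.exists_equiv_symTraceless (ρ := π) hn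
    (fun U hU => hirr U fun Q hQ => hU ⟨Q, SOGroup.mem_iff_transpose.2 hQ⟩) (by simpa using hd)
  exact ⟨e, fun Q hQ => he ⟨Q, SOGroup.mem_iff_transpose.2 hQ⟩⟩
end

section
/- Let n ≥ 3, p ≥ 1, let n₁,…,n_{p+1} be positive integers with n₁+⋯+n_{p+1} = n, let a₁,…,a_{p+1} be pairwise distinct real numbers, and let D = diag(a₁I_{n₁},…,a_{p+1}I_{n_{p+1}}) and M = {QDQᵀ : Q ∈ SO_n(ℝ)}. If ε : M → Sym²₀(ℝⁿ) is an injective continuous SO_n(ℝ)-equivariant map (ε(QXQᵀ) = Qε(X)Qᵀ), then there exist pairwise distinct real numbers b₁,…,b_{p+1} with n₁b₁+⋯+n_{p+1}b_{p+1} = 0 such that the image of ε equals the orbit {Q diag(b₁I_{n₁},…,b_{p+1}I_{n_{p+1}}) Qᵀ : Q ∈ SO_n(ℝ)}, i.e., the image of any such embedding is a traceless isospectral model of the flag manifold with the same block multiplicities n₁,…,n_{p+1}. -/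
open Matrix Topology

/-- The signed permutation matrix with signs `s` and underlying permutation `σ`. -/
def signedPermMatrix {n : ℕ} (s : Fin n → ℝ) (σ : Equiv.Perm (Fin n)) :
    Matrix (Fin n) (Fin n) ℝ :=
  Matrix.diagonal s * σ.permMatrix ℝ

lemma signedPermMatrix_conj_apply {n : ℕ} (s : Fin n → ℝ) (σ : Equiv.Perm (Fin n))
    (X : Matrix (Fin n) (Fin n) ℝ) (k l : Fin n) :
    (signedPermMatrix s σ * X * (signedPermMatrix s σ)ᵀ) k l = s k * s l * X (σ k) (σ l) := by
  have h : signedPermMatrix s σ * X * (signedPermMatrix s σ)ᵀ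
      = Matrix.diagonal s * (σ.permMatrix ℝ * X * (σ.permMatrix ℝ)ᵀ) * Matrix.diagonal s := by
    simp only [signedPermMatrix, Matrix.transpose_mul, Matrix.diagonal_transpose, Matrix.mul_assoc]
  rw [h, Matrix.mul_diagonal, Matrix.diagonal_mul, Matrix.transpose_permMatrix,
    Equiv.Perm.permMatrix, Equiv.Perm.permMatrix, PEquiv.mul_toMatrix_toPEquiv,
    PEquiv.toMatrix_toPEquiv_mul]
  simp only [Matrix.submatrix_apply, id_eq, Equiv.Perm.inv_def, Equiv.symm_symm]
  ring

lemma signedPermMatrix_mem_SOn {n : ℕ} {s : Fin n → ℝ} {σ : Equiv.Perm (Fin n)}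
    (hs : ∀ k, s k * s k = 1) (hdet : (∏ k, s k) * ((Equiv.Perm.sign σ : ℤ) : ℝ) = 1) :
    signedPermMatrix s σ ∈ SOn n := by
  refine ⟨mul_eq_one_comm.mp ?_, ?_⟩
  · ext k l
    have h := signedPermMatrix_conj_apply s σ 1 k l
    rw [Matrix.mul_one] at h
    rw [h]
    by_cases hkl : k = l
    · subst hkl
      simp [hs]
    · simp [hkl]
  · rw [signedPermMatrix, Matrix.det_mul, Matrix.det_diagonal, Matrix.det_permutation]
    exact_mod_cast hdet

/-- A matrix of size at least `3` fixed under conjugation by all diagonal sign matrices of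
determinant `1` is diagonal. -/
lemma apply_eq_zero_of_conj_signs {n : ℕ} (hn : 3 ≤ n) {Y : Matrix (Fin n) (Fin n) ℝ}
    (hY : ∀ s : Fin n → ℝ, signedPermMatrix s 1 ∈ SOn n →
      signedPermMatrix s 1 * Y * (signedPermMatrix s 1)ᵀ = Y)
    {i j : Fin n} (hij : i ≠ j) : Y i j = 0 := by
  obtain ⟨k, hk⟩ : ∃ k, k ∉ ({i, j} : Finset (Fin n)) := by
    by_contra! h
    have h1 := Finset.card_le_card (fun x _ => h x : Finset.univ ⊆ ({i, j} : Finset (Fin n)))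
    have h2 := Finset.card_le_two (a := i) (b := j)
    simp only [Finset.card_univ, Fintype.card_fin] at h1
    omega
  simp only [Finset.mem_insert, Finset.mem_singleton, not_or] at hk
  let s : Fin n → ℝ := fun l => (if l = i then -1 else 1) * (if l = k then -1 else 1)
  have hs : signedPermMatrix s 1 ∈ SOn n := by
    refine signedPermMatrix_mem_SOn (fun l => ?_) ?_
    · simp only [s]
      split_ifs <;> norm_num
    · simp only [s, Finset.prod_mul_distrib, Finset.prod_ite_eq', Finset.mem_univ]
      simp
  have h := signedPermMatrix_conj_apply s 1 Y i j
  rw [hY s hs] at h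
  simp [s, hij.symm, Ne.symm hk.1, Ne.symm hk.2] at h
  linarith

lemma exists_swap_conj {n : ℕ} {i j : Fin n} (hij : i ≠ j) :
    ∃ Q ∈ SOn n, ∀ d : Fin n → ℝ,
      Q * Matrix.diagonal d * Qᵀ = Matrix.diagonal (d ∘ Equiv.swap i j) := by
  let s : Fin n → ℝ := fun l => if l = i then -1 else 1
  have hs : ∀ l, s l * s l = 1 := fun l => by
    simp only [s]
    split_ifs <;> norm_num
  refine ⟨signedPermMatrix s (Equiv.swap i j), signedPermMatrix_mem_SOn hs ?_, fun d => ?_⟩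
  · simp [s, Equiv.Perm.sign_swap hij]
  · ext k l
    rw [signedPermMatrix_conj_apply]
    by_cases hkl : k = l
    · subst hkl
      simp [hs]
    · simp [hkl]

/-- With `M = {Q D Qᵀ : Q ∈ SO_n(ℝ)}` the isospectral model of the flag
manifold (`n ≥ 3`, `p ≥ 1`, blocks of sizes `n₁, …, n_{p+1}`, pairwise distinct `a_i`), if
`ε : M → Sym²₀(ℝⁿ)` is an injective continuous `SO_n(ℝ)`-equivariant map into the symmetric
traceless matrices, then there exist pairwise distinct reals `b₁, …, b_{p+1}` with
`n₁b₁ + ⋯ + n_{p+1}b_{p+1} = 0` such that the image of `ε` equals the orbit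
`{Q diag(b₁ I_{n₁}, …, b_{p+1} I_{n_{p+1}}) Qᵀ : Q ∈ SO_n(ℝ)}`: the image of any such
embedding is a traceless isospectral model with the same block multiplicities. -/
theorem image_of_equivariant_embedding_is_traceless_isospectral_model
    (n p : ℕ) (hn : 3 ≤ n) (hp : 1 ≤ p)
    (nn : Fin (p + 1) → ℕ) (hpos : ∀ i, 0 < nn i) (hsum : ∑ i, nn i = n)
    (blk : Fin n → Fin (p + 1)) (hmono : Monotone blk)
    (hfib : ∀ i, (Finset.univ.filter fun j => blk j = i).card = nn i)
    (a : Fin (p + 1) → ℝ) (ha : Function.Injective a)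
    (D : Matrix (Fin n) (Fin n) ℝ) (hD : D = Matrix.diagonal fun j => a (blk j))
    (M : Set (Matrix (Fin n) (Fin n) ℝ)) (hM : M = {X | ∃ Q ∈ SOn n, X = Q * D * Qᵀ})
    (ε : Matrix (Fin n) (Fin n) ℝ → Matrix (Fin n) (Fin n) ℝ)
    (hεval : ∀ X ∈ M, (ε X)ᵀ = ε X ∧ (ε X).trace = 0)
    (hεinj : Set.InjOn ε M) (hεcont : ContinuousOn ε M)
    (hεeqv : ∀ Q ∈ SOn n, ∀ X ∈ M, ε (Q * X * Qᵀ) = Q * ε X * Qᵀ) :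
    ∃ b : Fin (p + 1) → ℝ, Function.Injective b ∧
      (∑ i, (nn i : ℝ) * b i = 0) ∧
      ε '' M = {X | ∃ Q ∈ SOn n, X = Q * Matrix.diagonal (fun j => b (blk j)) * Qᵀ} := by
  have h1 : (1 : Matrix (Fin n) (Fin n) ℝ) ∈ SOn n := by simp [SOn]
  have hDM : D ∈ M := by
    rw [hM]
    exact ⟨1, h1, by simp⟩
  have hstab : ∀ Q ∈ SOn n, Q * D * Qᵀ = D → Q * ε D * Qᵀ = ε D := fun Q hQ h => by
    rw [← hεeqv Q hQ D hDM, h]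
  have hstab_conv : ∀ Q ∈ SOn n, Q * ε D * Qᵀ = ε D → Q * D * Qᵀ = D := fun Q hQ h => by
    refine hεinj ?_ hDM ((hεeqv Q hQ D hDM).trans h)
    rw [hM]
    exact ⟨Q, hQ, rfl⟩
  have hoff : ∀ i j, i ≠ j → ε D i j = 0 := fun i j hij => by
    refine apply_eq_zero_of_conj_signs hn (fun s hs => hstab _ hs ?_) hij
    ext k l
    have hkk := congrArg (fun A => A k k) (mul_eq_one_comm.mp hs.1)
    nth_rw 1 [← Matrix.mul_one (signedPermMatrix s 1)] at hkk
    simp only [signedPermMatrix_conj_apply] at hkk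
    rw [signedPermMatrix_conj_apply, hD]
    by_cases hkl : k = l
    · subst hkl
      simp at hkk
      simp [hkk]
    · simp [hkl]
  have hdiag : ε D = Matrix.diagonal fun j => ε D j j := by
    ext k l
    by_cases hkl : k = l
    · subst hkl
      simp
    · simp [hkl, hoff k l hkl]
  have hblk : ∀ i j, blk i = blk j → ε D i i = ε D j j := fun i j hb => by
    by_cases hij : i = j
    · rw [hij]
    obtain ⟨Q, hQ, hconj⟩ := exists_swap_conj hij
    have h := hstab Q hQ <| by
      rw [hD, hconj]
      congr 1
      funext k
      simp only [Function.comp_apply, Equiv.swap_apply_def]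
      split_ifs with hki hkj
      · rw [hki, hb]
      · rw [hkj, hb]
      · rfl
    rw [hdiag, hconj, Matrix.diagonal_injective.eq_iff] at h
    simpa using (congrFun h i).symm
  have hsurj : ∀ i, ∃ j, blk j = i := fun i => by
    have h := hpos i
    rw [← hfib i, Finset.card_pos] at h
    obtain ⟨j, hj⟩ := h
    exact ⟨j, by simpa using hj⟩
  choose r hr using hsurj
  have hb : ε D = Matrix.diagonal fun j => ε D (r (blk j)) (r (blk j)) := by
    rw [hdiag]
    congr 1
    funext j
    simpa using hblk j (r (blk j)) (hr _).symm
  refine ⟨fun i => ε D (r i) (r i), fun i j hij => ?_, ?_, ?_⟩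
  · by_contra hne
    have hrne : r i ≠ r j := fun h => hne (by rw [← hr i, h, hr j])
    obtain ⟨Q, hQ, hconj⟩ := exists_swap_conj hrne
    have h := hstab_conv Q hQ <| by
      rw [hdiag, hconj]
      congr 1
      funext k
      simp only [Function.comp_apply, Equiv.swap_apply_def]
      split_ifs with hki hkj
      · rw [hki]
        exact hij.symm
      · rw [hkj]
        exact hij
      · rfl
    rw [hD, hconj, Matrix.diagonal_injective.eq_iff] at h
    have h' := congrFun h (r i)
    simp only [Function.comp_apply, Equiv.swap_apply_left, hr] at h'
    exact hne (ha h'.symm)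
  · have ht := (hεval D hDM).2
    rw [hb, Matrix.trace_diagonal, ← Finset.sum_fiberwise _ blk] at ht
    rw [← ht]
    refine Finset.sum_congr rfl fun i _ => ?_
    rw [← hfib i, ← nsmul_eq_mul, ← Finset.sum_const]
    refine Finset.sum_congr rfl fun j hj => ?_
    rw [(Finset.mem_filter.mp hj).2]
  · rw [← hb]
    ext X
    simp only [Set.mem_image, Set.mem_ofPred_eq, hM]
    constructor
    · rintro ⟨_, ⟨Q, hQ, rfl⟩, rfl⟩
      exact ⟨Q, hQ, hεeqv Q hQ D hDM⟩
    · rintro ⟨Q, hQ, rfl⟩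
      exact ⟨_, ⟨Q, hQ, rfl⟩, hεeqv Q hQ D hDM⟩
end

section
/- Let n ≥ 17 and let k be an integer with 1 ≤ k < (n−1)/2. Let V(k,n) = {Y ∈ ℝ^{n×k} : YᵀY = I_k} be the Stiefel manifold, on which SO_n(ℝ) acts by left multiplication Q·Y = QY. If (W,ρ) is any finite-dimensional continuous real representation of SO_n(ℝ) and ε : V(k,n) → W is an injective continuous SO_n(ℝ)-equivariant map, then dim W ≥ nk; and if dim W = nk, then W is isomorphic as an SO_n(ℝ)-representation to the direct sum (ℝⁿ)^{⊕k} of k copies of the standard representation ℝⁿ (equivalently, to ℝ^{n×k} with the action Q·Y = QY). -/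
open Matrix Topology

namespace StiefelEmbedding

section Group

variable {ι : Type*} [Fintype ι] [DecidableEq ι]

/-- The rotation by the angle `θ` in the oriented coordinate plane `(i, j)`. -/
noncomputable def rotMatrix (i j : ι) (θ : ℝ) : Matrix ι ι ℝ :=
  fun a b =>
    if a = i then (if b = i then Real.cos θ else if b = j then -Real.sin θ else 0)
    else if a = j then (if b = i then Real.sin θ else if b = j then Real.cos θ else 0)
    else if a = b then 1 else 0

theorem rotMatrix_mulVec {i j : ι} (hij : i ≠ j) (θ : ℝ) (v : ι → ℝ) (a : ι) :
    (rotMatrix i j θ *ᵥ v) a =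
      if a = i then Real.cos θ * v i - Real.sin θ * v j
      else if a = j then Real.sin θ * v i + Real.cos θ * v j else v a := by
  have key : ∀ x y : ℝ, ∑ b, (if b = i then x else if b = j then y else 0) * v b
      = x * v i + y * v j := by
    intro x y
    have : ∀ b, (if b = i then x else if b = j then y else 0) * v b
        = (if b = i then x * v i else 0) + (if b = j then y * v j else 0) := by
      intro b
      by_cases h1 : b = i
      · subst h1; simp [hij]
      · by_cases h2 : b = j
        · subst h2; simp [h1]
        · simp [h1, h2]
    simp [this, Finset.sum_add_distrib]
  simp only [mulVec, dotProduct, rotMatrix]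
  by_cases h1 : a = i
  · simp only [h1, if_true, key]; ring
  · by_cases h2 : a = j
    · simp only [h2, if_true, if_false, key, hij.symm]
    · simp [h1, h2]

theorem eq_of_mulVec_eq {A B : Matrix ι ι ℝ} (h : ∀ v a, (A *ᵥ v) a = (B *ᵥ v) a) : A = B :=
  Matrix.ext_of_mulVec_single fun _ => funext fun a => h _ a

theorem rotMatrix_mul_rotMatrix {i j : ι} (hij : i ≠ j) (θ φ : ℝ) :
    rotMatrix i j θ * rotMatrix i j φ = rotMatrix i j (θ + φ) := by
  refine eq_of_mulVec_eq fun v a => ?_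
  rw [← mulVec_mulVec]
  simp only [rotMatrix_mulVec hij, Real.cos_add, Real.sin_add, hij.symm, if_true, if_false]
  split_ifs <;> ring

theorem rotMatrix_zero {i j : ι} (hij : i ≠ j) : rotMatrix i j 0 = (1 : Matrix ι ι ℝ) := by
  refine eq_of_mulVec_eq fun v a => ?_
  simp only [rotMatrix_mulVec hij, Real.cos_zero, Real.sin_zero, one_mulVec]
  split_ifs with h1 h2 <;> simp_all

theorem rotMatrix_transpose {α : Type*} [DecidableEq α] {i j : α} (hij : i ≠ j) (θ : ℝ) :
    (rotMatrix i j θ)ᵀ = rotMatrix i j (-θ) := by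
  ext a b
  simp only [transpose_apply, rotMatrix, Real.cos_neg, Real.sin_neg, neg_neg]
  by_cases ai : a = i <;> by_cases aj : a = j <;> by_cases bi : b = i <;> by_cases bj : b = j <;>
    simp [ai, aj, bi, bj, hij.symm, eq_comm]

theorem transpose_mul_rotMatrix {i j : ι} (hij : i ≠ j) (θ : ℝ) :
    (rotMatrix i j θ)ᵀ * rotMatrix i j θ = 1 := by
  rw [rotMatrix_transpose hij, rotMatrix_mul_rotMatrix hij, neg_add_cancel, rotMatrix_zero hij]

theorem rotMatrix_det {i j : ι} (hij : i ≠ j) (θ : ℝ) : (rotMatrix i j θ).det = 1 := by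
  have h1 : (rotMatrix i j (θ / 2)).det * (rotMatrix i j (θ / 2)).det = 1 := by
    have := congrArg det (transpose_mul_rotMatrix hij (θ / 2))
    rwa [det_mul, det_transpose, det_one] at this
  rw [← add_halves θ, ← rotMatrix_mul_rotMatrix hij, det_mul, h1]

theorem mem_specialOrthogonalGroup_of_transpose_mul {Q : Matrix ι ι ℝ} (h : Qᵀ * Q = 1)
    (hdet : Q.det = 1) : Q ∈ specialOrthogonalGroup ι ℝ :=
  mem_specialOrthogonalGroup_iff.2 ⟨(mem_orthogonalGroup_iff' ι ℝ).2 h, hdet⟩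

theorem transpose_mul_self (Q : specialOrthogonalGroup ι ℝ) : Q.1ᵀ * Q.1 = 1 :=
  (mem_orthogonalGroup_iff' ι ℝ).1 (mem_specialOrthogonalGroup_iff.1 Q.2).1

theorem det_coe (Q : specialOrthogonalGroup ι ℝ) : Q.1.det = 1 :=
  (mem_specialOrthogonalGroup_iff.1 Q.2).2

/-- Rotation in a coordinate plane, as an element of the special orthogonal group. -/
noncomputable def rot {i j : ι} (hij : i ≠ j) (θ : ℝ) : specialOrthogonalGroup ι ℝ :=
  ⟨rotMatrix i j θ, mem_specialOrthogonalGroup_of_transpose_mul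
    (transpose_mul_rotMatrix hij θ) (rotMatrix_det hij θ)⟩

/-- The diagonal matrix that changes the signs of the coordinates `i` and `j`
(the identity if `i = j`). -/
def flipMatrix (i j : ι) : Matrix ι ι ℝ :=
  diagonal fun c => (if c = i then -1 else 1) * (if c = j then -1 else 1)

/-- The sign change of two coordinates, as an element of the special orthogonal group. -/
def flip (i j : ι) : specialOrthogonalGroup ι ℝ :=
  ⟨flipMatrix i j, mem_specialOrthogonalGroup_of_transpose_mul
    (by
      rw [flipMatrix, diagonal_transpose, diagonal_mul_diagonal, ← diagonal_one]
      congr 1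
      funext c
      split_ifs <;> norm_num)
    (by rw [flipMatrix, det_diagonal, Finset.prod_mul_distrib]; simp)⟩

theorem rot_mulVec {i j : ι} (hij : i ≠ j) (θ : ℝ) (v : ι → ℝ) (a : ι) :
    ((rot hij θ).1 *ᵥ v) a =
      if a = i then Real.cos θ * v i - Real.sin θ * v j
      else if a = j then Real.sin θ * v i + Real.cos θ * v j else v a :=
  rotMatrix_mulVec hij θ v a

theorem flip_mulVec (i j : ι) (v : ι → ℝ) (a : ι) :
    ((flip i j).1 *ᵥ v) a = (if a = i then -1 else 1) * (if a = j then -1 else 1) * v a := by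
  simp [flip, flipMatrix, mulVec_diagonal]

theorem group_ext {g h : specialOrthogonalGroup ι ℝ} (H : ∀ v a, (g.1 *ᵥ v) a = (h.1 *ᵥ v) a) :
    g = h :=
  Subtype.ext (eq_of_mulVec_eq H)

theorem coe_mul_mulVec (g h : specialOrthogonalGroup ι ℝ) (v : ι → ℝ) :
    (g * h).1 *ᵥ v = g.1 *ᵥ (h.1 *ᵥ v) := by
  rw [mulVec_mulVec]; rfl

theorem rot_mul_rot {i j : ι} (hij : i ≠ j) (θ φ : ℝ) :
    rot hij θ * rot hij φ = rot hij (θ + φ) :=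
  Subtype.ext (rotMatrix_mul_rotMatrix hij θ φ)

theorem rot_zero {i j : ι} (hij : i ≠ j) : rot hij 0 = 1 :=
  Subtype.ext (rotMatrix_zero hij)

theorem rot_inv {i j : ι} (hij : i ≠ j) (θ : ℝ) : (rot hij θ)⁻¹ = rot hij (-θ) := by
  rw [inv_eq_iff_mul_eq_one, rot_mul_rot, add_neg_cancel, rot_zero]

theorem flip_mul_flip (i j k : ι) : flip i j * flip j k = flip i k := by
  refine group_ext fun v a => ?_
  simp only [coe_mul_mulVec, flip_mulVec]
  split_ifs <;> ring

theorem flip_comm (i j : ι) : flip i j = flip j i := by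
  refine group_ext fun v a => ?_
  simp only [flip_mulVec]
  ring

theorem flip_self (i : ι) : flip i i = 1 := by
  refine group_ext fun v a => ?_
  rw [flip_mulVec, OneMemClass.coe_one, one_mulVec]
  split_ifs <;> ring

theorem flip_mul_self (i j : ι) : flip i j * flip i j = 1 := by
  nth_rw 2 [flip_comm]
  rw [flip_mul_flip, flip_self]

theorem flip_commute (i j k l : ι) : Commute (flip i j) (flip k l) := by
  refine group_ext fun v a => ?_
  simp only [coe_mul_mulVec, flip_mulVec]
  ring

theorem rot_commute_flip {i j k l : ι} (hij : i ≠ j) (hik : i ≠ k) (hil : i ≠ l) (hjk : j ≠ k)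
    (hjl : j ≠ l) (θ : ℝ) : Commute (rot hij θ) (flip k l) := by
  refine group_ext fun v a => ?_
  simp only [coe_mul_mulVec, flip_mulVec, rot_mulVec]
  by_cases h1 : a = i
  · subst h1; simp [*]
  · by_cases h2 : a = j
    · subst h2; simp [*]
    · simp [*]

theorem rot_commute_flip_self {i j : ι} (hij : i ≠ j) (θ : ℝ) :
    Commute (rot hij θ) (flip i j) := by
  refine group_ext fun v a => ?_
  simp only [coe_mul_mulVec, flip_mulVec, rot_mulVec]
  by_cases h1 : a = i
  · subst h1; simp [hij, hij.symm]; ring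
  · by_cases h2 : a = j
    · subst h2; simp [hij, hij.symm]; ring
    · simp [*]

theorem flip_mul_rot {i j k : ι} (hij : i ≠ j) (hik : i ≠ k) (hjk : j ≠ k) (θ : ℝ) :
    flip j k * rot hij θ = rot hij (-θ) * flip j k := by
  refine group_ext fun v a => ?_
  simp only [coe_mul_mulVec, flip_mulVec, rot_mulVec, Real.cos_neg, Real.sin_neg]
  by_cases h1 : a = i
  · subst h1; simp [*]
  · by_cases h2 : a = j
    · subst h2; simp [*]; ring
    · simp [*]

theorem rot_half_pi_mul_flip {i j : ι} (hij : i ≠ j) (a b : ι) :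
    rot hij (Real.pi / 2) * flip a b
      = flip (Equiv.swap i j a) (Equiv.swap i j b) * rot hij (Real.pi / 2) := by
  have key : ∀ c a, (if c = Equiv.swap i j a then (-1 : ℝ) else 1)
      = if Equiv.swap i j c = a then -1 else 1 := by
    intro c a
    simp only [Equiv.swap_apply_eq_iff]
  refine group_ext fun v c => ?_
  simp only [coe_mul_mulVec, flip_mulVec, rot_mulVec, Real.cos_pi_div_two, Real.sin_pi_div_two, key]
  by_cases h1 : c = i
  · subst h1; simp
  · by_cases h2 : c = j
    · subst h2; simp [h1]
    · simp [h1, h2, Equiv.swap_apply_of_ne_of_ne h1 h2]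

theorem exists_conj_flip (σ : Equiv.Perm ι) :
    ∃ g : specialOrthogonalGroup ι ℝ, ∀ a b, g * flip a b = flip (σ a) (σ b) * g := by
  induction σ using Equiv.Perm.swap_induction_on with
  | one => exact ⟨1, by simp⟩
  | swap_mul f x y hxy ih =>
    obtain ⟨g, hg⟩ := ih
    refine ⟨rot hxy (Real.pi / 2) * g, fun a b => ?_⟩
    rw [mul_assoc, hg, ← mul_assoc, rot_half_pi_mul_flip, mul_assoc]
    rfl

/-- Coordinate rotations move a vector into the hyperplanes `v j = 0`, `j ∈ s`. -/
theorem exists_mulVec_eq_zero (H : Subgroup (specialOrthogonalGroup ι ℝ)) (m : ι) (s : Finset ι)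
    (hm : m ∉ s) (hH : ∀ a ∈ s, ∀ h : m ≠ a, ∀ θ, rot h θ ∈ H) (x : ι → ℝ) :
    ∃ h ∈ H, (∀ j ∈ s, (h.1 *ᵥ x) j = 0) ∧ (∀ j ∉ s, j ≠ m → ∀ v, (h.1 *ᵥ v) j = v j) ∧
      (s.Nonempty → 0 ≤ (h.1 *ᵥ x) m) := by
  induction s using Finset.induction_on with
  | empty => exact ⟨1, H.one_mem, by simp, by simp, by simp⟩
  | insert a s ha ih =>
    have hma : m ≠ a := fun h => hm (h ▸ Finset.mem_insert_self _ _)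
    obtain ⟨h, hh, h0, hfix, -⟩ := ih (fun h => hm (Finset.mem_insert_of_mem h))
      (fun b hb => hH b (Finset.mem_insert_of_mem hb))
    set y := h.1 *ᵥ x with hy
    set z : ℂ := ⟨y m, y a⟩ with hz
    have hc : ‖z‖ * Real.cos z.arg = y m := Complex.norm_mul_cos_arg z
    have hs : ‖z‖ * Real.sin z.arg = y a := Complex.norm_mul_sin_arg z
    have hcs := Real.sin_sq_add_cos_sq z.arg
    refine ⟨rot hma (-z.arg) * h, H.mul_mem (hH a (Finset.mem_insert_self _ _) hma _) hh, ?_⟩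
    simp only [coe_mul_mulVec, ← hy, rot_mulVec, Real.cos_neg, Real.sin_neg]
    refine ⟨fun j hj => ?_, fun j hj hjm v => ?_, fun _ => ?_⟩
    · have hjm : j ≠ m := fun h => hm (h ▸ hj)
      rcases Finset.mem_insert.1 hj with rfl | hj
      · simp only [hjm, if_true, if_false]
        rw [← hc, ← hs]; ring
      · have : j ≠ a := fun h => ha (h ▸ hj)
        simp [hjm, this, h0 j hj]
    · rw [Finset.mem_insert, not_or] at hj
      simp [hjm, hj.1, hfix j hj.2 hjm]
    · simp only [if_true]
      have : Real.cos z.arg * y m - -Real.sin z.arg * y a = ‖z‖ := by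
        rw [← hc, ← hs]
        linear_combination ‖z‖ * hcs
      rw [this]
      exact norm_nonneg z

theorem dotProduct_mulVec_mulVec (Q : specialOrthogonalGroup ι ℝ) (x y : ι → ℝ) :
    (Q.1 *ᵥ x) ⬝ᵥ (Q.1 *ᵥ y) = x ⬝ᵥ y := by
  rw [dotProduct_mulVec, vecMul_mulVec, ← dotProduct_mulVec, dotProduct_comm, transpose_mul_self,
    one_mulVec, dotProduct_comm]

theorem mul_mulVec_apply_of_mulVec_single (Q : specialOrthogonalGroup ι ℝ) {a : ι} {t : ℝ}
    (h : Q.1 *ᵥ Pi.single a 1 = Pi.single a t) (v : ι → ℝ) : (Q.1 *ᵥ v) a * t = v a := by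
  have := dotProduct_mulVec_mulVec Q v (Pi.single a 1)
  rwa [h, dotProduct_single, dotProduct_single, mul_one] at this

/-- A special orthogonal matrix that preserves the coordinates outside `s` is a product of
rotations in the coordinate planes spanned by basis vectors in `s`. -/
theorem mem_of_forall_rot_mem (H : Subgroup (specialOrthogonalGroup ι ℝ)) (s : Finset ι)
    (hH : ∀ a ∈ s, ∀ b ∈ s, ∀ h : a ≠ b, ∀ θ, rot h θ ∈ H) (Q : specialOrthogonalGroup ι ℝ)
    (hQ : ∀ i ∉ s, ∀ v, (Q.1 *ᵥ v) i = v i) : Q ∈ H := by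
  induction s using Finset.induction_on generalizing Q with
  | empty =>
    have : Q = 1 := group_ext fun v a => by simp [hQ a]
    rw [this]; exact H.one_mem
  | insert a s ha ih =>
    rcases s.eq_empty_or_nonempty with rfl | hs
    · have hQa : Q.1 *ᵥ Pi.single a 1 = Pi.single a (Q.1 a a) := by
        funext i
        by_cases hi : i = a
        · subst hi; simp
        · rw [hQ i (by simpa using hi), Pi.single_eq_of_ne hi, Pi.single_eq_of_ne hi]
      have hsq : Q.1 a a * Q.1 a a = 1 := by
        simpa using mul_mulVec_apply_of_mulVec_single Q hQa (Pi.single a 1)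
      have hdiag : Q.1 = diagonal fun c => if c = a then Q.1 a a else 1 := by
        refine eq_of_mulVec_eq fun v c => ?_
        rw [mulVec_diagonal]
        by_cases hc : c = a
        · subst hc
          have := mul_mulVec_apply_of_mulVec_single Q hQa v
          simp only [if_true]
          linear_combination Q.1 c c * this - (Q.1 *ᵥ v) c * hsq
        · simp [hc, hQ c (by simpa using hc)]
      have hdet := det_coe Q
      rw [hdiag, det_diagonal] at hdet
      simp only [Finset.prod_ite_eq', Finset.mem_univ, if_true] at hdet
      have : Q = 1 := Subtype.ext (by rw [hdiag, hdet]; simp)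
      rw [this]; exact H.one_mem
    · obtain ⟨h, hh, h0, hfix, hpos⟩ := exists_mulVec_eq_zero H a s ha
        (fun b hb => hH a (Finset.mem_insert_self _ _) b (Finset.mem_insert_of_mem hb))
        (Q.1 *ᵥ Pi.single a 1)
      have hrow : ∀ i ∉ s, i ≠ a → ∀ v, ((h * Q).1 *ᵥ v) i = v i := fun i hi hia v => by
        rw [coe_mul_mulVec, hfix i hi hia, hQ i (by simp [hi, hia])]
      have hcol : (h * Q).1 *ᵥ Pi.single a 1 = Pi.single a (((h * Q).1 *ᵥ Pi.single a 1) a) := by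
        funext i
        by_cases hia : i = a
        · subst hia; simp
        · rw [Pi.single_eq_of_ne hia]
          by_cases hi : i ∈ s
          · rw [coe_mul_mulVec, h0 i hi]
          · rw [hrow i hi hia, Pi.single_eq_of_ne hia]
      have hsq := mul_mulVec_apply_of_mulVec_single _ hcol (Pi.single a 1)
      rw [Pi.single_eq_same] at hsq
      have hone : ((h * Q).1 *ᵥ Pi.single a 1) a = 1 := by
        have := hpos hs
        rw [← coe_mul_mulVec] at this
        nlinarith
      rw [hone] at hcol
      have : h * Q ∈ H := by
        refine ih (fun b hb c hc => hH b (Finset.mem_insert_of_mem hb) c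
          (Finset.mem_insert_of_mem hc)) (h * Q) fun i hi v => ?_
        by_cases hia : i = a
        · subst hia
          simpa using mul_mulVec_apply_of_mulVec_single _ hcol v
        · exact hrow i hi hia v
      exact (H.mul_mem_cancel_left hh).1 this

end Group

section Weights

variable {ι κ : Type*} [Fintype ι] [DecidableEq ι] [Fintype κ] [DecidableEq κ]
  (ρ : specialOrthogonalGroup ι ℝ →* Matrix κ κ ℝ)

/-- The sign vector which is `-1` exactly on `S`. -/
def sgn (S : Finset ι) (a : ι) : ℝ := if a ∈ S then -1 else 1

theorem sgn_compl (S : Finset ι) (a : ι) : sgn Sᶜ a = -sgn S a := by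
  unfold sgn
  by_cases h : a ∈ S <;> simp [h]

/-- `w` is a weight vector, for the group of diagonal matrices, of the weight given by the signs
`sgn S`. -/
def IsWeightVector (S : Finset ι) (w : κ → ℝ) : Prop :=
  w ≠ 0 ∧ ∀ a b, ρ (flip a b) *ᵥ w = (sgn S a * sgn S b) • w

theorem map_flip_mul_self (i j : ι) : ρ (flip i j) * ρ (flip i j) = 1 := by
  rw [← map_mul, flip_mul_self, map_one]

theorem map_flip_mul_one_sub (i j : ι) :
    ρ (flip i j) * (1 - ρ (flip i j)) = -(1 - ρ (flip i j)) := by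
  rw [mul_sub, map_flip_mul_self, mul_one, neg_sub]

theorem map_flip_mul_flip (i j k : ι) : ρ (flip i j) * ρ (flip j k) = ρ (flip i k) := by
  rw [← map_mul, flip_mul_flip]

theorem map_flip_commute (i j k l : ι) : Commute (ρ (flip i j)) (ρ (flip k l)) :=
  (flip_commute i j k l).map ρ

theorem one_sub_map_flip_commute (i j k l : ι) :
    Commute (1 - ρ (flip i j)) (1 - ρ (flip k l)) :=
  (Commute.one_left _).sub_left ((Commute.one_right _).sub_right (map_flip_commute ρ i j k l))

variable {ρ}

theorem IsWeightVector.compl {S : Finset ι} {w : κ → ℝ} (h : IsWeightVector ρ S w) :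
    IsWeightVector ρ Sᶜ w :=
  ⟨h.1, fun a b => by rw [h.2, sgn_compl, sgn_compl, neg_mul_neg]⟩

theorem IsWeightVector.exists_of_card_eq {S T : Finset ι} {w : κ → ℝ} (h : IsWeightVector ρ S w)
    (hST : S.card = T.card) : ∃ w', IsWeightVector ρ T w' := by
  classical
  obtain ⟨e⟩ : Nonempty ({x // x ∈ T} ≃ {x // x ∈ S}) :=
    ⟨(Finset.equivOfCardEq hST).symm⟩
  let σ : Equiv.Perm ι := e.extendSubtype
  have hσ : ∀ a, sgn S (σ a) = sgn T a := by
    intro a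
    unfold sgn
    by_cases ha : a ∈ T
    · simp only [ha, if_true, σ, e.extendSubtype_mem a ha]
    · simp only [ha, if_false, σ, e.extendSubtype_not_mem a ha]
  obtain ⟨g, hg⟩ := exists_conj_flip σ
  refine ⟨ρ g⁻¹ *ᵥ w, fun h0 => h.1 ?_, fun a b => ?_⟩
  · have := congrArg (ρ g *ᵥ ·) h0
    simpa [← map_mul] using this
  · have : flip a b * g⁻¹ = g⁻¹ * flip (σ a) (σ b) := by
      rw [mul_inv_eq_iff_eq_mul, mul_assoc, ← hg, inv_mul_cancel_left]
    rw [mulVec_mulVec, ← map_mul, this, map_mul, ← mulVec_mulVec, h.2, mulVec_smul, hσ, hσ]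

theorem exists_isWeightVector_of_mul_ne_zero {i j k l : ι}
    (hne : (1 - ρ (flip i j)) * (1 - ρ (flip k l)) ≠ 0) :
    ∃ S w, IsWeightVector ρ S w ∧ sgn S i * sgn S j = -1 ∧ sgn S k * sgn S l = -1 := by
  classical
  have step : ∀ F : Finset ι, ∃ w : κ → ℝ, w ≠ 0 ∧ ρ (flip i j) *ᵥ w = -w ∧
      ρ (flip k l) *ᵥ w = -w ∧
      ∀ a ∈ F, ρ (flip i a) *ᵥ w = w ∨ ρ (flip i a) *ᵥ w = -w := by
    intro F
    induction F using Finset.induction_on with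
    | empty =>
      obtain ⟨v, hv⟩ : ∃ v, ((1 - ρ (flip i j)) * (1 - ρ (flip k l))) *ᵥ v ≠ 0 := by
        by_contra! h
        exact hne (Matrix.ext_of_mulVec_single fun a => by rw [h, zero_mulVec])
      refine ⟨_, hv, ?_, ?_, by simp⟩
      · rw [mulVec_mulVec, ← neg_mulVec]
        congr 1
        rw [← mul_assoc, map_flip_mul_one_sub, neg_mul]
      · rw [mulVec_mulVec, ← neg_mulVec]
        congr 1
        rw [(one_sub_map_flip_commute ρ i j k l).eq, ← mul_assoc, map_flip_mul_one_sub, neg_mul]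
    | insert a F ha ih =>
      obtain ⟨w, hw, h1, h2, h3⟩ := ih
      have hcomm : ∀ p q, ρ (flip p q) *ᵥ (ρ (flip i a) *ᵥ w) = ρ (flip i a) *ᵥ (ρ (flip p q) *ᵥ w) :=
        fun p q => by
          rw [mulVec_mulVec, mulVec_mulVec, (map_flip_commute ρ p q i a).eq]
      have hsq : ρ (flip i a) *ᵥ (ρ (flip i a) *ᵥ w) = w := by
        rw [mulVec_mulVec, map_flip_mul_self, one_mulVec]
      by_cases h0 : w + ρ (flip i a) *ᵥ w = 0
      · refine ⟨w, hw, h1, h2, fun b hb => ?_⟩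
        rcases Finset.mem_insert.1 hb with rfl | hb
        · exact Or.inr (eq_neg_of_add_eq_zero_right h0)
        · exact h3 b hb
      · refine ⟨_, h0, ?_, ?_, fun b hb => ?_⟩
        · rw [mulVec_add, hcomm, h1, mulVec_neg, neg_add]
        · rw [mulVec_add, hcomm, h2, mulVec_neg, neg_add]
        · rcases Finset.mem_insert.1 hb with rfl | hb
          · exact Or.inl (by rw [mulVec_add, hsq, add_comm])
          · rcases h3 b hb with h | h
            · exact Or.inl (by rw [mulVec_add, hcomm, h])
            · exact Or.inr (by rw [mulVec_add, hcomm, h, mulVec_neg, neg_add])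
  obtain ⟨w, hw, h1, h2, h3⟩ := step Finset.univ
  let S : Finset ι := Finset.univ.filter fun a => ρ (flip i a) *ᵥ w = -w
  have hS : ∀ a, ρ (flip i a) *ᵥ w = sgn S a • w := by
    intro a
    by_cases ha : ρ (flip i a) *ᵥ w = -w
    · simp [sgn, S, ha]
    · simpa [sgn, S, ha] using (h3 a (Finset.mem_univ a)).resolve_right ha
  have hweight : ∀ a b, ρ (flip a b) *ᵥ w = (sgn S a * sgn S b) • w := by
    intro a b
    rw [← map_flip_mul_flip ρ a i b, flip_comm a i, ← mulVec_mulVec, hS, mulVec_smul, hS, smul_smul,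
      mul_comm]
  have key : ∀ a b, ρ (flip a b) *ᵥ w = -w → sgn S a * sgn S b = -1 := by
    intro a b h
    rw [hweight, ← neg_one_smul ℝ w] at h
    exact smul_left_injective ℝ hw h
  exact ⟨S, w, ⟨hw, hweight⟩, key _ _ h1, key _ _ h2⟩

theorem card_le_of_isWeightVector (o : ι) (F : Finset (Finset ι))
    (hF : ∀ S ∈ F, ∃ w, IsWeightVector ρ S w)
    (hinj : Set.InjOn (fun (S : Finset ι) a => sgn S o * sgn S a) (F : Set (Finset ι))) :
    F.card ≤ Fintype.card κ := by
  choose w hw using fun S : F => hF S.1 S.2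
  let f : ι → Module.End ℝ (κ → ℝ) := fun a => (ρ (flip o a)).mulVecLin
  have hind := Module.End.independent_iInf_maxGenEigenspace_of_forall_mapsTo f
    (fun a b φ => Module.End.mapsTo_maxGenEigenspace_of_comm
      (by
        have := (map_flip_commute ρ o b o a).eq
        show f b * f a = f a * f b
        simp only [f, Module.End.mul_eq_comp, ← mulVecLin_mul, this]) φ)
  have hinj' : Function.Injective fun (S : F) a => sgn S.1 o * sgn S.1 a :=
    fun S T h => Subtype.ext (hinj S.2 T.2 h)
  have hlin : LinearIndependent ℝ w := by
    refine (hind.comp hinj').linearIndependent _ (fun S => ?_) fun S => (hw S).1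
    simp only [Function.comp, Submodule.mem_iInf]
    intro a
    refine (Module.End.mem_maxGenEigenspace _ _ _).2 ⟨1, ?_⟩
    simp [f, (hw S).2]
  simpa using hlin.fintype_card_le_finrank

theorem choose_le_choose_of_le_half {n m r : ℕ} (h : r ≤ m) (hm : m ≤ n / 2) :
    n.choose r ≤ n.choose m := by
  induction m, h using Nat.le_induction with
  | base => rfl
  | succ m h ih => exact (ih (by omega)).trans (Nat.choose_le_succ_of_lt_half_left (by omega))

theorem choose_two_le_card {S : Finset ι} {w : κ → ℝ} (hι : 8 ≤ Fintype.card ι)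
    (h : IsWeightVector ρ S w) (h2 : 2 ≤ S.card) (hhalf : S.card ≤ Fintype.card ι / 2) :
    (Fintype.card ι).choose 2 ≤ Fintype.card κ := by
  classical
  obtain ⟨o⟩ : Nonempty ι := Fintype.card_pos_iff.1 (by omega)
  have hcases : ∀ T T' : Finset ι, (fun a => sgn T o * sgn T a) = (fun a => sgn T' o * sgn T' a) →
      T = T' ∨ T = T'ᶜ := by
    intro T T' hTT
    have hval : ∀ a, sgn T o * sgn T a = sgn T' o * sgn T' a := congrFun hTT
    by_cases ho : (o ∈ T ↔ o ∈ T')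
    · left
      ext a
      have := hval a
      unfold sgn at this
      by_cases h1 : o ∈ T' <;> by_cases h3 : a ∈ T <;> by_cases h4 : a ∈ T' <;>
        simp_all <;> norm_num at this
    · right
      ext a
      have := hval a
      unfold sgn at this
      by_cases h1 : o ∈ T' <;> by_cases h3 : a ∈ T <;> by_cases h4 : a ∈ T' <;>
        simp_all <;> norm_num at this
  rcases Nat.lt_or_ge (2 * S.card) (Fintype.card ι) with hlt | hge
  · refine (choose_le_choose_of_le_half h2 hhalf).trans ?_
    rw [← Finset.card_univ, ← Finset.card_powersetCard]
    refine card_le_of_isWeightVector (ρ := ρ) o _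
      (fun T hT => h.exists_of_card_eq (Finset.mem_powersetCard.1 hT).2.symm) ?_
    intro T hT T' hT' hTT
    rcases hcases T T' hTT with h | h
    · exact h
    · have h1 := (Finset.mem_powersetCard.1 hT).2
      have h2 := (Finset.mem_powersetCard.1 hT').2
      rw [h, Finset.card_compl] at h1
      omega
  · have hn : Fintype.card ι = 2 * S.card := by omega
    have hcard : (Fintype.card ι).choose 2 ≤ (Fintype.card ι - 1).choose S.card := by
      have h3 : (Fintype.card ι - 1).choose S.card = (Fintype.card ι - 1).choose (S.card - 1) :=
        Nat.choose_symm_of_eq_add (by omega)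
      rw [h3]
      refine le_trans ?_ (choose_le_choose_of_le_half (r := 3) (by omega) (by omega))
      obtain ⟨q, hq⟩ : ∃ q, Fintype.card ι = q + 8 := ⟨_, (Nat.sub_add_cancel hι).symm⟩
      have e1 := Nat.choose_succ_right_eq (q + 8) 1
      have e2 := Nat.choose_succ_right_eq (q + 7) 1
      have e3 := Nat.choose_succ_right_eq (q + 7) 2
      simp only [Nat.choose_one_right, Nat.reduceAdd,
        show q + 8 - 1 = q + 7 from rfl, show q + 7 - 1 = q + 6 from rfl,
        show q + 7 - 2 = q + 5 from rfl] at e1 e2 e3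
      rw [hq, show q + 8 - 1 = q + 7 from rfl]
      nlinarith
    refine hcard.trans ?_
    have : (Fintype.card ι - 1).choose S.card
        = (((Finset.univ : Finset ι).erase o).powersetCard S.card).card := by
      rw [Finset.card_powersetCard, Finset.card_erase_of_mem (Finset.mem_univ o), Finset.card_univ]
    rw [this]
    refine card_le_of_isWeightVector (ρ := ρ) o _
      (fun T hT => h.exists_of_card_eq (Finset.mem_powersetCard.1 hT).2.symm) ?_
    intro T hT T' hT' hTT
    have h1 : o ∉ T := fun ho => by simpa using (Finset.mem_powersetCard.1 hT).1 ho
    have h2 : o ∉ T' := fun ho => by simpa using (Finset.mem_powersetCard.1 hT').1 ho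
    rcases hcases T T' hTT with h | h
    · exact h
    · exact absurd (by simpa [h] using h1) h2

theorem mem_iff_notMem_of_sgn_mul_eq {α : Type*} [DecidableEq α] {S : Finset α} {i j : α}
    (h : sgn S i * sgn S j = -1) :
    (i ∈ S ∧ j ∉ S) ∨ (j ∈ S ∧ i ∉ S) := by
  unfold sgn at h
  by_cases hi : i ∈ S <;> by_cases hj : j ∈ S <;> simp_all <;> norm_num at h

theorem one_sub_mul_one_sub_eq_zero (hι : 8 ≤ Fintype.card ι)
    (hκ : Fintype.card κ < (Fintype.card ι).choose 2) {i j k l : ι} (hik : i ≠ k) (hil : i ≠ l)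
    (hjk : j ≠ k) (hjl : j ≠ l) : (1 - ρ (flip i j)) * (1 - ρ (flip k l)) = 0 := by
  classical
  by_contra hne
  obtain ⟨S, w, hw, h1, h2⟩ := exists_isWeightVector_of_mul_ne_zero hne
  have hcard : ∀ T : Finset ι, sgn T i * sgn T j = -1 → sgn T k * sgn T l = -1 → 2 ≤ T.card := by
    intro T h1 h2
    rw [← Nat.lt_iff_add_one_le, Finset.one_lt_card]
    rcases mem_iff_notMem_of_sgn_mul_eq h1 with h1 | h1 <;>
      rcases mem_iff_notMem_of_sgn_mul_eq h2 with h2 | h2 <;>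
      exact ⟨_, h1.1, _, h2.1, by assumption⟩
  have hc := Finset.card_add_card_compl S
  have hS := hcard S h1 h2
  have hSc := hcard Sᶜ (by simpa [sgn_compl] using h1) (by simpa [sgn_compl] using h2)
  rcases le_or_gt S.card (Fintype.card ι / 2) with h | h
  · exact absurd (choose_two_le_card hι hw hS h) (by omega)
  · exact absurd (choose_two_le_card hι hw.compl hSc (by omega)) (by omega)

end Weights

section Projections

variable {ι κ : Type*} [Fintype ι] [DecidableEq ι] [Fintype κ] [DecidableEq κ]
  {ρ : specialOrthogonalGroup ι ℝ →* Matrix κ κ ℝ}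

theorem exists_notMem_of_card_lt {α : Type*} [Fintype α] {s : Finset α}
    (h : s.card < Fintype.card α) : ∃ k, k ∉ s := by
  by_contra! hs
  rw [Finset.eq_univ_of_forall hs, Finset.card_univ] at h
  exact h.false

/-- The projections onto the weight spaces for the weights `sgn {i}`, in a representation all of
whose other weights are trivial. -/
structure WeightProjections (ρ : specialOrthogonalGroup ι ℝ →* Matrix κ κ ℝ) where
  /-- The projection onto the `i`-th weight space. -/
  proj : ι → Matrix κ κ ℝ
  mul_self : ∀ i, proj i * proj i = proj i
  mul_of_ne : ∀ {i j}, i ≠ j → proj i * proj j = 0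
  map_flip : ∀ {i j}, i ≠ j → ρ (flip i j) = 1 - (2 : ℝ) • (proj i + proj j)
  conj : ∀ {i j} (h : i ≠ j),
    ρ (rot h (Real.pi / 2)) * proj i = proj j * ρ (rot h (Real.pi / 2))
  comm : ∀ {i j} (h : i ≠ j) (θ : ℝ) {m}, m ≠ i → m ≠ j → Commute (ρ (rot h θ)) (proj m)

theorem nonempty_weightProjections (hι : 8 ≤ Fintype.card ι)
    (hκ : Fintype.card κ < (Fintype.card ι).choose 2) : Nonempty (WeightProjections ρ) := by
  have hz : ∀ {i j k l : ι}, i ≠ k → i ≠ l → j ≠ k → j ≠ l →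
      (1 - ρ (flip i j)) * (1 - ρ (flip k l)) = 0 := one_sub_mul_one_sub_eq_zero hι hκ
  have hcomm := one_sub_map_flip_commute ρ
  have hsq : ∀ i j : ι, (1 - ρ (flip i j)) * (1 - ρ (flip i j)) = (2 : ℝ) • (1 - ρ (flip i j)) := by
    intro i j
    rw [sub_mul, one_mul, map_flip_mul_one_sub, sub_neg_eq_add, two_smul]
  have hpick : ∀ s : Finset ι, s.card < 8 → ∃ k, k ∉ s := fun s hs =>
    exists_notMem_of_card_lt (hs.trans_le hι)
  have hpick2 : ∀ i j : ι, ∃ k l, k ≠ i ∧ k ≠ j ∧ l ≠ i ∧ l ≠ j ∧ k ≠ l := by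
    intro i j
    obtain ⟨k, hk⟩ := hpick {i, j} (Finset.card_le_two.trans_lt (by norm_num))
    obtain ⟨l, hl⟩ := hpick {i, j, k} (Finset.card_le_three.trans_lt (by norm_num))
    simp only [Finset.mem_insert, Finset.mem_singleton, not_or] at hk hl
    exact ⟨k, l, hk.1, hk.2, hl.1, hl.2.1, Ne.symm hl.2.2⟩
  have hone : ∀ {i j k l : ι}, i ≠ j → i ≠ k → i ≠ l → j ≠ k → j ≠ l →
      (1 - ρ (flip i j)) * (1 - ρ (flip i k)) = (1 - ρ (flip i j)) * (1 - ρ (flip i l)) := by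
    intro i j k l hij hik hil hjk hjl
    rw [← sub_eq_zero, ← mul_sub]
    have : (1 - ρ (flip i k)) - (1 - ρ (flip i l)) = - ((1 - ρ (flip k l)) * ρ (flip i k)) := by
      rw [sub_mul, one_mul, flip_comm i k, flip_comm k l, flip_comm i l,
        map_flip_mul_flip]
      abel
    rw [this, mul_neg, ← mul_assoc, hz hik hil hjk hjl, zero_mul, neg_zero]
  have hex : ∀ i, ∃ P : Matrix κ κ ℝ, ∀ j k, i ≠ j → i ≠ k → j ≠ k →
      (1 - ρ (flip i j)) * (1 - ρ (flip i k)) = (4 : ℝ) • P := by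
    intro i
    obtain ⟨p, q, hp, -, hq, -, hpq⟩ := hpick2 i i
    refine ⟨(4⁻¹ : ℝ) • ((1 - ρ (flip i p)) * (1 - ρ (flip i q))), fun j k hij hik hjk => ?_⟩
    rw [smul_inv_smul₀ (by norm_num)]
    obtain ⟨r, hr⟩ := hpick {i, j, k, p, q} (Finset.card_le_five.trans_lt (by norm_num))
    simp only [Finset.mem_insert, Finset.mem_singleton, not_or] at hr
    obtain ⟨hri, hrj, hrk, hrp, hrq⟩ := hr
    rw [hone hij hik (Ne.symm hri) hjk (Ne.symm hrj), (hcomm _ _ _ _).eq,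
      hone (Ne.symm hri) hij hp.symm hrj hrp, (hcomm _ _ _ _).eq,
      hone hp.symm (Ne.symm hri) hq.symm (Ne.symm hrp) hpq]
  choose P hP using hex
  have h4 : (4 : ℝ) ≠ 0 := by norm_num
  refine ⟨⟨P, fun i => ?_, fun {i j} hij => ?_, fun {i j} hij => ?_, fun {i j} hij => ?_,
    fun {i j} hij θ m hmi hmj => ?_⟩⟩
  · obtain ⟨p, q, hp, -, hq, -, hpq⟩ := hpick2 i i
    have h := hP i p q hp.symm hq.symm hpq
    refine smul_right_injective _ (mul_ne_zero h4 h4) ?_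
    change (4 * 4 : ℝ) • (P i * P i) = (4 * 4 : ℝ) • P i
    rw [← smul_mul_smul_comm, mul_smul, ← h, mul_assoc, ← mul_assoc (1 - ρ (flip i q)),
      (hcomm i q i p).eq, mul_assoc, hsq, ← mul_assoc, hsq, smul_mul_assoc, mul_smul_comm, smul_smul]
    norm_num
  · obtain ⟨p, q, hpi, hpj, hqi, hqj, hpq⟩ := hpick2 i j
    refine smul_right_injective _ (mul_ne_zero h4 h4) ?_
    change (4 * 4 : ℝ) • (P i * P j) = (4 * 4 : ℝ) • 0
    rw [← smul_mul_smul_comm, ← hP i j p hij hpi.symm hpj.symm, ← hP j q i hqj.symm hij.symm hqi,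
      mul_assoc, ← mul_assoc (1 - ρ (flip i p)), hz hij hqi.symm hpj hpq, zero_mul, mul_zero,
      smul_zero]
  · obtain ⟨p, q, hpi, hpj, -⟩ := hpick2 i j
    have h1 := hP i j p hij hpi.symm hpj.symm
    have h2 := hP j i p hij.symm hpj.symm hpi.symm
    have h3 : (2 : ℝ) • (1 - ρ (flip i j)) = (4 : ℝ) • (P i + P j) := by
      have e1 : ρ (flip j i) * ρ (flip i p) = ρ (flip j p) := map_flip_mul_flip ρ j i p
      have e2 : ρ (flip i j) * ρ (flip j p) = ρ (flip i p) := map_flip_mul_flip ρ i j p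
      rw [smul_add, ← h1, ← h2, flip_comm j i]
      simp only [sub_mul, mul_sub, one_mul, mul_one, e2]
      rw [flip_comm j i] at e1
      rw [e1, two_smul]
      abel
    have h5 : (1 - ρ (flip i j)) = (2 : ℝ) • (P i + P j) := by
      refine smul_right_injective _ (two_ne_zero (α := ℝ)) ?_
      change (2 : ℝ) • (1 - ρ (flip i j)) = (2 : ℝ) • (2 : ℝ) • (P i + P j)
      rw [h3, smul_smul]; norm_num
    rw [← h5, sub_sub_cancel]
  · obtain ⟨p, q, hpi, hpj, hqi, hqj, hpq⟩ := hpick2 i j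
    refine smul_right_injective _ h4 ?_
    change (4 : ℝ) • (ρ (rot hij (Real.pi / 2)) * P i) = (4 : ℝ) • (P j * ρ (rot hij (Real.pi / 2)))
    have key : ∀ r, r ≠ i → r ≠ j → ρ (rot hij (Real.pi / 2)) * (1 - ρ (flip i r))
        = (1 - ρ (flip j r)) * ρ (rot hij (Real.pi / 2)) := by
      intro r hri hrj
      rw [mul_sub, sub_mul, mul_one, one_mul, ← map_mul, ← map_mul, rot_half_pi_mul_flip,
        Equiv.swap_apply_left, Equiv.swap_apply_of_ne_of_ne hri hrj]
    rw [← mul_smul_comm, ← smul_mul_assoc, ← hP i p q hpi.symm hqi.symm hpq,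
      ← hP j p q hpj.symm hqj.symm hpq, ← mul_assoc, key p hpi hpj, mul_assoc, key q hqi hqj,
      mul_assoc]
  · obtain ⟨p, hp⟩ := hpick {i, j, m} (Finset.card_le_three.trans_lt (by norm_num))
    obtain ⟨q, hq⟩ := hpick {i, j, m, p} (Finset.card_le_four.trans_lt (by norm_num))
    simp only [Finset.mem_insert, Finset.mem_singleton, not_or] at hp hq
    have key : ∀ r, r ≠ i → r ≠ j → Commute (ρ (rot hij θ)) (1 - ρ (flip m r)) := fun r hri hrj =>
      (Commute.one_right _).sub_right
        ((rot_commute_flip hij hmi.symm hri.symm hmj.symm hrj.symm θ).map ρ)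
    have : Commute (ρ (rot hij θ)) ((4 : ℝ) • P m) := by
      rw [← hP m p q (Ne.symm hp.2.2) (Ne.symm hq.2.2.1) (Ne.symm hq.2.2.2)]
      exact (key p hp.1 hp.2.1).mul_right (key q hq.1 hq.2.1)
    rw [← inv_smul_smul₀ h4 (P m)]
    exact this.smul_right _

namespace WeightProjections

variable (D : WeightProjections ρ)

/-- The projection onto the trivial weight space. -/
def proj₀ : Matrix κ κ ℝ := 1 - ∑ i, D.proj i

theorem mul_proj_eq {i j : ι} : D.proj i * D.proj j = if i = j then D.proj i else 0 := by
  split_ifs with h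
  · rw [← h, D.mul_self]
  · exact D.mul_of_ne h

theorem proj_mul_proj₀ (i : ι) : D.proj i * D.proj₀ = 0 := by
  simp [proj₀, mul_sub, Finset.mul_sum, D.mul_proj_eq]

theorem commute_rot_add {i j : ι} (h : i ≠ j) (θ : ℝ) :
    Commute (ρ (rot h θ)) (D.proj i + D.proj j) := by
  have h1 : Commute (ρ (rot h θ)) (1 - ρ (flip i j)) :=
    (Commute.one_right _).sub_right ((rot_commute_flip_self h θ).map ρ)
  rw [D.map_flip h, sub_sub_cancel] at h1
  rw [← inv_smul_smul₀ (two_ne_zero (α := ℝ)) (D.proj i + D.proj j)]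
  exact h1.smul_right _

theorem commute_rot_proj₀ {i j : ι} (h : i ≠ j) (θ : ℝ) : Commute (ρ (rot h θ)) D.proj₀ := by
  refine (Commute.one_right _).sub_right ?_
  rw [← Finset.add_sum_erase _ _ (Finset.mem_univ i),
    ← Finset.add_sum_erase _ _ (Finset.mem_erase.2 ⟨h.symm, Finset.mem_univ j⟩), ← add_assoc]
  refine (D.commute_rot_add h θ).add_right (Commute.sum_right _ _ _ fun m hm => ?_)
  simp only [Finset.mem_erase] at hm
  exact D.comm h θ hm.2.1 hm.1

theorem rot_mul_of_commute {i j k : ι} (hij : i ≠ j) (hik : i ≠ k) (hjk : j ≠ k)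
    {X : Matrix κ κ ℝ} (hX : ∀ θ, Commute (ρ (rot hij θ)) X) (hflip : ρ (flip j k) * X = X)
    (θ : ℝ) : ρ (rot hij θ) * X = X := by
  have h1 : ρ (rot hij (θ / 2)) * X = ρ (rot hij (-(θ / 2))) * X := by
    calc ρ (rot hij (θ / 2)) * X = X * ρ (rot hij (θ / 2)) := (hX _).eq
      _ = ρ (flip j k) * X * ρ (rot hij (θ / 2)) := by rw [hflip]
      _ = ρ (flip j k * rot hij (θ / 2)) * X := by rw [mul_assoc, ← (hX _).eq, map_mul, mul_assoc]
      _ = ρ (rot hij (-(θ / 2))) * X := by rw [flip_mul_rot hij hik hjk, map_mul, mul_assoc, hflip]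
  rw [← add_halves θ, ← rot_mul_rot, map_mul, mul_assoc, h1, ← mul_assoc, ← map_mul, rot_mul_rot,
    add_neg_cancel, rot_zero, map_one, one_mul]

theorem rot_mul_proj (hι : 8 ≤ Fintype.card ι) {i j m : ι} (hij : i ≠ j) (hmi : m ≠ i)
    (hmj : m ≠ j) (θ : ℝ) : ρ (rot hij θ) * D.proj m = D.proj m := by
  obtain ⟨k, hk⟩ := exists_notMem_of_card_lt (s := {i, j, m})
    (Finset.card_le_three.trans_lt (by omega))
  simp only [Finset.mem_insert, Finset.mem_singleton, not_or] at hk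
  refine rot_mul_of_commute hij (Ne.symm hk.1) (Ne.symm hk.2.1) (fun θ => D.comm hij θ hmi hmj) ?_ θ
  rw [D.map_flip (Ne.symm hk.2.1), sub_mul, smul_mul_assoc, add_mul, D.mul_of_ne hmj.symm,
    D.mul_of_ne hk.2.2]
  simp

theorem rot_mul_proj₀ (hι : 8 ≤ Fintype.card ι) {i j : ι} (hij : i ≠ j) (θ : ℝ) :
    ρ (rot hij θ) * D.proj₀ = D.proj₀ := by
  obtain ⟨k, hk⟩ := exists_notMem_of_card_lt (s := {i, j})
    (Finset.card_le_two.trans_lt (by omega))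
  simp only [Finset.mem_insert, Finset.mem_singleton, not_or] at hk
  refine rot_mul_of_commute hij (Ne.symm hk.1) (Ne.symm hk.2) (D.commute_rot_proj₀ hij) ?_ θ
  rw [D.map_flip (Ne.symm hk.2), sub_mul, smul_mul_assoc, add_mul, D.proj_mul_proj₀,
    D.proj_mul_proj₀]
  simp

/-- The subgroup of elements acting trivially on the image and on the coimage of `X`. -/
def fixer (ρ : specialOrthogonalGroup ι ℝ →* Matrix κ κ ℝ) (X : Matrix κ κ ℝ) :
    Subgroup (specialOrthogonalGroup ι ℝ) where
  carrier := {g | ρ g * X = X ∧ X * ρ g = X}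
  one_mem' := by simp
  mul_mem' {g h} hg hh :=
    ⟨by rw [map_mul, mul_assoc, hh.1, hg.1], by rw [map_mul, ← mul_assoc, hg.2, hh.2]⟩
  inv_mem' {g} hg := by
    constructor
    · conv_lhs => rw [← hg.1]
      rw [← mul_assoc, ← map_mul, inv_mul_cancel, map_one, one_mul]
    · conv_lhs => rw [← hg.2]
      rw [mul_assoc, ← map_mul, mul_inv_cancel, map_one, mul_one]

theorem mem_fixer_proj₀ (hι : 8 ≤ Fintype.card ι) (Q : specialOrthogonalGroup ι ℝ) :
    Q ∈ fixer ρ D.proj₀ := by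
  refine mem_of_forall_rot_mem _ Finset.univ (fun a _ b _ h θ => ?_) Q (by simp)
  have := D.rot_mul_proj₀ hι h θ
  exact ⟨this, by rw [← (D.commute_rot_proj₀ h θ).eq, this]⟩

theorem rot_mem_fixer_proj (hι : 8 ≤ Fintype.card ι) {i j m : ι} (hij : i ≠ j) (hmi : m ≠ i)
    (hmj : m ≠ j) (θ : ℝ) : rot hij θ ∈ fixer ρ (D.proj m) := by
  have := D.rot_mul_proj hι hij hmi hmj θ
  exact ⟨this, by rw [← (D.comm hij θ hmi hmj).eq, this]⟩

theorem mem_fixer_proj (hι : 8 ≤ Fintype.card ι) {m : ι} (Q : specialOrthogonalGroup ι ℝ)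
    (hQ : Q.1 *ᵥ Pi.single m 1 = Pi.single m 1) : Q ∈ fixer ρ (D.proj m) := by
  refine mem_of_forall_rot_mem _ (Finset.univ.erase m) (fun a ha b hb h θ => ?_) Q fun i hi v => ?_
  · exact D.rot_mem_fixer_proj hι h (Finset.ne_of_mem_erase ha).symm
      (Finset.ne_of_mem_erase hb).symm θ
  · obtain rfl : i = m := by simpa using hi
    simpa using mul_mulVec_apply_of_mulVec_single Q hQ v

end WeightProjections

end Projections

section Linear

theorem nonpos_of_midpoint_of_zero {u : ℝ → ℝ} (hu : ContinuousOn u (Set.Icc 0 1)) (h0 : u 0 = 0)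
    (h1 : u 1 = 0)
    (hmid : ∀ x ∈ Set.Icc (0 : ℝ) 1, ∀ y ∈ Set.Icc (0 : ℝ) 1, u x + u y = 2 * u ((x + y) / 2)) :
    ∀ x ∈ Set.Icc (0 : ℝ) 1, u x ≤ 0 := by
  obtain ⟨c, hc, hmax⟩ := isCompact_Icc.exists_isMaxOn (Set.nonempty_Icc.2 zero_le_one) hu
  have hle : ∀ x ∈ Set.Icc (0 : ℝ) 1, u x ≤ u c := fun x hx => hmax hx
  intro x hx
  refine (hle x hx).trans ?_
  rcases le_total c (1 / 2) with h | h
  · have hmem : 2 * c ∈ Set.Icc (0 : ℝ) 1 := ⟨by linarith [hc.1], by linarith⟩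
    have := hmid (2 * c) hmem 0 (by simp)
    rw [show (2 * c + 0) / 2 = c by ring] at this
    linarith [hle _ hmem]
  · have hmem : 2 * c - 1 ∈ Set.Icc (0 : ℝ) 1 := ⟨by linarith, by linarith [hc.2]⟩
    have := hmid (2 * c - 1) hmem 1 (by simp)
    rw [show (2 * c - 1 + 1) / 2 = c by ring] at this
    linarith [hle _ hmem]

theorem eq_mul_of_midpoint {u : ℝ → ℝ} (hu : ContinuousOn u (Set.Icc 0 1)) (h0 : u 0 = 0)
    (hmid : ∀ x ∈ Set.Icc (0 : ℝ) 1, ∀ y ∈ Set.Icc (0 : ℝ) 1, u x + u y = 2 * u ((x + y) / 2))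
    {x : ℝ} (hx : x ∈ Set.Icc (0 : ℝ) 1) : u x = x * u 1 := by
  have hlin : Continuous fun x : ℝ => x * u 1 := by fun_prop
  apply le_antisymm
  · have := nonpos_of_midpoint_of_zero (u := fun x => u x - x * u 1) (hu.sub hlin.continuousOn)
      (by simp [h0]) (by simp) (fun x hx y hy => by linear_combination hmid x hx y hy) x hx
    linarith
  · have := nonpos_of_midpoint_of_zero (u := fun x => x * u 1 - u x) (hlin.continuousOn.sub hu)
      (by simp [h0]) (by simp) (fun x hx y hy => by linear_combination -hmid x hx y hy) x hx
    linarith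

variable {ι κ : Type*} [Fintype ι] [DecidableEq ι] [Fintype κ] [DecidableEq κ]
  {ρ : specialOrthogonalGroup ι ℝ →* Matrix κ κ ℝ}

theorem continuous_rot {i j : ι} (hij : i ≠ j) : Continuous fun θ => rot hij θ := by
  refine Continuous.subtype_mk ?_ _
  refine continuous_pi fun a => continuous_pi fun b => ?_
  simp only [rotMatrix]
  split_ifs <;> fun_prop

namespace WeightProjections

variable (D : WeightProjections ρ)

/-- The compression of `ρ Q` to the `i`-th weight space. -/
def compress (i : ι) (Q : specialOrthogonalGroup ι ℝ) : Matrix κ κ ℝ :=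
  D.proj i * ρ Q * D.proj i

theorem compress_eq_compress_rot (hι : 8 ≤ Fintype.card ι) {i j : ι} (hij : i ≠ j)
    (Q : specialOrthogonalGroup ι ℝ) :
    D.compress i Q = D.compress i (rot hij (Real.arccos (Q.1 i i))) := by
  obtain ⟨h, hh, h0, hfix, hpos⟩ := exists_mulVec_eq_zero (fixer ρ (D.proj i)) j
    ((Finset.univ.erase i).erase j) (by simp)
    (fun a ha hja θ => D.rot_mem_fixer_proj hι hja hij
      (by simp only [Finset.mem_erase] at ha; exact ha.2.1.symm) θ) (Q.1 *ᵥ Pi.single i 1)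
  have hne : ((Finset.univ.erase i).erase j).Nonempty := by
    obtain ⟨k, hk⟩ := exists_notMem_of_card_lt (s := {i, j})
      (Finset.card_le_two.trans_lt (by omega))
    simp only [Finset.mem_insert, Finset.mem_singleton, not_or] at hk
    exact ⟨k, by simp [hk.1, hk.2]⟩
  have hyj := hpos hne
  have hyi : ((h * Q).1 *ᵥ Pi.single i 1) i = Q.1 i i := by
    rw [coe_mul_mulVec, hfix i (by simp) hij]
    simp
  rw [← coe_mul_mulVec] at h0 hyj
  set y := (h * Q).1 *ᵥ Pi.single i 1 with hy
  have hy0 : ∀ a, a ≠ i → a ≠ j → y a = 0 := fun a hai haj => h0 a (by simp [hai, haj])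
  have hnorm : y i ^ 2 + y j ^ 2 = 1 := by
    have h1 := dotProduct_mulVec_mulVec (h * Q) (Pi.single i 1) (Pi.single i 1)
    rw [← hy, dotProduct_single, Pi.single_eq_same, mul_one, dotProduct,
      ← Finset.add_sum_erase _ _ (Finset.mem_univ i),
      ← Finset.add_sum_erase _ _ (Finset.mem_erase.2 ⟨hij.symm, Finset.mem_univ j⟩),
      Finset.sum_eq_zero (fun a ha => by
        simp only [Finset.mem_erase] at ha
        rw [hy0 a ha.2.1 ha.1, zero_mul])] at h1
    linarith
  rw [hyi] at hnorm
  set θ := Real.arccos (Q.1 i i) with hθ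
  have hcos : Real.cos θ = Q.1 i i := Real.cos_arccos (by nlinarith) (by nlinarith)
  have hsin : Real.sin θ = y j := by
    rw [hθ, Real.sin_arccos, ← hnorm, add_sub_cancel_left, Real.sqrt_sq hyj]
  have hcol : (rot hij θ)⁻¹ * (h * Q) ∈ fixer ρ (D.proj i) := by
    refine D.mem_fixer_proj hι _ ?_
    funext a
    rw [coe_mul_mulVec, ← hy, rot_inv, rot_mulVec, Real.cos_neg, Real.sin_neg, hcos, hsin, hyi]
    by_cases hai : a = i
    · subst hai
      simp only [if_true, Pi.single_eq_same]
      linarith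
    · by_cases haj : a = j
      · subst haj
        simp only [hai, if_true, if_false, Pi.single_eq_of_ne hai]
        ring
      · simp [hai, haj, hy0 a hai haj]
  have h2 : ρ h * ρ Q * D.proj i = ρ (rot hij θ) * D.proj i := by
    rw [← map_mul, ← mul_inv_cancel_left (rot hij θ) (h * Q), map_mul, mul_assoc, hcol.1]
  calc D.compress i Q = D.proj i * ρ h * ρ Q * D.proj i := by rw [compress, hh.2]
    _ = D.compress i (rot hij θ) := by rw [mul_assoc, mul_assoc, ← mul_assoc (ρ h), h2, compress,
        mul_assoc]

theorem compress_congr (hι : 8 ≤ Fintype.card ι) (i : ι) {Q R : specialOrthogonalGroup ι ℝ}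
    (h : Q.1 i i = R.1 i i) : D.compress i Q = D.compress i R := by
  obtain ⟨j, hj⟩ := exists_notMem_of_card_lt (s := {i}) (by simp; omega)
  have hij : i ≠ j := fun h => hj (by simp [h])
  rw [D.compress_eq_compress_rot hι hij, h, ← D.compress_eq_compress_rot hι hij]

theorem rot_mul_proj_left {i j : ι} (hij : i ≠ j) (θ : ℝ) :
    ρ (rot hij θ) * D.proj i = (D.proj i + D.proj j) * ρ (rot hij θ) * D.proj i := by
  rw [← (D.commute_rot_add hij θ).eq, mul_assoc, add_mul, D.mul_self, D.mul_of_ne hij.symm, add_zero]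

theorem rot_apply_left {i j : ι} (hij : i ≠ j) (θ : ℝ) : (rot hij θ).1 i i = Real.cos θ := by
  simp [rot, rotMatrix]

/-- Compressions multiply like the corresponding diagonal entries. -/
theorem compress_rot_mul_compress_rot (hι : 8 ≤ Fintype.card ι) {i j k : ι} (hij : i ≠ j)
    (hik : i ≠ k) (hjk : j ≠ k) (θ φ : ℝ) :
    D.compress i (rot hij θ) * D.compress i (rot hij φ)
      = D.compress i (rot hij θ * rot hik φ) := by
  rw [D.compress_congr hι i (Q := rot hij φ) (R := rot hik φ) (by simp only [rot_apply_left])]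
  have hzero : D.proj i * ρ (rot hij θ) * D.proj k = 0 := by
    rw [mul_assoc, (D.comm hij θ hik.symm hjk.symm).eq, ← mul_assoc, D.mul_of_ne hik, zero_mul]
  symm
  calc D.compress i (rot hij θ * rot hik φ)
      = D.proj i * ρ (rot hij θ) * ((D.proj i + D.proj k) * ρ (rot hik φ) * D.proj i) := by
        rw [← D.rot_mul_proj_left hik, compress, map_mul]
        simp only [mul_assoc]
    _ = D.proj i * ρ (rot hij θ) * D.proj i * ρ (rot hik φ) * D.proj i := by
        simp only [add_mul, mul_add, ← mul_assoc, hzero, zero_mul, add_zero]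
    _ = D.compress i (rot hij θ) * D.compress i (rot hik φ) := by
        simp only [compress, ← mul_assoc]
        rw [mul_assoc _ (D.proj i) (D.proj i), D.mul_self]

theorem compress_rot_add {i j : ι} (hij : i ≠ j) (θ φ : ℝ) :
    D.compress i (rot hij (θ + φ))
      = D.compress i (rot hij θ) * D.compress i (rot hij φ)
        + D.compress i (rot hij (θ + Real.pi / 2)) * D.compress i (rot hij (φ - Real.pi / 2)) := by
  have hj : D.proj j = ρ (rot hij (Real.pi / 2)) * D.proj i * ρ (rot hij (-(Real.pi / 2))) := by
    rw [D.conj hij, mul_assoc, ← map_mul, rot_mul_rot, add_neg_cancel, rot_zero, map_one, mul_one]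
  have hθ : ρ (rot hij (θ + Real.pi / 2)) = ρ (rot hij θ) * ρ (rot hij (Real.pi / 2)) := by
    rw [← map_mul, rot_mul_rot]
  have hφ : ρ (rot hij (φ - Real.pi / 2)) = ρ (rot hij (-(Real.pi / 2))) * ρ (rot hij φ) := by
    rw [← map_mul, rot_mul_rot, neg_add_eq_sub]
  simp only [compress]
  rw [← rot_mul_rot, map_mul, ← mul_assoc, mul_assoc _ (ρ (rot hij φ)), D.rot_mul_proj_left hij,
    add_mul, add_mul, mul_add, hj, hθ, hφ]
  simp only [mul_assoc]
  simp only [← mul_assoc (D.proj i) (D.proj i), D.mul_self]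

theorem compress_eq_smul (hι : 8 ≤ Fintype.card ι) (hρ : Continuous ρ) (i : ι)
    (Q : specialOrthogonalGroup ι ℝ) : D.compress i Q = Q.1 i i • D.proj i := by
  obtain ⟨j, hj⟩ := exists_notMem_of_card_lt (s := {i}) (by simp; omega)
  have hij : i ≠ j := fun h => hj (by simp [h])
  obtain ⟨k, hk⟩ := exists_notMem_of_card_lt (s := {i, j})
    (Finset.card_le_two.trans_lt (by omega))
  simp only [Finset.mem_insert, Finset.mem_singleton, not_or] at hk
  have hik : i ≠ k := Ne.symm hk.1
  have hjk : j ≠ k := Ne.symm hk.2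
  set T : ℝ → Matrix κ κ ℝ := fun c => D.compress i (rot hij (Real.arccos c)) with hT
  have hTQ : ∀ Q, D.compress i Q = T (Q.1 i i) := fun Q => D.compress_eq_compress_rot hι hij Q
  have hTrot : ∀ θ, D.compress i (rot hij θ) = T (Real.cos θ) := fun θ => by
    rw [hTQ, rot_apply_left]
  have hmul : ∀ θ φ, T (Real.cos θ) * T (Real.cos φ) = T (Real.cos θ * Real.cos φ) := by
    intro θ φ
    rw [← hTrot, ← hTrot, D.compress_rot_mul_compress_rot hι hij hik hjk, hTQ]
    congr 1
    have : (rot hij θ * rot hik φ).1 i i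
        = ((rot hij θ * rot hik φ).1 *ᵥ Pi.single i 1) i := by simp
    rw [this, coe_mul_mulVec, rot_mulVec hij, rot_mulVec hik, rot_mulVec hik]
    simp [hij.symm, hjk, Pi.single_eq_of_ne hk.1]
  have hadd : ∀ θ φ, T (Real.cos (θ + φ))
      = T (Real.cos θ * Real.cos φ) + T (-(Real.sin θ * Real.sin φ)) := by
    intro θ φ
    rw [← hTrot, D.compress_rot_add hij, hTrot, hTrot, hTrot, hTrot, hmul, hmul,
      Real.cos_add_pi_div_two, Real.cos_sub_pi_div_two, neg_mul]
  have hT1 : T 1 = D.proj i := by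
    have := hTQ 1
    rw [OneMemClass.coe_one, one_apply_eq] at this
    rw [← this, compress, map_one, mul_one, D.mul_self]
  have hTneg1 : T (-1) = -D.proj i := by
    have := hTQ (flip i j)
    have hval : (flip i j).1 i i = -1 := by simp [flip, flipMatrix, hij]
    rw [hval] at this
    rw [← this, compress, D.map_flip hij]
    simp only [mul_sub, sub_mul, mul_one, mul_add, add_mul, D.mul_self, D.mul_of_ne hij,
      add_zero, two_smul]
    abel
  have hTproj : ∀ c, T c * D.proj i = T c := fun c => by
    simp only [hT, compress, mul_assoc, D.mul_self]
  have hneg : ∀ c ∈ Set.Icc (-1 : ℝ) 1, T (-c) = -T c := by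
    intro c hc
    have := hmul (Real.arccos c) Real.pi
    rw [Real.cos_arccos hc.1 hc.2, Real.cos_pi, hTneg1, mul_neg, hTproj, mul_neg_one] at this
    exact this.symm
  have hmid : ∀ x ∈ Set.Icc (-1 : ℝ) 1, ∀ y ∈ Set.Icc (-1 : ℝ) 1,
      T x + T y = (2 : ℝ) • T ((x + y) / 2) := by
    intro x hx y hy
    set θ := (Real.arccos x + Real.arccos y) / 2 with hθ
    set φ := (Real.arccos x - Real.arccos y) / 2 with hφ
    have hx' : Real.cos (θ + φ) = x := by
      rw [hθ, hφ, ← add_div, add_add_sub_cancel, add_self_div_two, Real.cos_arccos hx.1 hx.2]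
    have hy' : Real.cos (θ - φ) = y := by
      rw [show θ - φ = Real.arccos y by rw [hθ, hφ]; ring, Real.cos_arccos hy.1 hy.2]
    have h1 := hadd θ φ
    have h2 := hadd θ (-φ)
    have hs : Real.sin θ * Real.sin φ ∈ Set.Icc (-1 : ℝ) 1 := by
      refine abs_le.1 ?_
      rw [abs_mul]
      exact mul_le_one₀ (Real.abs_sin_le_one θ) (abs_nonneg _) (Real.abs_sin_le_one φ)
    rw [← sub_eq_add_neg, Real.cos_neg, Real.sin_neg, mul_neg, neg_neg, hy'] at h2
    rw [hx', hneg _ hs] at h1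
    have hc : Real.cos θ * Real.cos φ = (x + y) / 2 := by
      rw [← hx', ← hy', Real.cos_add, Real.cos_sub]; ring
    rw [h1, h2, hc, two_smul]
    abel
  have hT0 : T 0 = 0 := by
    have := hneg 0 (by norm_num)
    rw [neg_zero] at this
    ext a b
    have hab := congrFun (congrFun this a) b
    rw [neg_apply] at hab
    rw [Matrix.zero_apply]
    linarith
  have hcont : Continuous T := by
    have : Continuous fun c => ρ (rot hij (Real.arccos c)) :=
      hρ.comp ((continuous_rot hij).comp Real.continuous_arccos)
    exact (continuous_const.mul this).mul continuous_const
  have hpos : ∀ c ∈ Set.Icc (0 : ℝ) 1, T c = c • D.proj i := by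
    intro c hc
    have hsub : Set.Icc (0 : ℝ) 1 ⊆ Set.Icc (-1) 1 := Set.Icc_subset_Icc_left (by norm_num)
    ext a b
    have := eq_mul_of_midpoint (u := fun c => T c a b)
      ((continuous_apply_apply a b).comp hcont).continuousOn (by simp [hT0])
      (fun x hx y hy => by
        have := congrFun (congrFun (hmid x (hsub hx) y (hsub hy)) a) b
        simpa using this) hc
    simpa [hT1] using this
  have hQ : Q.1 i i ∈ Set.Icc (-1 : ℝ) 1 := by
    have h1 := congrFun (congrFun (transpose_mul_self Q) i) i
    rw [mul_apply, one_apply_eq, ← Finset.add_sum_erase _ _ (Finset.mem_univ i)] at h1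
    have h2 : 0 ≤ ∑ x ∈ Finset.univ.erase i, Q.1ᵀ i x * Q.1 x i :=
      Finset.sum_nonneg fun x _ => mul_self_nonneg (Q.1 x i)
    rw [transpose_apply] at h1
    exact abs_le.1 (abs_le_one_iff_mul_self_le_one.2 (by linarith))
  rw [hTQ]
  rcases le_total 0 (Q.1 i i) with h | h
  · exact hpos _ ⟨h, hQ.2⟩
  · have h1 := hpos (-Q.1 i i) ⟨by linarith, by linarith [hQ.1]⟩
    rw [hneg _ hQ, neg_smul] at h1
    exact neg_injective h1

end WeightProjections

end Linear

section Coordinates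

variable {ι κ : Type*} [Fintype ι] [DecidableEq ι] [Fintype κ] [DecidableEq κ]
  {ρ : specialOrthogonalGroup ι ℝ →* Matrix κ κ ℝ}

/-- A quarter turn carrying the basis vector `o` to the basis vector `i`. -/
noncomputable def turn (o i : ι) : specialOrthogonalGroup ι ℝ :=
  if h : o = i then 1 else rot h (Real.pi / 2)

theorem turn_mulVec_single (o i : ι) : (turn o i).1 *ᵥ Pi.single o 1 = Pi.single i 1 := by
  by_cases h : o = i
  · subst h
    rw [turn, dif_pos rfl, OneMemClass.coe_one, one_mulVec]
  · funext a
    rw [turn, dif_neg h, rot_mulVec, Pi.single_eq_same, Pi.single_eq_of_ne (Ne.symm h),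
      Real.cos_pi_div_two, Real.sin_pi_div_two, Pi.single_apply, Pi.single_apply]
    split_ifs <;> simp_all

theorem turn_inv_mul_mul_turn_apply (o i j : ι) (Q : specialOrthogonalGroup ι ℝ) :
    ((turn o i)⁻¹ * Q * turn o j).1 o o = Q.1 i j := by
  have h := dotProduct_mulVec_mulVec (turn o i) (Pi.single o 1)
    (((turn o i)⁻¹ * Q * turn o j).1 *ᵥ Pi.single o 1)
  rw [← coe_mul_mulVec, mul_assoc, mul_inv_cancel_left, coe_mul_mulVec, turn_mulVec_single,
    turn_mulVec_single] at h
  simpa [mul_assoc] using h.symm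

namespace WeightProjections

variable (D : WeightProjections ρ)

theorem map_turn_mul_proj (o i : ι) :
    ρ (turn o i) * D.proj o = D.proj i * ρ (turn o i) := by
  by_cases h : o = i
  · subst h
    simp [turn]
  · rw [turn, dif_neg h, D.conj h]

theorem map_turn_mul_proj_mul_map_turn_inv (o i : ι) :
    ρ (turn o i) * (D.proj o * ρ (turn o i)⁻¹) = D.proj i := by
  rw [← mul_assoc, D.map_turn_mul_proj, mul_assoc, ← map_mul, mul_inv_cancel, map_one, mul_one]

theorem proj_mul_map_turn_inv_mul_map (hι : 8 ≤ Fintype.card ι) (hρ : Continuous ρ) (o i : ι)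
    (Q : specialOrthogonalGroup ι ℝ) :
    D.proj o * ρ (turn o i)⁻¹ * ρ Q = ∑ j, Q.1 i j • (D.proj o * ρ (turn o j)⁻¹) := by
  have hone : (1 : Matrix κ κ ℝ) = D.proj₀ + ∑ j, D.proj j := by rw [proj₀, sub_add_cancel]
  have h0 : D.proj o * ρ ((turn o i)⁻¹ * Q) * D.proj₀ = 0 := by
    rw [mul_assoc, (D.mem_fixer_proj₀ hι _).1, D.proj_mul_proj₀]
  rw [mul_assoc, ← map_mul, ← mul_one (D.proj o * _), hone, mul_add, h0, zero_add, Finset.mul_sum]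
  refine Finset.sum_congr rfl fun j _ => ?_
  have hc := D.compress_eq_smul hι hρ o ((turn o i)⁻¹ * Q * turn o j)
  rw [turn_inv_mul_mul_turn_apply] at hc
  rw [← D.map_turn_mul_proj_mul_map_turn_inv o j, ← smul_mul_assoc, ← hc, compress,
    map_mul _ _ (turn o j)]
  simp only [mul_assoc]

theorem proj_mul_map_turn_inv_mul_map_turn (o i j : ι) :
    D.proj o * ρ (turn o i)⁻¹ * (ρ (turn o j) * D.proj o) = if i = j then D.proj o else 0 := by
  have h : D.proj o * ρ (turn o i)⁻¹ = ρ (turn o i)⁻¹ * D.proj i := by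
    rw [← D.map_turn_mul_proj_mul_map_turn_inv o i, ← mul_assoc, ← map_mul, inv_mul_cancel, map_one,
      one_mul]
  rw [D.map_turn_mul_proj, h, mul_assoc, ← mul_assoc (D.proj i), D.mul_proj_eq]
  split_ifs with hij
  · subst hij
    rw [← mul_assoc, ← h, mul_assoc, ← map_mul, inv_mul_cancel, map_one, mul_one]
  · rw [zero_mul, mul_zero]

theorem mulVec_eq_of_forall (hι : 8 ≤ Fintype.card ι) (o : ι) (Q : specialOrthogonalGroup ι ℝ)
    (w : κ → ℝ) (h : ∀ i, (D.proj o * ρ (turn o i)⁻¹) *ᵥ (ρ Q *ᵥ w)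
      = (D.proj o * ρ (turn o i)⁻¹) *ᵥ w) : ρ Q *ᵥ w = w := by
  have hone : (1 : Matrix κ κ ℝ)
      = D.proj₀ + ∑ i, ρ (turn o i) * (D.proj o * ρ (turn o i)⁻¹) := by
    simp only [D.map_turn_mul_proj_mul_map_turn_inv, proj₀, sub_add_cancel]
  have key : ∀ v, v = D.proj₀ *ᵥ v
      + ∑ i, ρ (turn o i) *ᵥ ((D.proj o * ρ (turn o i)⁻¹) *ᵥ v) := fun v => by
    nth_rw 1 [← one_mulVec v, hone, add_mulVec, sum_mulVec]
    simp only [mulVec_mulVec]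
  rw [key (ρ Q *ᵥ w)]
  simp only [h]
  rw [mulVec_mulVec, (D.mem_fixer_proj₀ hι Q).2, ← key]

/-- The complement of the invariants is a direct sum of copies of the standard representation. -/
theorem exists_equivariant_surjective (D : WeightProjections ρ) (o : ι)
    (hι : 8 ≤ Fintype.card ι) (hρ : Continuous ρ) :
    ∃ (b : ℕ) (f : (κ → ℝ) →ₗ[ℝ] Matrix ι (Fin b) ℝ), Function.Surjective f ∧
      (∀ Q v, f (ρ Q *ᵥ v) = Q.1 * f v) ∧ ∀ Q v, f (ρ Q *ᵥ v) = f v → ρ Q *ᵥ v = v := by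
  set p := (D.proj o).mulVecLin with hp
  set e := (Module.finBasis ℝ (LinearMap.range p)).equivFun with he
  set f : (κ → ℝ) →ₗ[ℝ] Matrix ι (Fin (Module.finrank ℝ (LinearMap.range p))) ℝ :=
    LinearMap.pi fun i => e.toLinearMap ∘ₗ p.rangeRestrict ∘ₗ (ρ (turn o i)⁻¹).mulVecLin with hf
  have hfv : ∀ v i, f v i = e (p.rangeRestrict (ρ (turn o i)⁻¹ *ᵥ v)) := fun v i => rfl
  have hcoe : ∀ v i, (p.rangeRestrict (ρ (turn o i)⁻¹ *ᵥ v) : κ → ℝ)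
      = (D.proj o * ρ (turn o i)⁻¹) *ᵥ v := fun v i => by
    rw [← mulVec_mulVec]; rfl
  refine ⟨_, f, fun M => ?_, fun Q v => ?_, fun Q v hv => ?_⟩
  · refine ⟨∑ j, (ρ (turn o j) * D.proj o) *ᵥ (e.symm (M j) : κ → ℝ), ?_⟩
    funext i
    rw [hfv, ← e.eq_symm_apply]
    refine Subtype.ext ?_
    rw [hcoe, mulVec_sum]
    simp only [mulVec_mulVec, D.proj_mul_map_turn_inv_mul_map_turn]
    obtain ⟨u, hu⟩ := (e.symm (M i)).2
    rw [Finset.sum_eq_single i (fun j _ hj => by rw [if_neg hj.symm, zero_mulVec]) (by simp),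
      if_pos rfl, ← hu, hp, mulVecLin_apply, mulVec_mulVec, D.mul_self]
  · funext i
    have hsum : p.rangeRestrict (ρ (turn o i)⁻¹ *ᵥ (ρ Q *ᵥ v))
        = ∑ j, Q.1 i j • p.rangeRestrict (ρ (turn o j)⁻¹ *ᵥ v) := by
      refine Subtype.ext ?_
      rw [hcoe, mulVec_mulVec, D.proj_mul_map_turn_inv_mul_map hι hρ, sum_mulVec,
        AddSubmonoidClass.coe_finsetSum]
      simp only [SetLike.val_smul, hcoe, smul_mulVec]
    rw [hfv, hsum, map_sum]
    funext c
    simp only [map_smul, ← hfv, Finset.sum_apply, Pi.smul_apply, smul_eq_mul, mul_apply]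
  · refine D.mulVec_eq_of_forall hι o Q v fun i => ?_
    rw [← hcoe, ← hcoe]
    exact congrArg Subtype.val (e.injective (congrFun hv i))

end WeightProjections

end Coordinates

section Stabilizer

variable {ι : Type*} [Fintype ι] [DecidableEq ι]

/-- The reflection in the hyperplane orthogonal to `x`. -/
noncomputable def reflection (x : ι → ℝ) : Matrix ι ι ℝ :=
  1 - vecMulVec ((2 / (x ⬝ᵥ x)) • x) x

theorem reflection_mulVec (x v : ι → ℝ) :
    reflection x *ᵥ v = v - (2 * (x ⬝ᵥ v) / (x ⬝ᵥ x)) • x := by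
  rw [reflection, sub_mulVec, one_mulVec, vecMulVec_mulVec]
  congr 1
  funext a
  simp only [Pi.smul_apply, smul_eq_mul, MulOpposite.smul_eq_mul_unop, MulOpposite.unop_op]
  ring

theorem reflection_transpose (x : ι → ℝ) : (reflection x)ᵀ = reflection x := by
  rw [reflection, transpose_sub, transpose_one, transpose_vecMulVec, vecMulVec_smul, smul_vecMulVec]

theorem reflection_mul_self {x : ι → ℝ} (hx : x ≠ 0) : reflection x * reflection x = 1 := by
  have hxx : x ⬝ᵥ x ≠ 0 := fun h => hx (dotProduct_self_eq_zero.1 h)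
  refine eq_of_mulVec_eq fun v a => ?_
  rw [← mulVec_mulVec, one_mulVec]
  simp only [reflection_mulVec, dotProduct_sub, dotProduct_smul, Pi.sub_apply, Pi.smul_apply,
    smul_eq_mul]
  field_simp
  ring

theorem reflection_det {x : ι → ℝ} (hx : x ≠ 0) : (reflection x).det = -1 := by
  have hxx : x ⬝ᵥ x ≠ 0 := fun h => hx (dotProduct_self_eq_zero.1 h)
  rw [reflection, sub_eq_add_neg, ← neg_vecMulVec, vecMulVec_eq Unit,
    det_one_add_replicateCol_mul_replicateRow, dotProduct_neg, dotProduct_smul, smul_eq_mul,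
    div_mul_cancel₀ _ hxx]
  norm_num

theorem reflection_mul_of_vecMul {τ : Type*} {x : ι → ℝ} {A : Matrix ι τ ℝ}
    (h : x ᵥ* A = 0) : reflection x * A = A := by
  rw [reflection, Matrix.sub_mul, Matrix.one_mul, vecMulVec_mul, h]
  ext a c
  simp [vecMulVec_apply]

theorem exists_mul_eq_and_mul_ne {b k : ℕ} (hbk : b < k) (hb : b + 1 < Fintype.card ι)
    (A : Matrix ι (Fin b) ℝ) (Y : Matrix ι (Fin k) ℝ) (hY : Yᵀ * Y = 1) :
    ∃ Q : specialOrthogonalGroup ι ℝ, Q.1 * A = A ∧ Q.1 * Y ≠ Y := by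
  obtain ⟨z, hz, hz0⟩ := (Submodule.ne_bot_iff _).1
    (LinearMap.ker_ne_bot_of_finrank_lt (f := (Aᵀ * Y).mulVecLin) (by simpa using hbk))
  set x := Y *ᵥ z with hx
  have hYx : Yᵀ *ᵥ x = z := by rw [hx, mulVec_mulVec, hY, one_mulVec]
  have hx0 : x ≠ 0 := fun h => hz0 (by rw [← hYx, h, mulVec_zero])
  have hxA : x ᵥ* A = 0 := by
    rw [← mulVec_transpose, hx, mulVec_mulVec]
    exact hz
  obtain ⟨y, hy, hy0⟩ := (Submodule.ne_bot_iff _).1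
    (LinearMap.ker_ne_bot_of_finrank_lt
      (f := Aᵀ.mulVecLin.prod (dotProductBilin ℝ ℝ x)) (by simpa using hb))
  rw [LinearMap.ker_prod] at hy
  have hyA : y ᵥ* A = 0 := by
    rw [← mulVec_transpose]
    exact hy.1
  have hyx : y ⬝ᵥ x = 0 := by
    rw [dotProduct_comm]
    exact hy.2
  set Q := reflection x * reflection y with hQ
  have hQT : Qᵀ = reflection y * reflection x := by
    rw [hQ, transpose_mul, reflection_transpose, reflection_transpose]
  have hQQ : Qᵀ * Q = 1 := by
    rw [hQT, hQ, mul_assoc, ← mul_assoc (reflection x), reflection_mul_self hx0, one_mul,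
      reflection_mul_self hy0]
  have hdet : Q.det = 1 := by
    rw [hQ, det_mul, reflection_det hx0, reflection_det hy0]
    norm_num
  refine ⟨⟨Q, mem_specialOrthogonalGroup_of_transpose_mul hQQ hdet⟩, ?_, fun h => hz0 ?_⟩
  · change Q * A = A
    rw [hQ, Matrix.mul_assoc, reflection_mul_of_vecMul hyA, reflection_mul_of_vecMul hxA]
  · change Q * Y = Y at h
    have hQx : Qᵀ *ᵥ x = -x := by
      have hxx : x ⬝ᵥ x ≠ 0 := fun h => hx0 (dotProduct_self_eq_zero.1 h)
      rw [hQT, ← mulVec_mulVec, reflection_mulVec x, mul_div_assoc, div_self hxx, mul_one, two_smul,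
        sub_add_cancel_left, reflection_mulVec, dotProduct_neg, hyx]
      simp
    have hzz : z = -z := by
      conv_lhs => rw [← hYx, ← h, transpose_mul, ← mulVec_mulVec, hQx, mulVec_neg, hYx]
    exact self_eq_neg.1 hzz

end Stabilizer

end StiefelEmbedding

/-- Let `n ≥ 17` and `1 ≤ k < (n−1)/2` (i.e. `2k < n − 1`).  Let
`V(k,n) = {Y ∈ ℝ^{n×k} : Yᵀ Y = I_k}` be the Stiefel manifold, with `SO_n(ℝ)` acting by left
multiplication.  If `(W, ρ)` is a finite-dimensional continuous real representation of
`SO_n(ℝ)` (realized on `W = ℝᵈ`) and `ε : V(k,n) → W` is an injective continuous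
`SO_n(ℝ)`-equivariant map, then `dim W ≥ nk`; and if `dim W = nk`, then `W` is isomorphic
as an `SO_n(ℝ)`-representation to `ℝ^{n×k}` with the action `Q · Y = Q Y`, i.e. the direct
sum of `k` copies of the standard representation `ℝⁿ`. -/
theorem minimal_equivariant_embedding_of_stiefel
    (n k : ℕ) (hn : 17 ≤ n) (hk : 1 ≤ k) (hk2 : 2 * k < n - 1)
    (V : Set (Matrix (Fin n) (Fin k) ℝ)) (hV : V = {Y | Yᵀ * Y = 1})
    (d : ℕ) (ρ : Matrix (Fin n) (Fin n) ℝ → Matrix (Fin d) (Fin d) ℝ)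
    (hρ1 : ρ 1 = 1)
    (hρmul : ∀ Q ∈ SOn n, ∀ R ∈ SOn n, ρ (Q * R) = ρ Q * ρ R)
    (hρunit : ∀ Q ∈ SOn n, IsUnit (ρ Q))
    (hρcont : ContinuousOn ρ (SOn n))
    (ε : Matrix (Fin n) (Fin k) ℝ → Fin d → ℝ)
    (hεinj : Set.InjOn ε V) (hεcont : ContinuousOn ε V)
    (hεeqv : ∀ Q ∈ SOn n, ∀ Y ∈ V, ε (Q * Y) = (ρ Q).mulVec (ε Y)) :
    n * k ≤ d ∧
    (d = n * k →
      ∃ e : (Fin d → ℝ) ≃ₗ[ℝ] Matrix (Fin n) (Fin k) ℝ,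
        ∀ Q ∈ SOn n, ∀ v : Fin d → ℝ, e ((ρ Q).mulVec v) = Q * e v) := by
  rcases lt_or_ge (n * k) d with hd | hd
  · exact ⟨hd.le, fun h => absurd h hd.ne'⟩
  have hmem : ∀ Q : specialOrthogonalGroup (Fin n) ℝ, Q.1 ∈ SOn n := fun Q =>
    ⟨StiefelEmbedding.transpose_mul_self Q, StiefelEmbedding.det_coe Q⟩
  set r : specialOrthogonalGroup (Fin n) ℝ →* Matrix (Fin d) (Fin d) ℝ :=
    { toFun := fun Q => ρ Q.1
      map_one' := hρ1
      map_mul' := fun Q R => hρmul _ (hmem Q) _ (hmem R) } with hr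
  have hcont : Continuous r := hρcont.comp_continuous continuous_subtype_val hmem
  have hchoose : n * k < n.choose 2 := by
    rw [Nat.choose_two_right, Nat.lt_iff_add_one_le, Nat.le_div_iff_mul_le (by norm_num)]
    have := Nat.mul_le_mul_left n (Nat.succ_le_of_lt hk2)
    rw [Nat.succ_eq_add_one, mul_add, mul_left_comm] at this
    omega
  have hι : 8 ≤ Fintype.card (Fin n) := by rw [Fintype.card_fin]; omega
  obtain ⟨D⟩ := StiefelEmbedding.nonempty_weightProjections (ρ := r) hι
    (by rw [Fintype.card_fin, Fintype.card_fin]; exact hd.trans_lt hchoose)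
  obtain ⟨b, f, hsurj, hequiv, hfix⟩ :=
    D.exists_equivariant_surjective ⟨0, by omega⟩ hι hcont
  have hdim : n * b ≤ d := by
    simpa [Module.finrank_matrix] using LinearMap.finrank_le_finrank_of_surjective hsurj
  have hkb : k ≤ b := by
    by_contra! hbk
    obtain ⟨Y, hY⟩ : ∃ Y : Matrix (Fin n) (Fin k) ℝ, Yᵀ * Y = 1 := by
      refine ⟨(1 : Matrix (Fin n) (Fin n) ℝ).submatrix id (Fin.castLE (by omega)), ?_⟩
      rw [transpose_submatrix, transpose_one, ← submatrix_mul _ _ _ _ _ Function.bijective_id,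
        one_mul, submatrix_one _ (Fin.castLE_injective _)]
    obtain ⟨Q, hQA, hQY⟩ := StiefelEmbedding.exists_mul_eq_and_mul_ne hbk
      (by rw [Fintype.card_fin]; omega) (f (ε Y)) Y hY
    have hYV : Y ∈ V := by rw [hV]; exact hY
    have hQYV : Q.1 * Y ∈ V := by
      rw [hV]
      change (Q.1 * Y)ᵀ * (Q.1 * Y) = 1
      rw [transpose_mul, Matrix.mul_assoc, ← Matrix.mul_assoc Q.1ᵀ, (hmem Q).1, Matrix.one_mul, hY]
    refine hQY (hεinj hQYV hYV ?_)
    rw [hεeqv _ (hmem Q) _ hYV]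
    exact hfix Q _ ((hequiv Q _).trans hQA)
  have hnk : n * k ≤ n * b := Nat.mul_le_mul_left n hkb
  refine ⟨hnk.trans hdim, fun hdk => ?_⟩
  obtain rfl : k = b := Nat.eq_of_mul_eq_mul_left (show 0 < n by omega) (by omega)
  have hinj : Function.Injective f :=
    (LinearMap.injective_iff_surjective_of_finrank_eq_finrank
      (by simp [hdk, Module.finrank_matrix])).2 hsurj
  refine ⟨LinearEquiv.ofBijective f ⟨hinj, hsurj⟩, fun Q hQ v => ?_⟩
  exact hequiv ⟨Q, StiefelEmbedding.mem_specialOrthogonalGroup_of_transpose_mul hQ.1 hQ.2⟩ v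
end

section
/- Let n ≥ 3, p ≥ 1, and let n₁,…,n_{p+1} be positive integers with n₁+⋯+n_{p+1} = n. If A is a real skew-symmetric n×n matrix satisfying QAQᵀ = A for every Q ∈ S(O_{n₁}×⋯×O_{n_{p+1}}), then A = 0. Equivalently, for every nonzero A ∈ Alt²(ℝⁿ), the stabilizer of A under the conjugation action of SO_n(ℝ) does not contain the subgroup S(O_{n₁}×⋯×O_{n_{p+1}}). -/
open Matrix Topology

/-- A diagonal sign matrix with exactly two entries `-1` is special orthogonal. -/
theorem diagonal_two_neg_mem_SOn {n : ℕ} {i k : Fin n} (hik : i ≠ k) :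
    diagonal (fun l => if l = i ∨ l = k then (-1 : ℝ) else 1) ∈ SOn n := by
  refine ⟨?_, ?_⟩
  · rw [diagonal_transpose, diagonal_mul_diagonal, ← diagonal_one]
    congr 1
    funext l
    split_ifs <;> norm_num
  · have hfilter : (Finset.univ.filter fun l => l = i ∨ l = k) = {i, k} := by
      ext l
      simp
    rw [det_diagonal, Finset.prod_ite, hfilter]
    simp [Finset.card_pair hik]

/-- Let `n ≥ 3`, `p ≥ 1`, and let `n₁, …, n_{p+1}` be positive integers
summing to `n` (encoded by the monotone block function `blk` with fibers of cardinality
`nn i`).  If `A` is a real skew-symmetric `n × n` matrix with `Q A Qᵀ = A` for every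
`Q ∈ S(O_{n₁} × ⋯ × O_{n_{p+1}})` (the block-diagonal special orthogonal matrices), then
`A = 0`.  Equivalently, no nonzero skew-symmetric matrix has stabilizer containing
`S(O_{n₁} × ⋯ × O_{n_{p+1}})`. -/
theorem skew_fixed_by_blockOrthogonal_eq_zero
    (n p : ℕ) (hn : 3 ≤ n) (hp : 1 ≤ p)
    (nn : Fin (p + 1) → ℕ) (hpos : ∀ i, 0 < nn i) (hsum : ∑ i, nn i = n)
    (blk : Fin n → Fin (p + 1)) (hmono : Monotone blk)
    (hfib : ∀ i, (Finset.univ.filter fun j => blk j = i).card = nn i)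
    (A : Matrix (Fin n) (Fin n) ℝ) (hA : Aᵀ = -A)
    (hfix : ∀ Q ∈ SOn n, (∀ i j, blk i ≠ blk j → Q i j = 0) → Q * A * Qᵀ = A) :
    A = 0 := by
  ext i j
  rw [Matrix.zero_apply]
  rcases eq_or_ne i j with rfl | hij
  · have h := congrFun (congrFun hA i) i
    rw [transpose_apply, Matrix.neg_apply] at h
    linarith
  · obtain ⟨k, hk⟩ : ∃ k, k ∉ ({i, j} : Finset (Fin n)) := by
      by_contra! hall
      have hcard := Finset.card_le_card (fun l _ => hall l : Finset.univ ⊆ {i, j})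
      rw [Finset.card_univ, Fintype.card_fin, Finset.card_pair hij] at hcard
      omega
    simp only [Finset.mem_insert, Finset.mem_singleton, not_or] at hk
    have h := hfix _ (diagonal_two_neg_mem_SOn (Ne.symm hk.1))
      fun a b hab => diagonal_apply_ne _ fun e => hab (congrArg blk e)
    have hentry := congrFun (congrFun h i) j
    rw [diagonal_transpose, mul_diagonal, diagonal_mul] at hentry
    simp only [true_or, if_true, hij.symm, Ne.symm hk.2, or_self, if_false] at hentry
    linarith
end
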